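/- Let n ≥ 1, a ∈ ℝ with a ≠ 0, α > 0 and β > 2. Then the convolution operator T_{L_{α,β}} with oscillating kernel L_{α,β} is bounded on L²(ℍⁿ_a) if and only if α ≤ (n + 1/2)β. -/

import Mathlib

open MeasureTheory

noncomputable section

/-- The standard `2n × 2n` block matrix `[[0, Iₙ],[−Iₙ, 0]]`. -/
def Jmat (n : ℕ) : Matrix (Fin (2*n)) (Fin (2*n)) ℝ :=
  Matrix.of fun i j =>
    if (i : ℕ) < n ∧ (j : ℕ) = (i : ℕ) + n then 1
    else if n ≤ (i : ℕ) ∧ (i : ℕ) = (j : ℕ) + n then -1 else 0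

/-- Heisenberg group multiplication on `ℝ^{2n} × ℝ`:
`(x,t)·(y,s) = (x+y, s+t−2a xᵀJy)`. -/
def heisMul (n : ℕ) (a : ℝ) (p q : (Fin (2*n) → ℝ) × ℝ) : (Fin (2*n) → ℝ) × ℝ :=
  (p.1 + q.1, q.2 + p.2 - 2 * a * ∑ i, ∑ j, p.1 i * Jmat n i j * q.1 j)

/-- Heisenberg group inverse `(x,t)⁻¹ = (−x,−t)`. -/
def heisInv (n : ℕ) (p : (Fin (2*n) → ℝ) × ℝ) : (Fin (2*n) → ℝ) × ℝ :=
  (-p.1, -p.2)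

/-- The quasi-norm `ρ(x,t) = (|x|⁴ + t²)^{1/4}`. -/
def heisRho (n : ℕ) (p : (Fin (2*n) → ℝ) × ℝ) : ℝ :=
  ((∑ i, p.1 i ^ 2) ^ 2 + p.2 ^ 2) ^ ((1:ℝ)/4)

/-- The critical constant `C_β = ((β+2)/2)(2β+5+√((2β+5)²−9))`. -/
def Cbeta (β : ℝ) : ℝ :=
  ((β + 2)/2) * (2*β + 5 + Real.sqrt ((2*β + 5)^2 - 9))


/-- The group convolution operator `T_K f(x,t) = ∫ K((x,t)·(y,s)⁻¹) f(y,s) dy ds`. -/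
def convOp (n : ℕ) (a : ℝ) (K : (Fin (2*n) → ℝ) × ℝ → ℂ)
    (f : (Fin (2*n) → ℝ) × ℝ → ℂ) : (Fin (2*n) → ℝ) × ℝ → ℂ :=
  fun p => ∫ q, K (heisMul n a p (heisInv n q)) * f q

/-- `T_K` is bounded on `L²(ℍⁿ_a)`: there is `C > 0` with
`‖T_K f‖₂ ≤ C ‖f‖₂` for all `f ∈ C_c^∞`. -/
def IsL2Bounded (n : ℕ) (a : ℝ) (K : (Fin (2*n) → ℝ) × ℝ → ℂ) : Prop :=
  ∃ C > (0:ℝ), ∀ f : (Fin (2*n) → ℝ) × ℝ → ℂ, ContDiff ℝ (⊤ : ℕ∞) f → HasCompactSupport f →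
    eLpNorm (convOp n a K f) 2 volume ≤ ENNReal.ofReal C * eLpNorm f 2 volume

/-- The oscillating kernel
`L_{α,β}(x,t) = ρ(x,t)^{−(2n+2−α)} e^{i ρ(x,t)^{β}} χ(ρ(x,t)⁻¹)`. -/
def Lker (n : ℕ) (α β : ℝ) (χ : ℝ → ℝ) (p : (Fin (2*n) → ℝ) × ℝ) : ℂ :=
  ((heisRho n p ^ (-(2*(n:ℝ) + 2 - α)) : ℝ) : ℂ)
    * Complex.exp (Complex.I * ((heisRho n p ^ β : ℝ) : ℂ))
    * ((χ (heisRho n p)⁻¹ : ℝ) : ℂ)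

section Algebra

variable {n : ℕ}

/-- The symplectic form `xᵀJy`. -/
def symJ (n : ℕ) (x y : Fin (2*n) → ℝ) : ℝ := ∑ i, ∑ j, x i * Jmat n i j * y j

/-- The group quotient `p·q⁻¹`. -/
def heisDiv (n : ℕ) (a : ℝ) (p q : (Fin (2*n) → ℝ) × ℝ) : (Fin (2*n) → ℝ) × ℝ :=
  (p.1 - q.1, p.2 - q.2 + 2 * a * symJ n p.1 q.1)

lemma symJ_add_left (x x' y : Fin (2*n) → ℝ) :
    symJ n (x + x') y = symJ n x y + symJ n x' y := by
  simp [symJ, add_mul, Finset.sum_add_distrib]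

lemma symJ_smul_left (c : ℝ) (x y : Fin (2*n) → ℝ) :
    symJ n (c • x) y = c * symJ n x y := by
  simp [symJ, Finset.mul_sum, mul_assoc]

lemma Jmat_antisymm (i j : Fin (2*n)) : Jmat n i j = - Jmat n j i := by
  have hi := i.2
  have hj := j.2
  simp only [Jmat, Matrix.of_apply]
  split_ifs <;> first | omega | norm_num

lemma symJ_antisymm (x y : Fin (2*n) → ℝ) : symJ n x y = - symJ n y x := by
  unfold symJ
  rw [Finset.sum_comm, ← Finset.sum_neg_distrib]
  refine Finset.sum_congr rfl fun i _ => ?_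
  rw [← Finset.sum_neg_distrib]
  refine Finset.sum_congr rfl fun j _ => ?_
  rw [Jmat_antisymm j i]
  ring

lemma symJ_self (x : Fin (2*n) → ℝ) : symJ n x x = 0 := by
  linarith [symJ_antisymm x x]

lemma symJ_add_right (x y y' : Fin (2*n) → ℝ) :
    symJ n x (y + y') = symJ n x y + symJ n x y' := by
  rw [symJ_antisymm, symJ_add_left, symJ_antisymm y, symJ_antisymm y']; ring

lemma symJ_smul_right (c : ℝ) (x y : Fin (2*n) → ℝ) :
    symJ n x (c • y) = c * symJ n x y := by
  rw [symJ_antisymm, symJ_smul_left, symJ_antisymm y]; ring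

lemma symJ_neg_left (x y : Fin (2*n) → ℝ) : symJ n (-x) y = - symJ n x y := by
  simpa using symJ_smul_left (-1) x y

lemma symJ_neg_right (x y : Fin (2*n) → ℝ) : symJ n x (-y) = - symJ n x y := by
  simpa using symJ_smul_right (-1) x y

lemma symJ_sub_left (x x' y : Fin (2*n) → ℝ) :
    symJ n (x - x') y = symJ n x y - symJ n x' y := by
  rw [sub_eq_add_neg, symJ_add_left, symJ_neg_left, ← sub_eq_add_neg]

lemma symJ_sub_right (x y y' : Fin (2*n) → ℝ) :
    symJ n x (y - y') = symJ n x y - symJ n x y' := by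
  rw [sub_eq_add_neg, symJ_add_right, symJ_neg_right, ← sub_eq_add_neg]

/-- The symplectic form is nondegenerate. -/
lemma exists_symJ_ne_zero {y : Fin (2*n) → ℝ} (hy : y ≠ 0) : ∃ z, symJ n z y ≠ 0 := by
  obtain ⟨k, hk⟩ := Function.ne_iff.1 hy
  have hk2 := k.2
  by_cases hkn : (k : ℕ) < n
  · refine ⟨Pi.single ⟨k + n, by omega⟩ 1, ?_⟩
    have : symJ n (Pi.single ⟨k + n, by omega⟩ 1) y = - y k := by
      unfold symJ
      rw [Finset.sum_eq_single (⟨k + n, by omega⟩ : Fin (2*n)), Finset.sum_eq_single k]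
      · simp [Jmat]
      · intro j _ hj
        have : (j : ℕ) ≠ k := fun h => hj (Fin.ext h)
        have h0 : Jmat n ⟨k + n, by omega⟩ j = 0 := by
          simp only [Jmat, Matrix.of_apply]
          rw [if_neg (by omega), if_neg (by omega)]
        rw [h0]; simp
      · simp
      · intro i _ hi
        simp [Pi.single_eq_of_ne hi]
      · simp
    rw [this]; simpa using hk
  · refine ⟨Pi.single ⟨k - n, by omega⟩ 1, ?_⟩
    have : symJ n (Pi.single ⟨k - n, by omega⟩ 1) y = y k := by
      unfold symJ
      rw [Finset.sum_eq_single (⟨k - n, by omega⟩ : Fin (2*n)), Finset.sum_eq_single k]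
      · simp [Jmat]; omega
      · intro j _ hj
        have : (j : ℕ) ≠ k := fun h => hj (Fin.ext h)
        have h0 : Jmat n ⟨k - n, by omega⟩ j = 0 := by
          simp only [Jmat, Matrix.of_apply]
          rw [if_neg (by omega), if_neg (by omega)]
        rw [h0]; simp
      · simp
      · intro i _ hi
        simp [Pi.single_eq_of_ne hi]
      · simp
    rw [this]; simpa using hk

@[fun_prop]
lemma ContDiff.symJ {F : Type*} [NormedAddCommGroup F] [NormedSpace ℝ F] {m : WithTop ℕ∞}
    {f g : F → Fin (2*n) → ℝ} (hf : ContDiff ℝ m f) (hg : ContDiff ℝ m g) :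
    ContDiff ℝ m (fun x => symJ n (f x) (g x)) := by
  unfold _root_.symJ
  refine ContDiff.sum fun i _ => ContDiff.sum fun j _ => ?_
  have h1 := contDiff_pi.1 hf i
  have h2 := contDiff_pi.1 hg j
  fun_prop

@[fun_prop]
lemma Continuous.symJ {F : Type*} [TopologicalSpace F]
    {f g : F → Fin (2*n) → ℝ} (hf : Continuous f) (hg : Continuous g) :
    Continuous (fun x => symJ n (f x) (g x)) := by
  unfold _root_.symJ
  fun_prop

variable {a : ℝ}

lemma heisMul_eq (p q : (Fin (2*n) → ℝ) × ℝ) :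
    heisMul n a p q = (p.1 + q.1, q.2 + p.2 - 2 * a * symJ n p.1 q.1) := rfl

lemma heisMul_heisInv (p q : (Fin (2*n) → ℝ) × ℝ) :
    heisMul n a p (heisInv n q) = heisDiv n a p q := by
  rw [heisMul_eq]
  simp only [heisInv, heisDiv, symJ_neg_right]
  ext <;> simp <;> ring

@[fun_prop]
lemma Continuous.heisDiv {F : Type*} [TopologicalSpace F]
    {f g : F → (Fin (2*n) → ℝ) × ℝ} (hf : Continuous f) (hg : Continuous g) :
    Continuous (fun x => heisDiv n a (f x) (g x)) := by
  unfold _root_.heisDiv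
  fun_prop

@[fun_prop]
lemma Continuous.heisMul {F : Type*} [TopologicalSpace F]
    {f g : F → (Fin (2*n) → ℝ) × ℝ} (hf : Continuous f) (hg : Continuous g) :
    Continuous (fun x => heisMul n a (f x) (g x)) := by
  simp only [heisMul_eq]
  fun_prop

@[fun_prop]
lemma ContDiff.heisDiv {F : Type*} [NormedAddCommGroup F] [NormedSpace ℝ F] {m : WithTop ℕ∞}
    {f g : F → (Fin (2*n) → ℝ) × ℝ} (hf : ContDiff ℝ m f) (hg : ContDiff ℝ m g) :
    ContDiff ℝ m (fun x => heisDiv n a (f x) (g x)) := by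
  unfold _root_.heisDiv
  fun_prop

lemma heisDiv_heisMul (p q r : (Fin (2*n) → ℝ) × ℝ) :
    heisDiv n a p (heisMul n a q r) = heisDiv n a (heisDiv n a p r) q := by
  simp only [heisMul_eq, heisDiv, symJ_add_right, symJ_sub_left]
  rw [symJ_antisymm r.1 q.1]
  ext <;> simp <;> ring

lemma heisMul_heisDiv_cancel (q r : (Fin (2*n) → ℝ) × ℝ) :
    heisDiv n a (heisMul n a q r) r = q := by
  simp only [heisMul_eq, heisDiv, symJ_add_left, symJ_self]
  ext
  · simp
  · simp; ring

lemma heisDiv_heisMul_cancel (q r : (Fin (2*n) → ℝ) × ℝ) :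
    heisMul n a (heisDiv n a q r) r = q := by
  simp only [heisMul_eq, heisDiv, symJ_sub_left, symJ_self]
  ext
  · simp
  · simp; ring

lemma heisInv_heisDiv (p q : (Fin (2*n) → ℝ) × ℝ) :
    heisInv n (heisDiv n a p q) = heisDiv n a q p := by
  simp only [heisInv, heisDiv]
  rw [symJ_antisymm p.1 q.1]
  ext <;> simp; ring

lemma heisDiv_zero (p : (Fin (2*n) → ℝ) × ℝ) : heisDiv n a p 0 = p := by
  simp [heisDiv, symJ]

lemma heisDiv_heisDiv_self (p v : (Fin (2*n) → ℝ) × ℝ) :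
    heisDiv n a p (heisDiv n a (heisInv n v) (heisInv n p)) = v := by
  simp only [heisInv, heisDiv, symJ_sub_right, symJ_self, symJ_neg_left, symJ_neg_right]
  rw [symJ_antisymm v.1 p.1]
  ext <;> simp; ring

/-- `P(x,t) = |x|⁴ + t²`, the fourth power of the quasi-norm. -/
def heisP (n : ℕ) (p : (Fin (2*n) → ℝ) × ℝ) : ℝ := (∑ i, p.1 i ^ 2) ^ 2 + p.2 ^ 2

lemma heisRho_eq (p : (Fin (2*n) → ℝ) × ℝ) : heisRho n p = heisP n p ^ ((1:ℝ)/4) := rfl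

lemma heisP_nonneg (p : (Fin (2*n) → ℝ) × ℝ) : 0 ≤ heisP n p := by
  unfold heisP; positivity

lemma heisP_eq_zero {p : (Fin (2*n) → ℝ) × ℝ} : heisP n p = 0 ↔ p = 0 := by
  constructor
  · intro h
    unfold heisP at h
    have h1 : (∑ i, p.1 i ^ 2) = 0 := by nlinarith [sq_nonneg (∑ i, p.1 i ^ 2), sq_nonneg p.2]
    have h2 : p.2 = 0 := by nlinarith [sq_nonneg (∑ i, p.1 i ^ 2), sq_nonneg p.2]
    rw [Finset.sum_eq_zero_iff_of_nonneg (fun i _ => sq_nonneg _)] at h1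
    ext i
    · simpa using h1 i (Finset.mem_univ _)
    · simpa using h2
  · rintro rfl; simp [heisP]

lemma heisP_pos {p : (Fin (2*n) → ℝ) × ℝ} (hp : p ≠ 0) : 0 < heisP n p :=
  lt_of_le_of_ne (heisP_nonneg p) fun h => hp (heisP_eq_zero.1 h.symm)

@[fun_prop]
lemma ContDiff.heisP {F : Type*} [NormedAddCommGroup F] [NormedSpace ℝ F] {m : WithTop ℕ∞}
    {f : F → (Fin (2*n) → ℝ) × ℝ} (hf : ContDiff ℝ m f) :
    ContDiff ℝ m (fun x => heisP n (f x)) := by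
  unfold _root_.heisP
  have h1 : ∀ i, ContDiff ℝ m (fun x => (f x).1 i) := fun i => contDiff_pi.1 hf.fst i
  refine ContDiff.add (ContDiff.pow (ContDiff.sum fun i _ => (h1 i).pow 2) 2) (hf.snd.pow 2)

@[fun_prop]
lemma continuous_heisP : Continuous (heisP n) := by
  unfold heisP; fun_prop

lemma heisP_heisInv (p : (Fin (2*n) → ℝ) × ℝ) : heisP n (heisInv n p) = heisP n p := by
  simp [heisP, heisInv]

lemma norm_sq_le_heisP (p : (Fin (2*n) → ℝ) × ℝ) : ‖p‖ ^ 2 ≤ 1 + heisP n p := by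
  have hx : ‖p.1‖ ^ 2 ≤ ∑ i, p.1 i ^ 2 := by
    have hs : 0 ≤ ∑ i, p.1 i ^ 2 := Finset.sum_nonneg fun i _ => sq_nonneg _
    have : ‖p.1‖ ≤ √(∑ i, p.1 i ^ 2) := by
      rw [pi_norm_le_iff_of_nonneg (Real.sqrt_nonneg _)]
      intro i
      rw [Real.norm_eq_abs, ← Real.sqrt_sq_eq_abs]
      exact Real.sqrt_le_sqrt (Finset.single_le_sum (f := fun i => p.1 i ^ 2)
        (fun i _ => sq_nonneg _) (Finset.mem_univ i))
    calc ‖p.1‖ ^ 2 ≤ √(∑ i, p.1 i ^ 2) ^ 2 := by gcongr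
      _ = _ := Real.sq_sqrt hs
  rw [Prod.norm_def]
  unfold heisP
  rcases max_cases ‖p.1‖ ‖p.2‖ with ⟨h, _⟩ | ⟨h, _⟩ <;> rw [h]
  · nlinarith [sq_nonneg ((∑ i, p.1 i ^ 2) - 1), sq_nonneg p.2]
  · rw [Real.norm_eq_abs, sq_abs]; nlinarith [sq_nonneg (∑ i, p.1 i ^ 2)]

lemma isCompact_heisP_Icc (c M : ℝ) : IsCompact {p : (Fin (2*n) → ℝ) × ℝ | c ≤ heisP n p ∧ heisP n p ≤ M} := by
  refine Metric.isCompact_of_isClosed_isBounded ?_ ?_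
  · exact (isClosed_le continuous_const continuous_heisP).inter
      (isClosed_le continuous_heisP continuous_const)
  · refine Metric.isBounded_iff_subset_closedBall 0 |>.2 ⟨1 + (1 + |M|), ?_⟩
    intro p hp
    rw [mem_closedBall_zero_iff]
    have := norm_sq_le_heisP p
    have h2 := hp.2
    nlinarith [le_abs_self M, norm_nonneg p, abs_nonneg M]

end Algebra

section MeasurePreserving

variable {n : ℕ} {a : ℝ}

lemma measurePreserving_heisMul_right (r : (Fin (2*n) → ℝ) × ℝ) :
    MeasurePreserving (fun p => heisMul n a p r) volume volume := by
  simp only [heisMul_eq]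
  refine MeasurePreserving.skew_product (μa := (volume : Measure (Fin (2*n) → ℝ)))
    (μc := (volume : Measure ℝ)) (f := fun x => x + r.1)
    (g := fun x t => r.2 + t - 2 * a * symJ n x r.1)
    (measurePreserving_add_right volume r.1) ?_ ?_
  · apply Continuous.measurable
    simp only [Function.uncurry_def]
    fun_prop
  · refine Filter.Eventually.of_forall fun x => ?_
    have := (measurePreserving_add_right (volume : Measure ℝ) (r.2 - 2 * a * symJ n x r.1)).map_eq
    rw [← this]
    congr 1
    funext t; ring

lemma measurePreserving_heisDiv_right (r : (Fin (2*n) → ℝ) × ℝ) :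
    MeasurePreserving (fun p => heisDiv n a p r) volume volume := by
  simpa only [heisMul_heisInv] using measurePreserving_heisMul_right (a := a) (heisInv n r)

lemma measurePreserving_heisDiv_left (p : (Fin (2*n) → ℝ) × ℝ) :
    MeasurePreserving (fun q => heisDiv n a p q) volume volume := by
  unfold heisDiv
  refine MeasurePreserving.skew_product (μa := (volume : Measure (Fin (2*n) → ℝ)))
    (μc := (volume : Measure ℝ)) (f := fun x => p.1 - x)
    (g := fun x t => p.2 - t + 2 * a * symJ n p.1 x)
    (Measure.measurePreserving_sub_left volume p.1) ?_ ?_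
  · apply Continuous.measurable
    simp only [Function.uncurry_def]
    fun_prop
  · refine Filter.Eventually.of_forall fun x => ?_
    have := (Measure.measurePreserving_sub_left (volume : Measure ℝ)
      (p.2 + 2 * a * symJ n p.1 x)).map_eq
    rw [← this]
    congr 1
    funext t; ring

end MeasurePreserving

section NonstationaryPhase

open Module
open scoped ContDiff

variable {E Θ : Type*} [NormedAddCommGroup E] [NormedSpace ℝ E] [FiniteDimensional ℝ E]
  [MeasurableSpace E] [BorelSpace E] [NormedAddCommGroup Θ] [NormedSpace ℝ Θ]

/-- The integral of a directional derivative of a compactly supported `C¹` function vanishes. -/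
lemma integral_fderiv_apply_eq_zero (μ : Measure E) [μ.IsAddHaarMeasure] {W : E → ℂ}
    (hW : ContDiff ℝ 1 W) (hc : HasCompactSupport W) (v : E) :
    ∫ x, fderiv ℝ W x v ∂μ = 0 := by
  have hcd : HasCompactSupport (fun x => fderiv ℝ W x v) := by
    have := hc.fderiv (𝕜 := ℝ)
    exact this.comp_left (g := fun L : E →L[ℝ] ℂ => L v) (by simp)
  have hcont : Continuous (fun x => fderiv ℝ W x v) :=
    (hW.continuous_fderiv one_ne_zero).clm_apply continuous_const
  have h := integral_mul_fderiv_eq_neg_fderiv_mul_of_integrable (μ := μ) (f := fun _ : E => (1 : ℂ))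
    (g := W) (v := v) (by simp)
    (by simpa using hcont.integrable_of_hasCompactSupport hcd)
    (by simpa using hW.continuous.integrable_of_hasCompactSupport hc)
    (fun x _ => differentiableAt_const _) (fun x _ => (hW.differentiable one_ne_zero) x)
  simpa using h

omit [FiniteDimensional ℝ E] [MeasurableSpace E] [BorelSpace E] in
lemma contDiff_slice {F : Type*} [NormedAddCommGroup F] [NormedSpace ℝ F]
    {U S : Set (E × Θ)} (hU : IsOpen U) (hS : IsClosed S) (hSU : S ⊆ U) {G : E × Θ → F}
    {m : WithTop ℕ∞}
    (hG : ContDiffOn ℝ m G U) {θ : Θ} (hz : ∀ q, (q, θ) ∉ S → G (q, θ) = 0)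
    {u : E → ℂ} (hu : ∀ q, (q, θ) ∈ U → ContDiffAt ℝ m u q) [NormedSpace ℂ F] :
    ContDiff ℝ m (fun q => u q • G (q, θ)) := by
  rw [contDiff_iff_contDiffAt]
  intro q
  by_cases hq : (q, θ) ∈ U
  · refine (hu q hq).smul ?_
    exact ContDiffAt.comp q (f := fun q : E => (q, θ)) ((hG (q, θ) hq).contDiffAt (hU.mem_nhds hq))
      (contDiffAt_id.prodMk contDiffAt_const)
  · have hq' : (q, θ) ∉ S := fun h => hq (hSU h)
    have : (fun q => u q • G (q, θ)) =ᶠ[nhds q] fun _ => 0 := by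
      have ho : IsOpen ((fun q : E => (q, θ)) ⁻¹' Sᶜ) :=
        hS.isOpen_compl.preimage (by fun_prop)
      filter_upwards [ho.mem_nhds hq'] with x hx
      rw [hz x hx, smul_zero]
    exact contDiffAt_const.congr_of_eventuallyEq this

omit [NormedSpace ℝ E] [FiniteDimensional ℝ E] [MeasurableSpace E] [BorelSpace E]
  [NormedSpace ℝ Θ] in
lemma hasCompactSupport_slice {F : Type*} [NormedAddCommGroup F]
    {S : Set (E × Θ)} (hS : IsCompact S) {θ : Θ} {g : E → F}
    (hz : ∀ q, (q, θ) ∉ S → g q = 0) : HasCompactSupport g :=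
  HasCompactSupport.intro (hS.image continuous_fst)
    fun q hq => hz q fun h => hq ⟨_, h, rfl⟩

/-- Nonstationary phase with parameters: if a smooth vector field `V` satisfies
`dψ(V) = μ` on the support of the amplitude, the oscillatory integral is `O(μ^{-N})`. -/
theorem nonstationary_phase (ν : Measure E) [ν.IsAddHaarMeasure]
    {U S : Set (E × Θ)} (hU : IsOpen U) (hS : IsCompact S) (hSU : S ⊆ U) (K : Set Θ)
    {V : E × Θ → E} (hV : ContDiffOn ℝ ∞ V U) (N : ℕ) :
    ∀ G : E × Θ → ℂ, ContDiffOn ℝ ∞ G U →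
    (∀ q, ∀ θ ∈ K, (q, θ) ∉ S → G (q, θ) = 0) →
    ∃ C : ℝ, 0 ≤ C ∧ ∀ θ ∈ K, ∀ (ψ : E → ℝ) (μ : ℝ), 0 < μ →
      (∀ q, (q, θ) ∈ U → ContDiffAt ℝ 1 ψ q) →
      (∀ q, (q, θ) ∈ S → fderiv ℝ ψ q (V (q, θ)) = μ) →
      ‖∫ q, Complex.exp (Complex.I * (ψ q : ℂ)) * G (q, θ) ∂ν‖ ≤ C * (μ ^ N)⁻¹ := by
  induction N with
  | zero =>
    intro G hG hz
    obtain ⟨M, hM⟩ := hS.exists_bound_of_continuousOn (hG.continuousOn.mono hSU)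
    have hfin : ν (Prod.fst '' S) < ⊤ := (hS.image continuous_fst).measure_lt_top
    refine ⟨max M 0 * ν.real (Prod.fst '' S), by positivity, ?_⟩
    intro θ hθ ψ μ hμ hψ hψV
    have hzero : ∀ q, q ∉ Prod.fst '' S → Complex.exp (Complex.I * (ψ q : ℂ)) * G (q, θ) = 0 := by
      intro q hq
      rw [hz q θ hθ (fun h => hq ⟨_, h, rfl⟩), mul_zero]
    rw [← setIntegral_eq_integral_of_forall_compl_eq_zero hzero, pow_zero, inv_one, mul_one]
    refine norm_setIntegral_le_of_norm_le_const hfin ?_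
    intro q hq
    rw [norm_mul, mul_comm Complex.I, Complex.norm_exp_ofReal_mul_I, one_mul]
    by_cases h : (q, θ) ∈ S
    · exact (hM _ h).trans (le_max_left _ _)
    · rw [hz q θ hθ h, norm_zero]; exact le_max_right _ _
  | succ N ih =>
    intro G hG hz
    classical
    set b := finBasis ℝ E with hb
    let c : Fin (finrank ℝ E) → E × Θ → ℝ := fun k x => b.coord k (V x)
    have hc : ∀ k, ContDiffOn ℝ ∞ (c k) U := by
      intro k
      have : c k = fun x => (LinearMap.toContinuousLinearMap (b.coord k)) (V x) := rfl
      rw [this]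
      exact (ContinuousLinearMap.contDiff _).comp_contDiffOn hV
    let F : Fin (finrank ℝ E) → E × Θ → ℂ := fun k x => (c k x : ℂ) * G x
    have hF : ∀ k, ContDiffOn ℝ ∞ (F k) U := by
      intro k
      exact (Complex.ofRealCLM.contDiff.comp_contDiffOn (hc k)).mul hG
    have hFz : ∀ k, ∀ q, ∀ θ ∈ K, (q, θ) ∉ S → F k (q, θ) = 0 := by
      intro k q θ hθ h
      simp only [F, hz q θ hθ h, mul_zero]
    let D : Fin (finrank ℝ E) → E × Θ → ℂ :=
      fun k x => fderiv ℝ (fun q => F k (q, x.2)) x.1 (b k)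
    have hDeq : ∀ k, ∀ x ∈ U, D k x = fderiv ℝ (F k) x (b k, 0) := by
      intro k x hx
      have h1 : HasFDerivAt (F k) (fderiv ℝ (F k) x) (x.1, x.2) :=
        (((hF k) x hx).contDiffAt (hU.mem_nhds hx)).differentiableAt (by simp) |>.hasFDerivAt
      have h2 : HasFDerivAt (fun q : E => (q, x.2)) (ContinuousLinearMap.inl ℝ E Θ) x.1 :=
        hasFDerivAt_prodMk_left x.1 x.2
      have h3 := (h1.comp x.1 h2).fderiv
      simp only [D]
      have h4 : (fun q => F k (q, x.2)) = F k ∘ fun q : E => (q, x.2) := rfl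
      rw [h4, h3]
      simp
    have hD : ∀ k, ContDiffOn ℝ ∞ (D k) U := by
      intro k
      refine ContDiffOn.congr ?_ (hDeq k)
      exact ((hF k).fderiv_of_isOpen hU (by simp)).clm_apply contDiffOn_const
    have hDz : ∀ k, ∀ q, ∀ θ ∈ K, (q, θ) ∉ S → D k (q, θ) = 0 := by
      intro k q θ hθ h
      have : (fun q => F k (q, θ)) =ᶠ[nhds q] fun _ => 0 := by
        have ho : IsOpen ((fun q : E => (q, θ)) ⁻¹' Sᶜ) :=
          hS.isClosed.isOpen_compl.preimage (by fun_prop)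
        filter_upwards [ho.mem_nhds h] with x hx
        exact hFz k x θ hθ hx
      simp only [D]
      rw [this.fderiv_eq]
      simp
    obtain ⟨C, hC0, hC⟩ := ih (fun x => ∑ k, D k x) (ContDiffOn.sum fun k _ => hD k)
      (fun q θ hθ h => Finset.sum_eq_zero fun k _ => hDz k q θ hθ h)
    refine ⟨C, hC0, ?_⟩
    intro θ hθ ψ μ hμ hψ hψV
    have key := hC θ hθ ψ μ hμ hψ hψV
    have hexp : ∀ q, (q, θ) ∈ U →
        ContDiffAt ℝ 1 (fun q => Complex.exp (Complex.I * (ψ q : ℂ))) q := by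
      intro q hq
      exact (contDiffAt_const.mul (Complex.ofRealCLM.contDiff.contDiffAt.comp q (hψ q hq))).cexp
    have hW : ∀ k, ContDiff ℝ 1 (fun q => Complex.exp (Complex.I * (ψ q : ℂ)) • F k (q, θ)) :=
      fun k => contDiff_slice hU hS.isClosed hSU ((hF k).of_le (by simp))
        (fun q hq => hFz k q θ hθ hq) hexp
    have hWc : ∀ k, HasCompactSupport
        (fun q => Complex.exp (Complex.I * (ψ q : ℂ)) • F k (q, θ)) :=
      fun k => hasCompactSupport_slice hS fun q hq => by rw [hFz k q θ hθ hq, smul_zero]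
    have hint : ∀ k, Integrable (fun q => fderiv ℝ
        (fun q => Complex.exp (Complex.I * (ψ q : ℂ)) • F k (q, θ)) q (b k)) ν := by
      intro k
      refine (((hW k).continuous_fderiv one_ne_zero).clm_apply
        continuous_const).integrable_of_hasCompactSupport ?_
      exact ((hWc k).fderiv (𝕜 := ℝ)).comp_left (g := fun L : E →L[ℝ] ℂ => L (b k)) (by simp)
    have hsum : ∫ q, ∑ k, fderiv ℝ
        (fun q => Complex.exp (Complex.I * (ψ q : ℂ)) • F k (q, θ)) q (b k) ∂ν = 0 := by
      rw [integral_finsetSum _ (fun k _ => hint k)]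
      exact Finset.sum_eq_zero fun k _ => integral_fderiv_apply_eq_zero ν (hW k) (hWc k) _
    have hpt : ∀ q, ∑ k, fderiv ℝ
        (fun q => Complex.exp (Complex.I * (ψ q : ℂ)) • F k (q, θ)) q (b k)
        = (Complex.I * μ) * (Complex.exp (Complex.I * (ψ q : ℂ)) * G (q, θ))
          + Complex.exp (Complex.I * (ψ q : ℂ)) * ∑ k, D k (q, θ) := by
      intro q
      by_cases hq : (q, θ) ∈ S
      · have hqU := hSU hq
        have e1 : HasFDerivAt ψ (fderiv ℝ ψ q) q :=
          ((hψ q hqU).differentiableAt one_ne_zero).hasFDerivAt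
        have e2 : HasFDerivAt (fun q => Complex.exp (Complex.I * (ψ q : ℂ)))
            (Complex.exp (Complex.I * (ψ q : ℂ)) • (Complex.I •
              (Complex.ofRealCLM.comp (fderiv ℝ ψ q)))) q := by
          have := (Complex.ofRealCLM.hasFDerivAt.comp q e1).const_mul Complex.I
          exact this.cexp
        have e3 : ∀ k, fderiv ℝ
            (fun q => Complex.exp (Complex.I * (ψ q : ℂ)) • F k (q, θ)) q (b k)
            = Complex.exp (Complex.I * (ψ q : ℂ)) * D k (q, θ)
              + Complex.exp (Complex.I * (ψ q : ℂ)) * (Complex.I * (fderiv ℝ ψ q (b k) : ℝ))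
                * ((c k (q, θ) : ℂ) * G (q, θ)) := by
          intro k
          have hFd : DifferentiableAt ℝ (fun q => F k (q, θ)) q := by
            have hh := contDiff_slice hU hS.isClosed hSU ((hF k).of_le (m := 1) (by simp))
              (fun q hq => hFz k q θ hθ hq) (u := fun _ => 1) (fun _ _ => contDiffAt_const)
            simpa using (hh.differentiable one_ne_zero) q
          have e6 := (e2.smul hFd.hasFDerivAt).fderiv
          have e7 := congrArg (fun L : E →L[ℝ] ℂ => L (b k)) e6
          refine e7.trans ?_
          simp [D, F]
        rw [Finset.sum_congr rfl fun k _ => e3 k, Finset.sum_add_distrib, ← Finset.mul_sum]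
        have e4 : ∑ k, c k (q, θ) * fderiv ℝ ψ q (b k) = μ := by
          rw [← hψV q hq]
          conv_rhs => rw [← b.sum_repr (V (q, θ))]
          rw [map_sum]
          simp [c, -Basis.sum_repr]
        have e5 : (∑ k, (c k (q, θ) : ℂ) * ((fderiv ℝ ψ q (b k) : ℝ) : ℂ)) = μ := by
          rw [← e4]; push_cast; rfl
        rw [← e5, add_comm]
        congr 1
        rw [Finset.mul_sum, Finset.sum_mul]
        refine Finset.sum_congr rfl fun k _ => ?_
        ring
      · have : ∀ k, fderiv ℝ
            (fun q => Complex.exp (Complex.I * (ψ q : ℂ)) • F k (q, θ)) q (b k) = 0 := by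
          intro k
          have : (fun q => Complex.exp (Complex.I * (ψ q : ℂ)) • F k (q, θ)) =ᶠ[nhds q]
              fun _ => 0 := by
            have ho : IsOpen ((fun q : E => (q, θ)) ⁻¹' Sᶜ) :=
              hS.isClosed.isOpen_compl.preimage (by fun_prop)
            filter_upwards [ho.mem_nhds hq] with x hx
            rw [hFz k x θ hθ hx, smul_zero]
          rw [this.fderiv_eq]
          simp
        rw [Finset.sum_eq_zero fun k _ => this k,
          Finset.sum_eq_zero fun k _ => hDz k q θ hθ hq, hz q θ hθ hq]
        simp
    have hI1 : Integrable (fun q => Complex.exp (Complex.I * (ψ q : ℂ)) * G (q, θ)) ν := by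
      have h := contDiff_slice hU hS.isClosed hSU (hG.of_le (m := 1) (by simp))
        (fun q hq => hz q θ hθ hq) hexp
      exact h.continuous.integrable_of_hasCompactSupport
        (hasCompactSupport_slice hS fun q hq => by rw [hz q θ hθ hq, smul_zero])
    have hI2 : Integrable (fun q => Complex.exp (Complex.I * (ψ q : ℂ)) * ∑ k, D k (q, θ)) ν := by
      have h := contDiff_slice hU hS.isClosed hSU
        (G := fun x => ∑ k, D k x)
        ((ContDiffOn.sum fun k _ => hD k).of_le (m := 1) (by simp))
        (fun q hq => Finset.sum_eq_zero fun k _ => hDz k q θ hθ hq) hexp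
      exact h.continuous.integrable_of_hasCompactSupport
        (hasCompactSupport_slice hS fun q hq => by
          rw [Finset.sum_eq_zero fun k _ => hDz k q θ hθ hq, smul_zero])
    rw [integral_congr_ae (Filter.Eventually.of_forall hpt),
      integral_add (hI1.const_mul _) hI2, integral_const_mul] at hsum
    have hn : ‖(Complex.I * μ) *
        ∫ q, Complex.exp (Complex.I * (ψ q : ℂ)) * G (q, θ) ∂ν‖ ≤ C * (μ ^ N)⁻¹ := by
      rw [eq_neg_of_add_eq_zero_left hsum, norm_neg]
      exact key
    rw [norm_mul, norm_mul, Complex.norm_I, one_mul, Complex.norm_real, Real.norm_eq_abs,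
      abs_of_pos hμ] at hn
    rw [pow_succ, mul_inv, ← mul_assoc, ← div_eq_mul_inv _ μ, le_div_iff₀ hμ]
    linarith
end NonstationaryPhase

section Convolution

variable {n : ℕ} {a : ℝ}

lemma convOp_eq (K f : (Fin (2*n) → ℝ) × ℝ → ℂ) (p : (Fin (2*n) → ℝ) × ℝ) :
    convOp n a K f p = ∫ q, K (heisDiv n a p q) * f q := by
  simp only [convOp, heisMul_heisInv]

lemma convOp_continuous {K f : (Fin (2*n) → ℝ) × ℝ → ℂ} (hK : Continuous K)
    (hf : Continuous f) (hfc : HasCompactSupport f) : Continuous (convOp n a K f) := by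
  have h : convOp n a K f = fun p => ∫ q in tsupport f, K (heisDiv n a p q) * f q := by
    funext p
    rw [convOp_eq, setIntegral_eq_integral_of_forall_compl_eq_zero]
    intro q hq
    rw [image_eq_zero_of_notMem_tsupport hq, mul_zero]
  rw [h]
  refine continuous_parametric_integral_of_continuous ?_ hfc
  simp only [Function.uncurry_def]
  fun_prop

lemma convOp_hasCompactSupport {K f : (Fin (2*n) → ℝ) × ℝ → ℂ} (hKc : HasCompactSupport K)
    (hfc : HasCompactSupport f) : HasCompactSupport (convOp n a K f) := by
  have hcpt : IsCompact ((fun x : ((Fin (2*n) → ℝ) × ℝ) × ((Fin (2*n) → ℝ) × ℝ) =>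
      heisMul n a x.1 x.2) '' (tsupport K ×ˢ tsupport f)) :=
    (IsCompact.prod hKc hfc).image (by fun_prop)
  refine HasCompactSupport.intro hcpt fun p hp => ?_
  rw [convOp_eq]
  refine integral_eq_zero_of_ae (Filter.Eventually.of_forall fun q => ?_)
  by_contra hne
  have h1 : K (heisDiv n a p q) ≠ 0 := left_ne_zero_of_mul hne
  have h2 : f q ≠ 0 := right_ne_zero_of_mul hne
  exact hp ⟨(heisDiv n a p q, q), ⟨subset_tsupport _ h1, subset_tsupport _ h2⟩,
    heisDiv_heisMul_cancel p q⟩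

lemma convOp_assoc {K K' f : (Fin (2*n) → ℝ) × ℝ → ℂ} (hK : Continuous K)
    (hKc : HasCompactSupport K) (hK' : Continuous K') (hKc' : HasCompactSupport K')
    (hf : Continuous f) (hfc : HasCompactSupport f) :
    convOp n a K (convOp n a K' f) = convOp n a (convOp n a K K') f := by
  funext p
  rw [convOp_eq]
  have h1 : ∀ q, K (heisDiv n a p q) * convOp n a K' f q
      = ∫ r, K (heisDiv n a p q) * (K' (heisDiv n a q r) * f r) := by
    intro q
    rw [convOp_eq, integral_const_mul]
  simp_rw [h1]
  rw [integral_integral_swap_of_hasCompactSupport]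
  · rw [convOp_eq]
    refine integral_congr_ae (Filter.Eventually.of_forall fun r => ?_)
    simp only
    rw [convOp_eq, ← integral_mul_const,
      ← (measurePreserving_heisMul_right (a := a) r).integral_comp' (f :=
        { toFun := fun q => heisMul n a q r
          invFun := fun q => heisDiv n a q r
          left_inv := fun q => heisMul_heisDiv_cancel q r
          right_inv := fun q => heisDiv_heisMul_cancel q r
          measurable_toFun := (show Continuous fun q => heisMul n a q r by fun_prop).measurable
          measurable_invFun := (show Continuous fun q => heisDiv n a q r by fun_prop).measurable })]
    refine integral_congr_ae (Filter.Eventually.of_forall fun q => ?_)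
    simp only [MeasurableEquiv.coe_mk, Equiv.coe_fn_mk]
    rw [heisDiv_heisMul, heisMul_heisDiv_cancel, mul_assoc]
  · simp only [Function.uncurry_def]
    fun_prop
  · have hcpt : IsCompact ((fun x : ((Fin (2*n) → ℝ) × ℝ) × ((Fin (2*n) → ℝ) × ℝ) =>
      (heisMul n a x.1 x.2, x.2)) '' (tsupport K' ×ˢ tsupport f)) :=
      (IsCompact.prod hKc' hfc).image (by fun_prop)
    refine HasCompactSupport.intro hcpt fun x hx => ?_
    by_contra hne
    simp only [Function.uncurry] at hne
    have h2 := right_ne_zero_of_mul hne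
    exact hx ⟨(heisDiv n a x.1 x.2, x.2), ⟨subset_tsupport _ (left_ne_zero_of_mul h2),
      subset_tsupport _ (right_ne_zero_of_mul h2)⟩, by simp [heisDiv_heisMul_cancel]⟩

/-- For a kernel invariant under inversion, the adjoint is convolution with the conjugate. -/
lemma convOp_adjoint {K f g : (Fin (2*n) → ℝ) × ℝ → ℂ} (hK : Continuous K)
    (hsymm : ∀ p, K (heisInv n p) = K p)
    (hf : Continuous f) (hfc : HasCompactSupport f)
    (hg : Continuous g) (hgc : HasCompactSupport g) :
    ∫ p, g p * starRingEnd ℂ (convOp n a K f p)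
      = ∫ q, convOp n a (fun p => starRingEnd ℂ (K p)) g q * starRingEnd ℂ (f q) := by
  have h1 : ∀ p, g p * starRingEnd ℂ (convOp n a K f p)
      = ∫ q, g p * (starRingEnd ℂ (K (heisDiv n a p q)) * starRingEnd ℂ (f q)) := by
    intro p
    rw [convOp_eq, ← integral_conj, integral_const_mul]
    simp only [map_mul]
  have h2 : ∀ q, convOp n a (fun p => starRingEnd ℂ (K p)) g q * starRingEnd ℂ (f q)
      = ∫ p, g p * (starRingEnd ℂ (K (heisDiv n a p q)) * starRingEnd ℂ (f q)) := by
    intro q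
    rw [convOp_eq, ← integral_mul_const]
    refine integral_congr_ae (Filter.Eventually.of_forall fun p => ?_)
    simp only
    rw [← heisInv_heisDiv, hsymm]
    ring
  simp_rw [h1, h2]
  have hconj : Continuous (starRingEnd ℂ) := Complex.continuous_conj
  rw [integral_integral_swap_of_hasCompactSupport]
  · simp only [Function.uncurry_def]
    fun_prop
  · refine HasCompactSupport.intro (IsCompact.prod hgc hfc) fun x hx => ?_
    by_contra hne
    simp only [Function.uncurry] at hne
    have h2 := right_ne_zero_of_mul (right_ne_zero_of_mul hne)
    refine hx ⟨subset_tsupport _ (left_ne_zero_of_mul hne), subset_tsupport _ ?_⟩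
    simpa using h2

lemma sq_lintegral_mul_le {X : Type*} [MeasurableSpace X] {μ : Measure X} {k f : X → ENNReal}
    (hk : Measurable k) (hf : Measurable f) :
    (∫⁻ x, k x * f x ∂μ) ^ 2 ≤ (∫⁻ x, k x ∂μ) * ∫⁻ x, k x * f x ^ 2 ∂μ := by
  have hpq : (2 : ℝ).HolderConjugate 2 := Real.HolderConjugate.two_two
  have h := ENNReal.lintegral_mul_le_Lp_mul_Lq μ hpq
    (f := fun x => k x ^ (1/2 : ℝ)) (g := fun x => k x ^ (1/2 : ℝ) * f x)
    (hk.pow_const _).aemeasurable ((hk.pow_const _).mul hf).aemeasurable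
  have e1 : ∀ x, (k x ^ (1/2 : ℝ)) * (k x ^ (1/2 : ℝ) * f x) = k x * f x := by
    intro x
    rw [← mul_assoc, ← ENNReal.rpow_add_of_nonneg _ _ (by norm_num) (by norm_num)]
    norm_num
  have e2 : ∀ x, (k x ^ (1/2 : ℝ)) ^ (2:ℝ) = k x := by
    intro x; rw [← ENNReal.rpow_mul]; norm_num
  have e3 : ∀ x, (k x ^ (1/2 : ℝ) * f x) ^ (2:ℝ) = k x * f x ^ 2 := by
    intro x; rw [ENNReal.mul_rpow_of_nonneg _ _ (by norm_num), e2]; norm_num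
  simp only [Pi.mul_apply, e1, e2, e3] at h
  calc (∫⁻ x, k x * f x ∂μ) ^ 2 ≤ ((∫⁻ x, k x ∂μ) ^ (1/2 : ℝ)
        * (∫⁻ x, k x * f x ^ 2 ∂μ) ^ (1/2 : ℝ)) ^ 2 := by gcongr
    _ = _ := by
      rw [mul_pow, ← ENNReal.rpow_natCast, ← ENNReal.rpow_natCast, ← ENNReal.rpow_mul,
        ← ENNReal.rpow_mul]
      norm_num

lemma eLpNorm_two_sq {X : Type*} [MeasurableSpace X] {μ : Measure X} (f : X → ℂ) :
    eLpNorm f 2 μ ^ 2 = ∫⁻ x, ‖f x‖ₑ ^ 2 ∂μ := by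
  rw [eLpNorm_eq_lintegral_rpow_enorm_toReal (by norm_num) (by norm_num), ← ENNReal.rpow_natCast,
    ← ENNReal.rpow_mul]
  norm_num

/-- Young's inequality `‖k * f‖₂ ≤ ‖k‖₁ ‖f‖₂` on the group. -/
lemma eLpNorm_convOp_le {k f : (Fin (2*n) → ℝ) × ℝ → ℂ} (hk : Continuous k) (hf : Continuous f) :
    eLpNorm (convOp n a k f) 2 volume ≤ (∫⁻ p, ‖k p‖ₑ) * eLpNorm f 2 volume := by
  have hkm : Measurable fun p => ‖k p‖ₑ := hk.enorm.measurable
  have hsq : ∫⁻ p, ‖convOp n a k f p‖ₑ ^ 2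
      ≤ (∫⁻ p, ‖k p‖ₑ) ^ 2 * ∫⁻ p, ‖f p‖ₑ ^ 2 := by
    have hp : ∀ p, ‖convOp n a k f p‖ₑ ^ 2
        ≤ (∫⁻ p, ‖k p‖ₑ) * ∫⁻ q, ‖k (heisDiv n a p q)‖ₑ * ‖f q‖ₑ ^ 2 := by
      intro p
      have hA : ∫⁻ q, ‖k (heisDiv n a p q)‖ₑ = ∫⁻ p, ‖k p‖ₑ :=
        (measurePreserving_heisDiv_left p).lintegral_comp hkm
      rw [← hA]
      refine le_trans ?_ (sq_lintegral_mul_le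
        (show Continuous fun q => ‖k (heisDiv n a p q)‖ₑ by fun_prop).measurable
        hf.enorm.measurable)
      rw [convOp_eq]
      gcongr
      refine (enorm_integral_le_lintegral_enorm _).trans (le_of_eq ?_)
      simp only [enorm_mul]
    calc ∫⁻ p, ‖convOp n a k f p‖ₑ ^ 2
        ≤ ∫⁻ p, (∫⁻ p, ‖k p‖ₑ) * ∫⁻ q, ‖k (heisDiv n a p q)‖ₑ * ‖f q‖ₑ ^ 2 :=
          lintegral_mono hp
      _ = (∫⁻ p, ‖k p‖ₑ) * ∫⁻ p, ∫⁻ q, ‖k (heisDiv n a p q)‖ₑ * ‖f q‖ₑ ^ 2 := by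
          rw [lintegral_const_mul]
          refine Measurable.lintegral_prod_right' (f := fun x : ((Fin (2*n) → ℝ) × ℝ) ×
            ((Fin (2*n) → ℝ) × ℝ) => ‖k (heisDiv n a x.1 x.2)‖ₑ * ‖f x.2‖ₑ ^ 2) ?_
          exact (show Continuous fun x : ((Fin (2*n) → ℝ) × ℝ) × ((Fin (2*n) → ℝ) × ℝ) =>
            ‖k (heisDiv n a x.1 x.2)‖ₑ by fun_prop).measurable.mul
            ((show Continuous fun x : ((Fin (2*n) → ℝ) × ℝ) × ((Fin (2*n) → ℝ) × ℝ) =>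
            ‖f x.2‖ₑ by fun_prop).measurable.pow_const 2)
      _ = (∫⁻ p, ‖k p‖ₑ) * ∫⁻ q, ∫⁻ p, ‖k (heisDiv n a p q)‖ₑ * ‖f q‖ₑ ^ 2 := by
          rw [lintegral_lintegral_swap]
          exact ((show Continuous fun x : ((Fin (2*n) → ℝ) × ℝ) × ((Fin (2*n) → ℝ) × ℝ) =>
            ‖k (heisDiv n a x.1 x.2)‖ₑ by fun_prop).measurable.mul
            ((show Continuous fun x : ((Fin (2*n) → ℝ) × ℝ) × ((Fin (2*n) → ℝ) × ℝ) =>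
            ‖f x.2‖ₑ by fun_prop).measurable.pow_const 2)).aemeasurable
      _ = (∫⁻ p, ‖k p‖ₑ) * ∫⁻ q, (∫⁻ p, ‖k p‖ₑ) * ‖f q‖ₑ ^ 2 := by
          congr 1
          refine lintegral_congr fun q => ?_
          rw [lintegral_mul_const _
            (show Continuous fun p => ‖k (heisDiv n a p q)‖ₑ by fun_prop).measurable,
            (measurePreserving_heisDiv_right q).lintegral_comp hkm]
      _ = _ := by
          rw [lintegral_const_mul _ (hf.enorm.measurable.pow_const 2), ← mul_assoc, sq]
  rw [← eLpNorm_two_sq, ← eLpNorm_two_sq, ← mul_pow] at hsq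
  exact (ENNReal.pow_le_pow_left_iff two_ne_zero).1 hsq

end Convolution

section AlmostOrthogonality

open scoped InnerProductSpace

variable {𝓥 H : Type*} [NormedAddCommGroup H] [InnerProductSpace ℂ H]

/-- An almost orthogonality principle: if the mutual products `SᵢTⱼ`, `TᵢSⱼ` (`i ≠ j`) have
summably small norms, then the sum of the `Tⱼ` is bounded. -/
theorem almost_orthogonal_sum_le {ι : 𝓥 → H} {T S : ℕ → 𝓥 → 𝓥}
    (hadj : ∀ j f g, ⟪ι (T j f), ι g⟫_ℂ = ⟪ι f, ι (S j g)⟫_ℂ)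
    {A B : ℝ} (hA : 0 ≤ A) (hB : 0 ≤ B) {e : ℕ → ℝ} (he : ∀ j, 0 ≤ e j) (F : Finset ℕ)
    (hsum : ∑ j ∈ F, e j ≤ B)
    (hT : ∀ j ∈ F, ∀ f, ‖ι (T j f)‖ ≤ A * ‖ι f‖)
    (hS : ∀ j ∈ F, ∀ f, ‖ι (S j f)‖ ≤ A * ‖ι f‖)
    (hST : ∀ i ∈ F, ∀ j ∈ F, j < i → ∀ f, ‖ι (S i (T j f))‖ ≤ e i * e j * ‖ι f‖)
    (hTS : ∀ i ∈ F, ∀ j ∈ F, j < i → ∀ f, ‖ι (T i (S j f))‖ ≤ e i * e j * ‖ι f‖) (f : 𝓥) :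
    ‖∑ j ∈ F, ι (T j f)‖ ≤ (A + B) * ‖ι f‖ := by
  classical
  have hadj' : ∀ j f g, ⟪ι (S j f), ι g⟫_ℂ = ⟪ι f, ι (T j g)⟫_ℂ := by
    intro j f g
    rw [← inner_conj_symm, ← hadj, inner_conj_symm]
  have sumsq : ∀ v : ℕ → H, ‖∑ j ∈ F, v j‖ ^ 2 ≤ ∑ i ∈ F, ∑ j ∈ F, ‖⟪v i, v j⟫_ℂ‖ := by
    intro v
    have h1 : ((‖∑ j ∈ F, v j‖ ^ 2 : ℝ) : ℂ) = ∑ i ∈ F, ∑ j ∈ F, ⟪v i, v j⟫_ℂ := by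
      push_cast
      rw [← Complex.coe_algebraMap, ← inner_self_eq_norm_sq_to_K (𝕜 := ℂ), sum_inner]
      exact Finset.sum_congr rfl fun i _ => inner_sum _ _ _
    have h2 : ‖∑ j ∈ F, v j‖ ^ 2 = ‖((‖∑ j ∈ F, v j‖ ^ 2 : ℝ) : ℂ)‖ := by
      rw [Complex.norm_real, Real.norm_of_nonneg (by positivity)]
    rw [h2, h1]
    exact (norm_sum_le _ _).trans (Finset.sum_le_sum fun i _ => norm_sum_le _ _)
  have split : ∀ (v : ℕ → H) (c : ℝ), 0 ≤ c →
      (∀ i ∈ F, ∀ j ∈ F, j < i → ‖⟪v i, v j⟫_ℂ‖ ≤ c * (e i * e j)) →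
      ‖∑ j ∈ F, v j‖ ^ 2 ≤ ∑ j ∈ F, ‖v j‖ ^ 2 + c * B ^ 2 := by
    intro v c hc h
    refine (sumsq v).trans ?_
    have h1 : ∀ i ∈ F, ∀ j ∈ F, ‖⟪v i, v j⟫_ℂ‖
        ≤ (if i = j then ‖v j‖ ^ 2 else 0) + c * (e i * e j) := by
      intro i hi j hj
      have hp : 0 ≤ c * (e i * e j) := mul_nonneg hc (mul_nonneg (he i) (he j))
      rcases lt_trichotomy i j with hij | hij | hij
      · rw [if_neg hij.ne, zero_add, norm_inner_symm, mul_comm (e i)]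
        exact h j hj i hi hij
      · rw [if_pos hij, hij]
        have := norm_inner_le_norm (𝕜 := ℂ) (v j) (v j)
        have h3 : 0 ≤ c * (e j * e j) := mul_nonneg hc (mul_nonneg (he j) (he j))
        nlinarith
      · rw [if_neg hij.ne', zero_add]
        exact h i hi j hj hij
    refine (Finset.sum_le_sum fun i hi => Finset.sum_le_sum fun j hj => h1 i hi j hj).trans ?_
    simp only [Finset.sum_add_distrib]
    have h2 : ∑ i ∈ F, ∑ j ∈ F, (if i = j then ‖v j‖ ^ 2 else 0) = ∑ j ∈ F, ‖v j‖ ^ 2 :=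
      Finset.sum_congr rfl fun i hi => by simp [hi]
    have h3 : ∑ i ∈ F, ∑ j ∈ F, c * (e i * e j) = c * (∑ j ∈ F, e j) ^ 2 := by
      rw [sq, Finset.sum_mul_sum, Finset.mul_sum]
      exact Finset.sum_congr rfl fun i _ => by rw [Finset.mul_sum]
    rw [h2, h3]
    have h4 : 0 ≤ ∑ j ∈ F, e j := Finset.sum_nonneg fun j _ => he j
    gcongr
  set N := ‖ι f‖ with hN
  have hN0 : 0 ≤ N := norm_nonneg _
  set X := ∑ j ∈ F, ‖ι (T j f)‖ ^ 2 with hX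
  have hX0 : 0 ≤ X := Finset.sum_nonneg fun j _ => by positivity
  have step1 : ‖∑ j ∈ F, ι (T j f)‖ ^ 2 ≤ X + N ^ 2 * B ^ 2 := by
    refine split (fun j => ι (T j f)) (N ^ 2) (by positivity) ?_
    intro i hi j hj hij
    rw [hadj]
    calc ‖⟪ι f, ι (S i (T j f))⟫_ℂ‖ ≤ ‖ι f‖ * ‖ι (S i (T j f))‖ := norm_inner_le_norm _ _
      _ ≤ N * (e i * e j * N) := by gcongr; exact hST i hi j hj hij f
      _ = _ := by ring
  have step2 : ‖∑ j ∈ F, ι (S j (T j f))‖ ^ 2 ≤ A ^ 2 * X + A ^ 2 * N ^ 2 * B ^ 2 := by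
    have h := split (fun j => ι (S j (T j f))) (A ^ 2 * N ^ 2) (by positivity) ?_
    · refine h.trans ?_
      gcongr
      rw [hX, Finset.mul_sum]
      refine Finset.sum_le_sum fun j hj => ?_
      rw [← mul_pow]
      exact pow_le_pow_left₀ (norm_nonneg _) (hS j hj _) 2
    · intro i hi j hj hij
      rw [hadj']
      calc ‖⟪ι (T i f), ι (T i (S j (T j f)))⟫_ℂ‖
          ≤ ‖ι (T i f)‖ * ‖ι (T i (S j (T j f)))‖ := norm_inner_le_norm _ _
        _ ≤ (A * N) * (e i * e j * (A * N)) := by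
            have h1 := hT i hi f
            have h2 := (hTS i hi j hj hij (T j f)).trans
              (mul_le_mul_of_nonneg_left (hT j hj f) (mul_nonneg (he i) (he j)))
            gcongr
        _ = _ := by ring
  have step3 : X ≤ ‖∑ j ∈ F, ι (S j (T j f))‖ * N := by
    have h1 : ((X : ℝ) : ℂ) = ⟪∑ j ∈ F, ι (S j (T j f)), ι f⟫_ℂ := by
      rw [sum_inner, hX]
      push_cast
      refine Finset.sum_congr rfl fun j _ => ?_
      rw [hadj', ← Complex.coe_algebraMap, ← inner_self_eq_norm_sq_to_K (𝕜 := ℂ)]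
    have h2 : X = ‖((X : ℝ) : ℂ)‖ := by
      rw [Complex.norm_real, Real.norm_of_nonneg hX0]
    rw [h2, h1]
    exact norm_inner_le_norm _ _
  have step4 : X ≤ (A ^ 2 + A * B) * N ^ 2 := by
    by_contra hlt
    push Not at hlt
    have h5 : X ^ 2 ≤ (A ^ 2 * X + A ^ 2 * N ^ 2 * B ^ 2) * N ^ 2 := by
      calc X ^ 2 ≤ (‖∑ j ∈ F, ι (S j (T j f))‖ * N) ^ 2 := by gcongr
        _ = ‖∑ j ∈ F, ι (S j (T j f))‖ ^ 2 * N ^ 2 := by ring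
        _ ≤ _ := by gcongr
    have h6 : 0 ≤ A * B * N ^ 2 := by positivity
    have h7 : 0 ≤ A ^ 2 * N ^ 2 := by positivity
    nlinarith [mul_nonneg h6 hX0, mul_nonneg h6 h7]
  have h8 : ‖∑ j ∈ F, ι (T j f)‖ ^ 2 ≤ ((A + B) * N) ^ 2 := by
    have h9 : 0 ≤ A * B * N ^ 2 := by positivity
    nlinarith
  exact (pow_le_pow_iff_left₀ (norm_nonneg _) (by positivity) two_ne_zero).1 h8

end AlmostOrthogonality

section Phase

open scoped ContDiff Matrix

variable {n : ℕ} {a β : ℝ}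

lemma heisP_eq_dotProduct (p : (Fin (2*n) → ℝ) × ℝ) :
    heisP n p = (p.1 ⬝ᵥ p.1) ^ 2 + p.2 ^ 2 := by
  simp [heisP, dotProduct, sq]

lemma fderiv_heisP_apply (p h : (Fin (2*n) → ℝ) × ℝ) :
    fderiv ℝ (heisP n) p h = 4 * (p.1 ⬝ᵥ p.1) * (p.1 ⬝ᵥ h.1) + 2 * p.2 * h.2 := by
  have hd : DifferentiableAt ℝ (heisP n) p :=
    (ContDiff.heisP (m := 1) contDiff_id).differentiable one_ne_zero p
  rw [← hd.lineDeriv_eq_fderiv]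
  unfold lineDeriv
  have e : ∀ s : ℝ, heisP n (p + s • h)
      = ((p.1 ⬝ᵥ p.1) + s * (2 * (p.1 ⬝ᵥ h.1)) + s ^ 2 * (h.1 ⬝ᵥ h.1)) ^ 2
        + (p.2 + s * h.2) ^ 2 := by
    intro s
    rw [heisP_eq_dotProduct]
    simp only [Prod.fst_add, Prod.smul_fst, Prod.snd_add, Prod.smul_snd, dotProduct_add,
      add_dotProduct, smul_dotProduct, dotProduct_smul, smul_eq_mul]
    rw [dotProduct_comm h.1 p.1]
    ring
  simp_rw [e]
  have h0 := hasDerivAt_id (0:ℝ)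
  have := ((((h0.mul_const (2 * (p.1 ⬝ᵥ h.1))).const_add (p.1 ⬝ᵥ p.1)).add
    ((h0.pow 2).mul_const (h.1 ⬝ᵥ h.1))).pow 2).add (((h0.mul_const h.2).const_add p.2).pow 2)
  refine (this.congr_deriv ?_).deriv
  simp
  ring

/-- The phase function `ρ^β`. -/
def heisPhi (n : ℕ) (β : ℝ) (p : (Fin (2*n) → ℝ) × ℝ) : ℝ := heisP n p ^ (β/4)

lemma heisRho_rpow (p : (Fin (2*n) → ℝ) × ℝ) (s : ℝ) : heisRho n p ^ s = heisPhi n s p := by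
  rw [heisRho_eq, heisPhi, ← Real.rpow_mul (heisP_nonneg p)]
  congr 1; ring

lemma contDiffAt_heisPhi {p : (Fin (2*n) → ℝ) × ℝ} (hp : p ≠ 0) {m : WithTop ℕ∞} :
    ContDiffAt ℝ m (heisPhi n β) p :=
  (ContDiff.heisP contDiff_id).contDiffAt.rpow_const_of_ne (heisP_pos hp).ne'

lemma fderiv_heisPhi_apply {p : (Fin (2*n) → ℝ) × ℝ} (hp : p ≠ 0) (h : (Fin (2*n) → ℝ) × ℝ) :
    fderiv ℝ (heisPhi n β) p h = β / 4 * heisP n p ^ (β / 4 - 1)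
      * (4 * (p.1 ⬝ᵥ p.1) * (p.1 ⬝ᵥ h.1) + 2 * p.2 * h.2) := by
  have hd : HasFDerivAt (heisP n) (fderiv ℝ (heisP n) p) p :=
    ((ContDiff.heisP (m := 1) contDiff_id).differentiable one_ne_zero p).hasFDerivAt
  have := (hd.rpow_const (p := β/4) (Or.inl (heisP_pos hp).ne')).fderiv
  have e : heisPhi n β = fun x => heisP n x ^ (β / 4) := rfl
  rw [e, this, ContinuousLinearMap.smul_apply, fderiv_heisP_apply, smul_eq_mul]

lemma fderiv_heisPhi_euler {p : (Fin (2*n) → ℝ) × ℝ} (hp : p ≠ 0) :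
    fderiv ℝ (heisPhi n β) p (p.1, 2 * p.2) = β * heisPhi n β p := by
  rw [fderiv_heisPhi_apply hp, heisPhi]
  have h1 : heisP n p ^ (β/4) = heisP n p ^ (β/4 - 1) * heisP n p := by
    rw [Real.rpow_sub_one (heisP_pos hp).ne']
    field_simp [(heisP_pos hp).ne']
  rw [h1]
  nth_rewrite 3 [heisP_eq_dotProduct]
  ring

lemma contDiffOn_heisPhi {m : WithTop ℕ∞} : ContDiffOn ℝ m (heisPhi n β) {p | p ≠ 0} :=
  fun _ hp => (contDiffAt_heisPhi hp).contDiffWithinAt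

lemma isOpen_ne_zero : IsOpen {p : (Fin (2*n) → ℝ) × ℝ | p ≠ 0} := isOpen_ne

lemma contDiffOn_fderiv_heisPhi : ContDiffOn ℝ ∞ (fderiv ℝ (heisPhi n β)) {p | p ≠ 0} :=
  (contDiffOn_heisPhi (m := ∞)).fderiv_of_isOpen isOpen_ne_zero (m := ∞) (by simp)

/-- The automorphic dilations `(x,t) ↦ (Rx, R²t)`. -/
def heisDil (n : ℕ) (R : ℝ) (p : (Fin (2*n) → ℝ) × ℝ) : (Fin (2*n) → ℝ) × ℝ :=
  (R • p.1, R ^ 2 * p.2)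

lemma heisP_heisDil (R : ℝ) (p : (Fin (2*n) → ℝ) × ℝ) :
    heisP n (heisDil n R p) = R ^ 4 * heisP n p := by
  simp only [heisP_eq_dotProduct, heisDil, smul_dotProduct, dotProduct_smul, smul_eq_mul]
  ring

lemma heisPhi_heisDil {R : ℝ} (hR : 0 ≤ R) (p : (Fin (2*n) → ℝ) × ℝ) :
    heisPhi n β (heisDil n R p) = R ^ β * heisPhi n β p := by
  rw [heisPhi, heisP_heisDil, Real.mul_rpow (by positivity) (heisP_nonneg p), heisPhi,
    ← Real.rpow_natCast, ← Real.rpow_mul hR]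
  congr 2; push_cast; ring

lemma heisDiv_heisDil (R : ℝ) (p q : (Fin (2*n) → ℝ) × ℝ) :
    heisDiv n a (heisDil n R p) (heisDil n R q) = heisDil n R (heisDiv n a p q) := by
  simp only [heisDiv, heisDil, symJ_smul_left, symJ_smul_right]
  ext
  · simp; ring
  · simp; ring

lemma heisDil_heisDil (R R' : ℝ) (p : (Fin (2*n) → ℝ) × ℝ) :
    heisDil n R (heisDil n R' p) = heisDil n (R * R') p := by
  simp only [heisDil, smul_smul]
  ext <;> simp; ring

lemma heisDil_one (p : (Fin (2*n) → ℝ) × ℝ) : heisDil n 1 p = p := by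
  simp [heisDil]

lemma heisInv_heisDil (R : ℝ) (p : (Fin (2*n) → ℝ) × ℝ) :
    heisInv n (heisDil n R p) = heisDil n R (heisInv n p) := by
  simp [heisInv, heisDil]

@[fun_prop]
lemma ContDiff.heisDil {F : Type*} [NormedAddCommGroup F] [NormedSpace ℝ F] {m : WithTop ℕ∞}
    {r : F → ℝ} {f : F → (Fin (2*n) → ℝ) × ℝ} (hr : ContDiff ℝ m r) (hf : ContDiff ℝ m f) :
    ContDiff ℝ m (fun x => heisDil n (r x) (f x)) := by
  unfold _root_.heisDil
  fun_prop

@[fun_prop]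
lemma Continuous.heisDil {F : Type*} [TopologicalSpace F]
    {r : F → ℝ} {f : F → (Fin (2*n) → ℝ) × ℝ} (hr : Continuous r) (hf : Continuous f) :
    Continuous (fun x => heisDil n (r x) (f x)) := by
  unfold _root_.heisDil
  fun_prop

@[fun_prop]
lemma Continuous.heisInv {F : Type*} [TopologicalSpace F]
    {f : F → (Fin (2*n) → ℝ) × ℝ} (hf : Continuous f) :
    Continuous (fun x => heisInv n (f x)) := by
  unfold _root_.heisInv
  fun_prop

/-- Change of variables under dilations. -/
lemma map_heisDil {R : ℝ} (hR : 0 < R) :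
    Measure.map (heisDil n R) (volume : Measure ((Fin (2*n) → ℝ) × ℝ))
      = ENNReal.ofReal ((R ^ (2*n+2))⁻¹) • volume := by
  have h1 : Measure.map (fun x : Fin (2*n) → ℝ => R • x) volume
      = ENNReal.ofReal ((R ^ (2*n))⁻¹) • volume := by
    rw [Measure.map_addHaar_smul _ hR.ne']
    simp [abs_of_pos hR]
  have h2 : Measure.map (fun t : ℝ => R^2 * t) volume
      = ENNReal.ofReal ((R ^ 2)⁻¹) • volume := by
    rw [Real.map_volume_mul_left (by positivity : R^2 ≠ 0), abs_of_pos (by positivity)]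
  have h3 : heisDil n R = Prod.map (fun x : Fin (2*n) → ℝ => R • x) (fun t : ℝ => R^2 * t) := by
    rfl
  rw [h3, Measure.volume_eq_prod, ← Measure.map_prod_map _ _ (by fun_prop) (by fun_prop), h1, h2,
    Measure.prod_smul_left, Measure.prod_smul_right, smul_smul, ← ENNReal.ofReal_mul (by positivity)]
  congr 2
  rw [pow_add, mul_inv]

lemma heisDil_measurableEmbedding {R : ℝ} (hR : 0 < R) : MeasurableEmbedding (heisDil n R) := by
  have hc : ∀ S : ℝ, Continuous (heisDil n S) := fun S => by fun_prop
  have : heisDil n R = (Homeomorph.mk ⟨heisDil n R, heisDil n R⁻¹,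
      fun p => by rw [heisDil_heisDil, inv_mul_cancel₀ hR.ne', heisDil_one],
      fun p => by rw [heisDil_heisDil, mul_inv_cancel₀ hR.ne', heisDil_one]⟩ (hc _) (hc _) :
      ((Fin (2*n) → ℝ) × ℝ) ≃ₜ ((Fin (2*n) → ℝ) × ℝ)) := rfl
  rw [this]
  exact Homeomorph.measurableEmbedding _

lemma integral_comp_heisDil {R : ℝ} (hR : 0 < R) (f : (Fin (2*n) → ℝ) × ℝ → ℂ) :
    ∫ p, f p = (R : ℂ) ^ (2*n+2) * ∫ p, f (heisDil n R p) := by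
  have h := (heisDil_measurableEmbedding (n := n) hR).integral_map (μ := volume) f
  rw [map_heisDil hR, integral_smul_measure, ENNReal.toReal_ofReal (by positivity)] at h
  rw [← h, Complex.real_smul, ← mul_assoc]
  push_cast
  rw [mul_inv_cancel₀, one_mul]
  exact pow_ne_zero _ (by exact_mod_cast hR.ne')

lemma lintegral_comp_heisDil {R : ℝ} (hR : 0 < R) (f : (Fin (2*n) → ℝ) × ℝ → ENNReal) :
    ∫⁻ p, f p = ENNReal.ofReal (R ^ (2*n+2)) * ∫⁻ p, f (heisDil n R p) := by
  have h := (heisDil_measurableEmbedding (n := n) hR).lintegral_map (μ := volume) f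
  rw [map_heisDil hR, lintegral_smul_measure] at h
  rw [← h, smul_eq_mul, ← mul_assoc, ← ENNReal.ofReal_mul (by positivity),
    mul_inv_cancel₀ (by positivity), ENNReal.ofReal_one, one_mul]

end Phase

section OffDiagonal

open scoped ContDiff Matrix

variable {n : ℕ} {a β : ℝ}

/-- The underlying space of the Heisenberg group. -/
abbrev HeisSpace (n : ℕ) : Type := (Fin (2*n) → ℝ) × ℝ

instance isAddHaarMeasure_volume_heisSpace :
    (volume : Measure ((Fin (2*n) → ℝ) × ℝ)).IsAddHaarMeasure := by
  rw [Measure.volume_eq_prod]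
  infer_instance

lemma eq_heisDiv_of_heisDiv_eq {p w v : (Fin (2*n) → ℝ) × ℝ} (h : heisDiv n a p w = v) :
    w = heisDiv n a (heisInv n v) (heisInv n p) := by
  subst h
  simp only [heisInv, heisDiv, symJ_sub_left, symJ_self, symJ_neg_left, symJ_neg_right]
  rw [symJ_antisymm w.1 p.1]
  ext <;> simp; ring

/-- The directional derivative of `q ↦ δ_ε q · w⁻¹`. -/
lemma hasFDerivAt_heisDiv_heisDil (ε : ℝ) (w q : (Fin (2*n) → ℝ) × ℝ) :
    ∃ L : ((Fin (2*n) → ℝ) × ℝ) →L[ℝ] ((Fin (2*n) → ℝ) × ℝ),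
      HasFDerivAt (fun q => heisDiv n a (heisDil n ε q) w) L q ∧
      ∀ h, L h = (ε • h.1, ε ^ 2 * h.2 + 2 * a * ε * symJ n h.1 w.1) := by
  let L : ((Fin (2*n) → ℝ) × ℝ) →ₗ[ℝ] ((Fin (2*n) → ℝ) × ℝ) :=
    { toFun := fun h => (ε • h.1, ε ^ 2 * h.2 + 2 * a * ε * symJ n h.1 w.1)
      map_add' := fun x y => by
        simp only [Prod.fst_add, Prod.snd_add, symJ_add_left]
        ext <;> simp <;> ring
      map_smul' := fun c x => by
        simp only [Prod.smul_fst, Prod.smul_snd, symJ_smul_left]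
        ext <;> simp <;> ring }
  refine ⟨LinearMap.toContinuousLinearMap L, ?_, fun h => rfl⟩
  have e : (fun q => heisDiv n a (heisDil n ε q) w)
      = fun q => (LinearMap.toContinuousLinearMap L) q + (-w.1, -w.2) := by
    funext q
    simp only [heisDiv, heisDil, symJ_smul_left, LinearMap.coe_toContinuousLinearMap', L,
      LinearMap.coe_mk, AddHom.coe_mk]
    ext <;> simp <;> ring
  rw [e]
  exact (ContinuousLinearMap.hasFDerivAt _).add_const _

/-- The vector field direction `(ε x_v, 2t_v - 2a x_vᵀ J y)` with `v = δ_ε q · w⁻¹`. -/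
def eulerDir (n : ℕ) (a : ℝ) (ε : ℝ) (v w : (Fin (2*n) → ℝ) × ℝ) : (Fin (2*n) → ℝ) × ℝ :=
  (ε • v.1, 2 * v.2 - 2 * a * symJ n v.1 w.1)

/-- The normalizing factor of the off-diagonal vector field. -/
def eulerFactor (n : ℕ) (a β : ℝ) (ε κ : ℝ) (v q w : (Fin (2*n) → ℝ) × ℝ) : ℝ :=
  β * heisPhi n β v - κ * fderiv ℝ (heisPhi n β) q (eulerDir n a ε v w)

lemma exists_eulerFactor_pos (hβ : 0 < β) (M : ℝ) : ∃ κ₀ > 0, ∀ ε ∈ Set.Icc (0:ℝ) 1,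
    ∀ κ ∈ Set.Icc (0:ℝ) κ₀, ∀ q w v : (Fin (2*n) → ℝ) × ℝ, 1 ≤ heisP n q → heisP n q ≤ M →
    1 ≤ heisP n v → heisP n v ≤ M →
    v = heisDiv n a (heisDil n ε q) w → 0 < eulerFactor n a β ε κ v q w := by
  have hQ := isCompact_heisP_Icc (n := n) 1 M
  have hcpt := (hQ.prod hQ).prod (isCompact_Icc (a := (0:ℝ)) (b := 1))
  have hne : ∀ q : (Fin (2*n) → ℝ) × ℝ, 1 ≤ heisP n q → q ≠ 0 := by
    rintro q h rfl
    rw [heisP_eq_zero.2 rfl] at h; linarith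
  obtain ⟨B, hB⟩ := hcpt.exists_bound_of_continuousOn
    (f := fun x : ((((Fin (2*n) → ℝ) × ℝ) × ((Fin (2*n) → ℝ) × ℝ)) × ℝ) =>
      fderiv ℝ (heisPhi n β) x.1.1 (x.2 • x.1.2.1, 2 * x.1.2.2
        - 2 * a * symJ n x.1.2.1 (x.2 • x.1.1.1 - x.1.2.1))) (by
      refine ContinuousOn.clm_apply ?_ (Continuous.continuousOn (by fun_prop))
      refine (contDiffOn_fderiv_heisPhi.continuousOn).comp (by fun_prop) ?_
      rintro x ⟨⟨h1, -⟩, -⟩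
      exact hne _ h1.1)
  refine ⟨β / (|B| + 1), by positivity, ?_⟩
  intro ε hε κ hκ q w v hq1 hqM hv1 hvM hv
  have hw : w.1 = ε • q.1 - v.1 := by
    rw [hv]; simp [heisDiv, heisDil]
  have h1 := hB ((q, v), ε) ⟨⟨⟨hq1, hqM⟩, ⟨hv1, hvM⟩⟩, hε⟩
  simp only at h1
  rw [← hw, Real.norm_eq_abs] at h1
  have h2 : 1 ≤ heisPhi n β v := Real.one_le_rpow hv1 (by positivity)
  unfold eulerFactor eulerDir
  set D := fderiv ℝ (heisPhi n β) q (ε • v.1, 2 * v.2 - 2 * a * symJ n v.1 w.1)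
  have h3 : κ * D < β := by
    have h4 : |D| < |B| + 1 := by linarith [le_abs_self B]
    calc κ * D ≤ κ * |D| := mul_le_mul_of_nonneg_left (le_abs_self _) hκ.1
      _ ≤ β / (|B| + 1) * |D| := mul_le_mul_of_nonneg_right hκ.2 (abs_nonneg _)
      _ < β / (|B| + 1) * (|B| + 1) := by gcongr
      _ = β := by field_simp
  nlinarith

/-- Oscillatory estimate for products of pieces at well separated scales. -/
theorem offDiagonal_bound (hβ : 0 < β) (M : ℝ) : ∃ κ₀ > 0, ∀ (N : ℕ)
    {b c : (Fin (2*n) → ℝ) × ℝ → ℂ}, ContDiff ℝ ∞ b → ContDiff ℝ ∞ c →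
    (∀ p, ¬ (1 ≤ heisP n p ∧ heisP n p ≤ M) → b p = 0) →
    (∀ p, ¬ (1 ≤ heisP n p ∧ heisP n p ≤ M) → c p = 0) →
    ∃ C, 0 ≤ C ∧ ∀ ε ∈ Set.Ioc (0:ℝ) 1, ∀ κ ∈ Set.Icc (0:ℝ) κ₀, ∀ l : ℝ, 0 < l → ∀ w,
      ‖∫ q, Complex.exp (Complex.I * ((l * heisPhi n β (heisDiv n a (heisDil n ε q) w)
          - l * ε ^ 2 * κ * heisPhi n β q : ℝ) : ℂ))
        * (b (heisDiv n a (heisDil n ε q) w) * c q)‖ ≤ C * ((l * ε ^ 2) ^ N)⁻¹ := by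
  obtain ⟨κ₀, hκ₀, hpos⟩ := exists_eulerFactor_pos (n := n) (a := a) hβ M
  refine ⟨κ₀, hκ₀, ?_⟩
  intro N b c hb hc hbz hcz
  have hne : ∀ q : (Fin (2*n) → ℝ) × ℝ, 1 ≤ heisP n q → q ≠ 0 := by
    rintro q h rfl
    rw [heisP_eq_zero.2 rfl] at h; linarith
  let vv : HeisSpace n × (ℝ × ℝ × HeisSpace n) → HeisSpace n := fun x => heisDiv n a (heisDil n x.2.1 x.1) x.2.2.2
  have hvv : ContDiff ℝ ∞ vv := by
    simp only [vv]; fun_prop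
  let HH : HeisSpace n × (ℝ × ℝ × HeisSpace n) → ℝ := fun x => eulerFactor n a β x.2.1 x.2.2.1 (vv x) x.1 x.2.2.2
  let U₀ : Set (HeisSpace n × (ℝ × ℝ × HeisSpace n)) := {x | x.1 ≠ 0} ∩ {x | vv x ≠ 0}
  have hU₀ : IsOpen U₀ := (isOpen_ne_zero.preimage continuous_fst).inter
    (isOpen_ne_zero.preimage hvv.continuous)
  have hdir : ContDiff ℝ ∞ (fun x : HeisSpace n × (ℝ × ℝ × HeisSpace n) => eulerDir n a x.2.1 (vv x) x.2.2.2) := by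
    unfold eulerDir; fun_prop
  have hHH : ContDiffOn ℝ ∞ HH U₀ := by
    simp only [HH, eulerFactor]
    refine ContDiffOn.sub (contDiffOn_const.mul ?_) (ContDiffOn.mul (by fun_prop) ?_)
    · exact contDiffOn_heisPhi.comp hvv.contDiffOn fun x hx => hx.2
    · refine ContDiffOn.clm_apply ?_ hdir.contDiffOn
      exact contDiffOn_fderiv_heisPhi.comp contDiff_fst.contDiffOn fun x hx => hx.1
  let U := U₀ ∩ HH ⁻¹' {0}ᶜ
  have hU : IsOpen U := hHH.continuousOn.isOpen_inter_preimage hU₀ isOpen_compl_singleton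
  let K : Set (ℝ × ℝ × HeisSpace n) := {θ | θ.1 ∈ Set.Icc (0:ℝ) 1 ∧ θ.2.1 ∈ Set.Icc (0:ℝ) κ₀}
  have hQ := isCompact_heisP_Icc (n := n) 1 M
  let S : Set (HeisSpace n × (ℝ × ℝ × HeisSpace n)) := (fun x : (HeisSpace n × HeisSpace n) × (ℝ × ℝ) => (x.1.1, (x.2.1, x.2.2,
    heisDiv n a (heisInv n x.1.2) (heisInv n (heisDil n x.2.1 x.1.1))))) ''
      (({p | 1 ≤ heisP n p ∧ heisP n p ≤ M} ×ˢ {p | 1 ≤ heisP n p ∧ heisP n p ≤ M})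
        ×ˢ (Set.Icc (0:ℝ) 1 ×ˢ Set.Icc (0:ℝ) κ₀))
  have hS : IsCompact S :=
    ((hQ.prod hQ).prod (isCompact_Icc.prod isCompact_Icc)).image (by fun_prop)
  have hSU : S ⊆ U := by
    rintro _ ⟨⟨⟨q, v⟩, ε, κ⟩, ⟨⟨hq, hv⟩, hε, hκ⟩, rfl⟩
    have hvv' : vv (q, (ε, κ, heisDiv n a (heisInv n v) (heisInv n (heisDil n ε q)))) = v :=
      heisDiv_heisDiv_self _ _
    refine ⟨⟨hne q hq.1, ?_⟩, ?_⟩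
    · simp only [Set.mem_setOf_eq, hvv']; exact hne v hv.1
    · simp only [Set.mem_preimage, HH, hvv', Set.mem_compl_iff, Set.mem_singleton_iff]
      exact (hpos ε hε κ hκ q _ v hq.1 hq.2 hv.1 hv.2 hvv'.symm).ne'
  let V : HeisSpace n × (ℝ × ℝ × HeisSpace n) → HeisSpace n := fun x => (HH x)⁻¹ • eulerDir n a x.2.1 (vv x) x.2.2.2
  have hV : ContDiffOn ℝ ∞ V U :=
    ContDiffOn.smul ((hHH.mono Set.inter_subset_left).inv fun x hx => hx.2) hdir.contDiffOn
  obtain ⟨C, hC0, hC⟩ := nonstationary_phase (volume : Measure (HeisSpace n)) hU hS hSU K hV N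
    (fun x => b (vv x) * c x.1) (by
      have h1 := hb.comp hvv
      have h2 := hc.comp (contDiff_fst : ContDiff ℝ ∞ (Prod.fst : HeisSpace n × (ℝ × ℝ × HeisSpace n) → HeisSpace n))
      exact (h1.mul h2).contDiffOn) (by
      rintro q ⟨ε, κ, w⟩ hθ hnS
      by_contra hne0
      simp only at hne0
      have h1 : 1 ≤ heisP n (vv (q, ε, κ, w)) ∧ heisP n (vv (q, ε, κ, w)) ≤ M := by
        by_contra h; exact hne0 (by rw [hbz _ h, zero_mul])
      have h2 : 1 ≤ heisP n q ∧ heisP n q ≤ M := by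
        by_contra h; exact hne0 (by rw [hcz _ h, mul_zero])
      refine hnS ⟨((q, vv (q, ε, κ, w)), (ε, κ)), ⟨⟨h2, h1⟩, hθ⟩, ?_⟩
      simp only
      rw [← eq_heisDiv_of_heisDiv_eq (p := heisDil n ε q) (w := w) rfl])
  refine ⟨C, hC0, ?_⟩
  intro ε hε κ hκ l hl w
  refine hC (ε, κ, w) ⟨⟨hε.1.le, hε.2⟩, hκ⟩ (fun q => l * heisPhi n β (heisDiv n a (heisDil n ε q) w)
          - l * ε ^ 2 * κ * heisPhi n β q) (l * ε ^ 2) (by have := hε.1; positivity) ?_ ?_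
  · intro q hq
    refine ContDiffAt.sub (contDiffAt_const.mul ?_) (contDiffAt_const.mul ?_)
    · have hv0 : heisDiv n a (heisDil n ε q) w ≠ 0 := hq.1.2
      refine ContDiffAt.comp q (f := fun q => heisDiv n a (heisDil n ε q) w)
        (contDiffAt_heisPhi hv0) ?_
      exact ContDiff.contDiffAt (by fun_prop)
    · exact contDiffAt_heisPhi hq.1.1
  · intro q hqS
    have hq := hSU hqS
    obtain ⟨L, hL, hLe⟩ := hasFDerivAt_heisDiv_heisDil (a := a) ε w q
    have hv0 : heisDiv n a (heisDil n ε q) w ≠ 0 := hq.1.2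
    have hq0 : q ≠ 0 := hq.1.1
    have d1 := ((contDiffAt_heisPhi (β := β) hv0 (m := 1)).differentiableAt one_ne_zero).hasFDerivAt
    have d2 := ((contDiffAt_heisPhi (β := β) hq0 (m := 1)).differentiableAt one_ne_zero).hasFDerivAt
    have d3 := ((d1.comp q hL).const_mul l).sub (d2.const_mul (l * ε ^ 2 * κ))
    have d4 := d3.fderiv
    have hH0 : HH (q, ε, κ, w) ≠ 0 := hq.2
    refine (congrArg (fun T : HeisSpace n →L[ℝ] ℝ => T (V (q, ε, κ, w))) d4).trans ?_
    have e1 : L (eulerDir n a ε (vv (q, ε, κ, w)) w)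
        = ε ^ 2 • ((vv (q, ε, κ, w)).1, 2 * (vv (q, ε, κ, w)).2) := by
      rw [hLe]
      simp only [eulerDir, symJ_smul_left]
      ext
      · simp; ring
      · simp; ring
    have e2 : fderiv ℝ (heisPhi n β) (heisDiv n a (heisDil n ε q) w)
        (L (eulerDir n a ε (vv (q, ε, κ, w)) w)) = ε ^ 2 * (β * heisPhi n β (vv (q, ε, κ, w))) := by
      rw [e1, map_smul, fderiv_heisPhi_euler hv0, smul_eq_mul]
    simp only [V, ContinuousLinearMap.sub_apply, ContinuousLinearMap.smul_apply, map_smul,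
      ContinuousLinearMap.comp_apply, e2, smul_eq_mul]
    have e3 : HH (q, ε, κ, w) = β * heisPhi n β (vv (q, ε, κ, w))
      - κ * fderiv ℝ (heisPhi n β) q (eulerDir n a ε (vv (q, ε, κ, w)) w) := rfl
    field_simp
    rw [e3]
    ring

end OffDiagonal

section Diagonal

open scoped ContDiff Matrix

variable {n : ℕ} {a β : ℝ}

/-- The divided difference of `u ↦ u ^ γ` based at `1` is smooth on `(0, ∞)`. -/
lemma exists_smooth_rpow_slope (γ : ℝ) : ∃ k : ℝ → ℝ, ContDiffOn ℝ ∞ k (Set.Ioi 0) ∧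
    k 1 = γ ∧ ∀ u, u ^ γ - 1 = k u * (u - 1) := by
  let f : ℝ → ℝ := fun u => u ^ γ
  refine ⟨dslope f 1, ?_, ?_, ?_⟩
  · intro u hu
    have hu0 : u ≠ 0 := (Set.mem_Ioi.1 hu).ne'
    refine ContDiffAt.contDiffWithinAt ?_
    by_cases h1 : u = 1
    · subst h1
      have hf : AnalyticAt ℝ f 1 := (Real.contDiffAt_rpow_const_of_ne one_ne_zero).analyticAt
      obtain ⟨p, hp⟩ := hf
      have : AnalyticAt ℝ (dslope f 1) 1 := ⟨_, hp.has_fpower_series_dslope_fslope⟩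
      exact this.contDiffAt
    · have he : dslope f 1 =ᶠ[nhds u] fun x => (x - 1)⁻¹ * (x ^ γ - 1) := by
        filter_upwards [isOpen_ne.mem_nhds h1] with x hx
        rw [dslope_of_ne _ hx, slope_def_field]
        simp only [f, Real.one_rpow]
        ring
      refine ContDiffAt.congr_of_eventuallyEq ?_ he
      refine ContDiffAt.mul (ContDiffAt.inv (by fun_prop) (sub_ne_zero.2 h1)) ?_
      exact (contDiffAt_id.rpow_const_of_ne hu0).sub contDiffAt_const
  · rw [dslope_same]
    have := (Real.hasDerivAt_rpow_const (x := 1) (p := γ) (Or.inl one_ne_zero)).deriv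
    rw [Real.one_rpow, mul_one] at this
    exact this
  · intro u
    have := sub_smul_dslope f 1 u
    simp only [f, smul_eq_mul, Real.one_rpow] at this
    rw [← this, mul_comm]

/-- The polynomial `(P(q·(rη)⁻¹) - P(q)) / r`. -/
def heisPQuot (n : ℕ) (a : ℝ) (q : (Fin (2*n) → ℝ) × ℝ) (r : ℝ)
    (η : (Fin (2*n) → ℝ) × ℝ) : ℝ :=
  (-2 * (q.1 ⬝ᵥ η.1) + r * (η.1 ⬝ᵥ η.1))
      * (2 * (q.1 ⬝ᵥ q.1) - 2 * r * (q.1 ⬝ᵥ η.1) + r ^ 2 * (η.1 ⬝ᵥ η.1))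
    + (-η.2 + 2 * a * symJ n q.1 η.1) * (2 * q.2 + r * (-η.2 + 2 * a * symJ n q.1 η.1))

lemma heisP_heisDiv_smul (q : (Fin (2*n) → ℝ) × ℝ) (r : ℝ) (η : (Fin (2*n) → ℝ) × ℝ) :
    heisP n (heisDiv n a q (r • η)) - heisP n q = r * heisPQuot n a q r η := by
  simp only [heisP_eq_dotProduct, heisDiv, heisPQuot, Prod.smul_fst, Prod.smul_snd, smul_eq_mul,
    symJ_smul_right, sub_dotProduct, dotProduct_sub, smul_dotProduct, dotProduct_smul]
  rw [dotProduct_comm η.1 q.1]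
  ring

@[fun_prop]
lemma contDiff_dotProduct {F : Type*} [NormedAddCommGroup F] [NormedSpace ℝ F] {m : WithTop ℕ∞}
    {f g : F → Fin (2*n) → ℝ} (hf : ContDiff ℝ m f) (hg : ContDiff ℝ m g) :
    ContDiff ℝ m (fun x => f x ⬝ᵥ g x) := by
  unfold dotProduct
  exact ContDiff.sum fun i _ => (contDiff_pi.1 hf i).mul (contDiff_pi.1 hg i)

/-- The phase difference `(φ(q·(rη)⁻¹) - φ(q)) / r`, extended smoothly to `r = 0`. -/
lemma exists_phase_quotient (β : ℝ) :
    ∃ Ψ : HeisSpace n × (ℝ × HeisSpace n) → ℝ,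
      ContDiffOn ℝ ∞ Ψ ({x | x.1 ≠ 0} ∩ {x | heisDiv n a x.1 (x.2.1 • x.2.2) ≠ 0}) ∧
      (∀ q r η, q ≠ 0 → r * Ψ (q, (r, η))
        = heisPhi n β (heisDiv n a q (r • η)) - heisPhi n β q) ∧
      (∀ q η, q ≠ 0 → Ψ (q, (0, η)) = β / 4 * heisP n q ^ (β / 4 - 1) * heisPQuot n a q 0 η) := by
  obtain ⟨k, hk, hk1, hku⟩ := exists_smooth_rpow_slope (β / 4)
  refine ⟨fun x => heisP n x.1 ^ (β / 4 - 1)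
    * k (heisP n (heisDiv n a x.1 (x.2.1 • x.2.2)) / heisP n x.1)
    * heisPQuot n a x.1 x.2.1 x.2.2, ?_, ?_, ?_⟩
  · refine ContDiffOn.mul (ContDiffOn.mul ?_ ?_) ?_
    · intro x hx
      refine ContDiffAt.contDiffWithinAt ?_
      exact ContDiffAt.rpow_const_of_ne (ContDiff.contDiffAt (by fun_prop)) (heisP_pos hx.1).ne'
    · refine hk.comp (ContDiffOn.div (ContDiff.contDiffOn (by fun_prop))
        (ContDiff.contDiffOn (by fun_prop)) fun x hx => (heisP_pos hx.1).ne') ?_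
      intro x hx
      exact div_pos (heisP_pos hx.2) (heisP_pos hx.1)
    · refine ContDiff.contDiffOn ?_
      unfold heisPQuot
      fun_prop
  · intro q r η hq
    have hP := heisP_pos hq
    have h1 := hku (heisP n (heisDiv n a q (r • η)) / heisP n q)
    rw [Real.div_rpow (heisP_nonneg _) (heisP_nonneg _)] at h1
    have h2 := heisP_heisDiv_smul (a := a) q r η
    have h3 : heisP n (heisDiv n a q (r • η)) / heisP n q - 1
        = r * heisPQuot n a q r η / heisP n q := by
      rw [← h2]; field_simp
    rw [h3] at h1
    simp only [heisPhi]
    have h4 : heisP n q ^ (β / 4) ≠ 0 := (Real.rpow_pos_of_pos hP _).ne'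
    rw [Real.rpow_sub_one hP.ne']
    field_simp at h1 ⊢
    linarith
  · intro q η hq
    have hP := heisP_pos hq
    simp only [zero_smul, heisDiv_zero, div_self hP.ne', hk1]
    ring

lemma dotProduct_self_nonneg_real (x : Fin (2*n) → ℝ) : 0 ≤ x ⬝ᵥ x := by
  simp only [dotProduct]; exact Finset.sum_nonneg fun i _ => mul_self_nonneg _

lemma rpow_sub_mul_sub_nonneg {s N N' : ℝ} (hs : 0 ≤ s) (hN : 0 ≤ N) (hN' : 0 ≤ N') :
    0 ≤ (N ^ s - N' ^ s) * (N - N') := by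
  rcases le_total N N' with h | h
  · have := Real.rpow_le_rpow hN h hs
    nlinarith
  · have := Real.rpow_le_rpow hN' h hs
    nlinarith

lemma eq_of_rpow_sub_mul_sub_eq_zero {s N N' : ℝ} (hs : 0 < s) (hN : 0 ≤ N) (hN' : 0 ≤ N')
    (h : (N ^ s - N' ^ s) * (N - N') = 0) : N = N' := by
  rcases mul_eq_zero.1 h with h | h
  · exact (Real.rpow_left_inj hN hN' hs.ne').1 (sub_eq_zero.1 h)
  · exact sub_eq_zero.1 h

lemma gradient_gap_identity {X X' t t' d A A' N N' : ℝ} (hNN : N ^ 2 = X ^ 2 + t ^ 2)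
    (hNN' : N' ^ 2 = X' ^ 2 + t' ^ 2) :
    A * (4 * X * (X - (X + X' - d) / 2) + 2 * t * (t - t'))
      - A' * (4 * X' * ((X + X' - d) / 2 - X') + 2 * t' * (t - t'))
      = 2 * (A * X * d + A' * X' * d + (A + A') * (N * N' - (X * X' + t * t'))
        + (A * N - A' * N') * (N - N')) := by
  linear_combination (-2 * A) * hNN - 2 * A' * hNN'

lemma mul_add_mul_le_of_sq_eq {X X' t t' N N' : ℝ} (hN : 0 ≤ N) (hN' : 0 ≤ N')
    (hNN : N ^ 2 = X ^ 2 + t ^ 2) (hNN' : N' ^ 2 = X' ^ 2 + t' ^ 2) :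
    X * X' + t * t' ≤ N * N' := by
  refine (abs_le_of_sq_le_sq' ?_ (by positivity)).2
  rw [mul_pow, hNN, hNN']
  nlinarith [sq_nonneg (X * t' - X' * t)]

/-- Strict monotonicity of the gradient of `ρ^β` for `β > 2`. -/
lemma fderiv_heisPhi_sub_pos (hβ : 2 < β) {v q : (Fin (2*n) → ℝ) × ℝ} (hv : v ≠ 0) (hq : q ≠ 0)
    (hvq : v ≠ q) :
    0 < fderiv ℝ (heisPhi n β) v (v - q) - fderiv ℝ (heisPhi n β) q (v - q) := by
  obtain ⟨x, t⟩ := v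
  obtain ⟨x', t'⟩ := q
  rw [fderiv_heisPhi_apply hv, fderiv_heisPhi_apply hq]
  have hPv := heisP_pos hv
  have hPq := heisP_pos hq
  obtain ⟨N, hN0, hNN⟩ : ∃ N, 0 < N ∧ N ^ 2 = heisP n (x, t) :=
    ⟨√(heisP n (x, t)), Real.sqrt_pos.2 hPv, Real.sq_sqrt hPv.le⟩
  obtain ⟨N', hN0', hNN'⟩ : ∃ N, 0 < N ∧ N ^ 2 = heisP n (x', t') :=
    ⟨√(heisP n (x', t')), Real.sqrt_pos.2 hPq, Real.sq_sqrt hPq.le⟩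
  have pw : ∀ S : ℝ, 0 < S → (S ^ 2) ^ (β / 4 - 1) * S = S ^ (β / 2 - 1) := by
    intro S hS
    rw [← Real.rpow_natCast, ← Real.rpow_mul hS.le, ← Real.rpow_add_one hS.ne']
    congr 1; push_cast; ring
  have hAN := pw N hN0
  have hAN' := pw N' hN0'
  rw [← hNN, ← hNN']
  have hA0 : 0 < (N ^ 2) ^ (β / 4 - 1) := Real.rpow_pos_of_pos (by positivity) _
  have hA0' : 0 < (N' ^ 2) ^ (β / 4 - 1) := Real.rpow_pos_of_pos (by positivity) _
  generalize (N ^ 2) ^ (β / 4 - 1) = A at *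
  generalize (N' ^ 2) ^ (β / 4 - 1) = A' at *
  rw [heisP_eq_dotProduct] at hNN hNN'
  have hX0 := dotProduct_self_nonneg_real x
  have hX0' := dotProduct_self_nonneg_real x'
  have hd0 := dotProduct_self_nonneg_real (x - x')
  have hd : (x - x') ⬝ᵥ (x - x') = x ⬝ᵥ x - 2 * (x ⬝ᵥ x') + x' ⬝ᵥ x' := by
    simp only [sub_dotProduct, dotProduct_sub]; rw [dotProduct_comm x' x]; ring
  have hz : x ⬝ᵥ x' = (x ⬝ᵥ x + x' ⬝ᵥ x' - (x - x') ⬝ᵥ (x - x')) / 2 := by linarith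
  simp only [Prod.fst_sub, Prod.snd_sub, dotProduct_sub, dotProduct_comm x' x] at hNN hNN' ⊢
  rw [hz]
  have hfin : (x - x') ⬝ᵥ (x - x') = 0 ∨ (x ⬝ᵥ x = 0 ∧ x' ⬝ᵥ x' = 0) → t = t' → False := by
    intro h htt
    refine hvq (Prod.ext ?_ htt)
    rcases h with h | ⟨h, h'⟩
    · exact sub_eq_zero.1 (dotProduct_self_eq_zero.1 h)
    · simp only [dotProduct_self_eq_zero.1 h, dotProduct_self_eq_zero.1 h']
  clear hz hd
  generalize (x - x') ⬝ᵥ (x - x') = d at *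
  generalize x ⬝ᵥ x = X at *
  generalize x' ⬝ᵥ x' = X' at *
  rw [mul_assoc (β / 4), mul_assoc (β / 4), ← mul_sub, gradient_gap_identity hNN hNN']
  have hcs := mul_add_mul_le_of_sq_eq hN0.le hN0'.le hNN hNN'
  have hmono := rpow_sub_mul_sub_nonneg (s := β / 2 - 1) (by linarith) hN0.le hN0'.le
  rw [← hAN, ← hAN'] at hmono
  have t1 : 0 ≤ A * X * d := by positivity
  have t2 : 0 ≤ A' * X' * d := by positivity
  have t3 : 0 ≤ (A + A') * (N * N' - (X * X' + t * t')) :=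
    mul_nonneg (by positivity) (by linarith)
  refine mul_pos (by linarith) (mul_pos two_pos (lt_of_le_of_ne (by linarith) fun h => ?_))
  have z1 : A * X * d = 0 := by linarith
  have z3 : (A + A') * (N * N' - (X * X' + t * t')) = 0 := by linarith
  have z4 : (A * N - A' * N') * (N - N') = 0 := by linarith
  rw [hAN, hAN'] at z4
  have hNeq := eq_of_rpow_sub_mul_sub_eq_zero (by linarith) hN0.le hN0'.le z4
  have hc : N * N' = X * X' + t * t' := by
    rcases mul_eq_zero.1 z3 with h | h
    · linarith
    · linarith
  have hsum : (X - X') ^ 2 + (t - t') ^ 2 = 0 := by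
    rw [← hNeq] at hc hNN'
    linarith [sq N]
  have hXX : X = X' := by nlinarith [sq_nonneg (X - X'), sq_nonneg (t - t')]
  have htt : t = t' := by nlinarith [sq_nonneg (X - X'), sq_nonneg (t - t')]
  refine hfin ?_ htt
  rcases mul_eq_zero.1 z1 with h | h
  · rcases mul_eq_zero.1 h with h | h
    · exact absurd h hA0.ne'
    · exact Or.inr ⟨h, by rw [← hXX, h]⟩
  · exact Or.inl h

end Diagonal

section DiagonalBound

open scoped ContDiff Matrix

variable {n : ℕ} {a β : ℝ}

lemma hasDerivAt_heisP_line (q e : (Fin (2*n) → ℝ) × ℝ) :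
    HasDerivAt (fun s : ℝ => heisP n (q + s • e))
      (4 * (q.1 ⬝ᵥ q.1) * (q.1 ⬝ᵥ e.1) + 2 * q.2 * e.2) 0 := by
  have hd : DifferentiableAt ℝ (heisP n) q :=
    (ContDiff.heisP (m := 1) contDiff_id).differentiable one_ne_zero q
  have := hd.hasFDerivAt.hasLineDerivAt e
  rw [fderiv_heisP_apply] at this
  exact this

lemma hasDerivAt_heisPQuot_line (q η e : (Fin (2*n) → ℝ) × ℝ) :
    HasDerivAt (fun s : ℝ => heisPQuot n a (q + s • e) 0 η)
      (-4 * (e.1 ⬝ᵥ η.1) * (q.1 ⬝ᵥ q.1) - 8 * (q.1 ⬝ᵥ η.1) * (q.1 ⬝ᵥ e.1)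
        + 4 * a * symJ n e.1 η.1 * q.2 + 2 * (-η.2 + 2 * a * symJ n q.1 η.1) * e.2) 0 := by
  have e1 : ∀ s : ℝ, heisPQuot n a (q + s • e) 0 η
      = (-4 * ((q.1 ⬝ᵥ η.1) + s * (e.1 ⬝ᵥ η.1)))
        * ((q.1 ⬝ᵥ q.1) + s * (2 * (q.1 ⬝ᵥ e.1)) + s ^ 2 * (e.1 ⬝ᵥ e.1))
        + ((-η.2 + 2 * a * symJ n q.1 η.1) + s * (2 * a * symJ n e.1 η.1))
          * (2 * (q.2 + s * e.2)) := by
    intro s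
    simp only [heisPQuot, Prod.fst_add, Prod.smul_fst, Prod.snd_add, Prod.smul_snd, dotProduct_add,
      add_dotProduct, smul_dotProduct, dotProduct_smul, smul_eq_mul, symJ_add_left, symJ_smul_left]
    rw [dotProduct_comm e.1 q.1]
    ring
  simp_rw [e1]
  have h0 := hasDerivAt_id (0:ℝ)
  have := ((((h0.mul_const (e.1 ⬝ᵥ η.1)).const_add (q.1 ⬝ᵥ η.1)).const_mul (-4)).mul
    (((h0.mul_const (2 * (q.1 ⬝ᵥ e.1))).const_add (q.1 ⬝ᵥ q.1)).add
    ((h0.pow 2).mul_const (e.1 ⬝ᵥ e.1)))).add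
    (((h0.mul_const (2 * a * symJ n e.1 η.1)).const_add (-η.2 + 2 * a * symJ n q.1 η.1)).mul
      (((h0.mul_const e.2).const_add q.2).const_mul 2))
  refine this.congr_deriv ?_
  simp
  ring

/-- The derivative of the limiting phase `(β/4) P^{β/4-1} Q` along a line. -/
lemma hasDerivAt_limit_phase_line {q : (Fin (2*n) → ℝ) × ℝ} (hq : q ≠ 0)
    {η e : (Fin (2*n) → ℝ) × ℝ} {p' q' : ℝ}
    (hp : HasDerivAt (fun s : ℝ => heisP n (q + s • e)) p' 0)
    (hQ : HasDerivAt (fun s : ℝ => heisPQuot n a (q + s • e) 0 η) q' 0) :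
    HasDerivAt (fun s : ℝ => β / 4 * heisP n (q + s • e) ^ (β / 4 - 1)
        * heisPQuot n a (q + s • e) 0 η)
      (β / 4 * heisP n q ^ (β / 4 - 2) * ((β / 4 - 1) * p' * heisPQuot n a q 0 η
        + heisP n q * q')) 0 := by
  have hP := heisP_pos hq
  have h1 := hp.rpow_const (p := β / 4 - 1) (Or.inl (by simpa using hP.ne'))
  refine ((h1.const_mul (β / 4)).mul hQ).congr_deriv ?_
  simp only [zero_smul, add_zero]
  have h2 : heisP n q ^ (β / 4 - 1) = heisP n q ^ (β / 4 - 2) * heisP n q := by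
    rw [← Real.rpow_add_one hP.ne']; congr 1; ring
  have h3 : β / 4 - 1 - 1 = β / 4 - 2 := by ring
  rw [h3, h2]
  ring

/-- The limiting phase has no critical points when `β > 2`. -/
lemma exists_limit_phase_deriv_ne_zero (ha : a ≠ 0) (hβ : 2 < β) {q η : (Fin (2*n) → ℝ) × ℝ}
    (hq : q ≠ 0) (hη : η ≠ 0) : ∃ e : (Fin (2*n) → ℝ) × ℝ, ∃ D : ℝ, D ≠ 0 ∧
      HasDerivAt (fun s : ℝ => β / 4 * heisP n (q + s • e) ^ (β / 4 - 1)
        * heisPQuot n a (q + s • e) 0 η) D 0 := by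
  have hP := heisP_pos hq
  obtain ⟨x, t⟩ := q
  obtain ⟨y, u⟩ := η
  set σ := -u + 2 * a * symJ n x y with hσ
  have hF : 0 < β / 4 * heisP n (x, t) ^ (β / 4 - 2) :=
    mul_pos (by linarith) (Real.rpow_pos_of_pos hP _)
  have hX0 := dotProduct_self_nonneg_real x
  have hY0 := dotProduct_self_nonneg_real y
  have hPe : heisP n (x, t) = (x ⬝ᵥ x) ^ 2 + t ^ 2 := heisP_eq_dotProduct _
  have hQ : heisPQuot n a (x, t) 0 (y, u) = -4 * (x ⬝ᵥ x) * (x ⬝ᵥ y) + 2 * t * σ := by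
    simp only [heisPQuot, ← hσ]; ring
  by_cases hB : (β / 4 - 1) * heisPQuot n a (x, t) 0 (y, u) * heisPQuot n a (x, t) 0 (y, u)
      + heisP n (x, t) * (8 * (x ⬝ᵥ y) ^ 2 + 4 * (x ⬝ᵥ x) * (y ⬝ᵥ y) + 2 * σ ^ 2) = 0
  · have hcs : heisPQuot n a (x, t) 0 (y, u) ^ 2
        ≤ heisP n (x, t) * (16 * (x ⬝ᵥ y) ^ 2 + 4 * σ ^ 2) := by
      rw [hQ, hPe]
      nlinarith [sq_nonneg ((x ⬝ᵥ x) * (2 * σ) + t * (4 * (x ⬝ᵥ y)))]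
    have hXY : 0 ≤ heisP n (x, t) * ((x ⬝ᵥ x) * (y ⬝ᵥ y)) := by positivity
    have hQ2 : heisPQuot n a (x, t) 0 (y, u) ^ 2 = 0 := by
      have := sq_nonneg (heisPQuot n a (x, t) 0 (y, u))
      nlinarith
    have hXYz : heisP n (x, t) * ((x ⬝ᵥ x) * (y ⬝ᵥ y)) = 0 := by nlinarith
    have hXY0 : (x ⬝ᵥ x) * (y ⬝ᵥ y) = 0 := (mul_eq_zero.1 hXYz).resolve_left hP.ne'
    have hQ0 : heisPQuot n a (x, t) 0 (y, u) = 0 := pow_eq_zero_iff two_ne_zero |>.1 hQ2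
    have hσ0 : σ = 0 := by
      rw [hQ0, mul_zero, zero_add] at hB
      have := (mul_eq_zero.1 hB).resolve_left hP.ne'
      nlinarith [sq_nonneg (x ⬝ᵥ y), sq_nonneg σ]
    have hy : y ≠ 0 := by
      rintro rfl
      have h0 : symJ n x 0 = 0 := by simpa using symJ_smul_right 0 x 0
      refine hη (Prod.ext rfl ?_)
      rw [h0] at hσ
      simp only [Prod.snd_zero]
      linarith
    have hx : x = 0 := by
      rcases mul_eq_zero.1 hXY0 with h | h
      · exact dotProduct_self_eq_zero.1 h
      · exact absurd (dotProduct_self_eq_zero.1 h) hy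
    subst hx
    have ht : t ≠ 0 := fun h => hq (by rw [h]; rfl)
    obtain ⟨z, hz⟩ := exists_symJ_ne_zero hy
    refine ⟨(z, 0), _, ?_, hasDerivAt_limit_phase_line hq (hasDerivAt_heisP_line _ _)
      (hasDerivAt_heisPQuot_line _ _ _)⟩
    rw [hQ0]
    simp only [zero_dotProduct, mul_zero, zero_mul, sub_zero, zero_add, add_zero]
    have := hP.ne'
    have := hF.ne'
    positivity
  · refine ⟨(-y, σ), _, ?_, hasDerivAt_limit_phase_line hq (hasDerivAt_heisP_line _ _)
      (hasDerivAt_heisPQuot_line _ _ _)⟩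
    refine mul_ne_zero hF.ne' ?_
    convert hB using 1
    simp only [hQ, ← hσ, neg_dotProduct, dotProduct_neg, symJ_neg_left, symJ_self]
    ring

/-- The normalized phase difference has no critical points when `β > 2`. -/
lemma exists_fderiv_phase_quotient_ne_zero (ha : a ≠ 0) (hβ : 2 < β)
    {Ψ : HeisSpace n × (ℝ × HeisSpace n) → ℝ}
    (hΨ : ContDiffOn ℝ ∞ Ψ ({x | x.1 ≠ 0} ∩ {x | heisDiv n a x.1 (x.2.1 • x.2.2) ≠ 0}))
    (hΨr : ∀ q r η, q ≠ 0 → r * Ψ (q, (r, η))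
        = heisPhi n β (heisDiv n a q (r • η)) - heisPhi n β q)
    (hΨ0 : ∀ q η, q ≠ 0 → Ψ (q, (0, η)) = β / 4 * heisP n q ^ (β / 4 - 1) * heisPQuot n a q 0 η)
    {q η : HeisSpace n} {r : ℝ} (hη : η ≠ 0) (hq : q ≠ 0)
    (hv : heisDiv n a q (r • η) ≠ 0) :
    ∃ e, fderiv ℝ (fun q => Ψ (q, (r, η))) q e ≠ 0 := by
  by_cases hr : r = 0
  · subst hr
    obtain ⟨e, D, hD, hDe⟩ := exists_limit_phase_deriv_ne_zero (a := a) ha hβ hq hη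
    refine ⟨e, ?_⟩
    have hU : IsOpen ({x | x.1 ≠ 0} ∩ {x | heisDiv n a x.1 (x.2.1 • x.2.2) ≠ 0} :
        Set (HeisSpace n × (ℝ × HeisSpace n))) :=
      (isOpen_ne_zero.preimage continuous_fst).inter
        (isOpen_ne_zero.preimage (by fun_prop))
    have hd : DifferentiableAt ℝ (fun q => Ψ (q, ((0:ℝ), η))) q := by
      have h1 : ContDiffAt ℝ ∞ Ψ (q, ((0:ℝ), η)) :=
        (hΨ (q, (0, η)) ⟨hq, hv⟩).contDiffAt (hU.mem_nhds ⟨hq, hv⟩)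
      have h2 : ContDiffAt ℝ ∞ (fun q => Ψ (q, ((0:ℝ), η))) q :=
        ContDiffAt.comp q (f := fun q : HeisSpace n => (q, ((0:ℝ), η))) h1
          (contDiffAt_id.prodMk contDiffAt_const)
      exact h2.differentiableAt (by simp)
    rw [← hd.lineDeriv_eq_fderiv]
    unfold lineDeriv
    have he : (fun s : ℝ => Ψ (q + s • e, ((0:ℝ), η))) =ᶠ[nhds 0]
        fun s : ℝ => β / 4 * heisP n (q + s • e) ^ (β / 4 - 1)
        * heisPQuot n a (q + s • e) 0 η := by
      have ho : IsOpen ((fun s : ℝ => q + s • e) ⁻¹' {p | p ≠ 0}) :=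
        isOpen_ne_zero.preimage (by fun_prop)
      filter_upwards [ho.mem_nhds (by simpa using hq)] with s hs
      exact hΨ0 _ _ hs
    rw [he.deriv_eq, hDe.deriv]
    exact hD
  · refine ⟨heisDiv n a q (r • η) - q, ?_⟩
    have he : (fun q => Ψ (q, (r, η))) =ᶠ[nhds q]
        fun q => r⁻¹ * (heisPhi n β (heisDiv n a q (r • η)) - heisPhi n β q) := by
      filter_upwards [isOpen_ne_zero.mem_nhds hq] with p hp
      rw [← hΨr p r η hp]; field_simp
    obtain ⟨L, hL, hLe⟩ := hasFDerivAt_heisDiv_heisDil (a := a) 1 (r • η) q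
    simp only [heisDil_one, one_smul, one_pow, one_mul, mul_one] at hL hLe
    have d1 := ((contDiffAt_heisPhi (β := β) hv (m := 1)).differentiableAt one_ne_zero).hasFDerivAt
    have d2 := ((contDiffAt_heisPhi (β := β) hq (m := 1)).differentiableAt one_ne_zero).hasFDerivAt
    have d3 := ((d1.comp q hL).sub d2).const_mul r⁻¹
    have d4 := d3.fderiv
    have hvq : heisDiv n a q (r • η) ≠ q := by
      intro h
      have h1 := congrArg Prod.fst h
      have h2 := congrArg Prod.snd h
      simp only [heisDiv, Prod.smul_fst, Prod.smul_snd, symJ_smul_right, smul_eq_mul,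
        sub_eq_self] at h1 h2
      have hy : η.1 = 0 := (smul_eq_zero.1 h1).resolve_left hr
      have h0 : symJ n q.1 0 = 0 := by simpa using symJ_smul_right 0 q.1 0
      rw [hy, h0] at h2
      have hu : η.2 = 0 := by
        have : r * η.2 = 0 := by linarith
        exact (mul_eq_zero.1 this).resolve_left hr
      exact hη (Prod.ext hy hu)
    have hpos := fderiv_heisPhi_sub_pos hβ hv hq hvq
    rw [he.fderiv_eq]
    have d5 := congrArg (fun T : HeisSpace n →L[ℝ] ℝ => T (heisDiv n a q (r • η) - q)) d4
    have hLv : L (heisDiv n a q (r • η) - q) = heisDiv n a q (r • η) - q := by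
      rw [hLe]
      simp only [heisDiv, Prod.fst_sub, Prod.snd_sub, Prod.smul_fst, symJ_sub_left, symJ_self,
        sub_sub_cancel_left, symJ_smul_right, symJ_smul_left, symJ_neg_left]
      ext
      · simp
      · simp
    refine ne_of_eq_of_ne d5 ?_
    simp only [ContinuousLinearMap.smul_apply, ContinuousLinearMap.sub_apply,
      ContinuousLinearMap.comp_apply, hLv, smul_eq_mul]
    exact mul_ne_zero (inv_ne_zero hr) hpos.ne'

/-- Oscillatory estimate for the square of a single piece. -/
theorem diagonal_bound (ha : a ≠ 0) (hβ : 2 < β) (M : ℝ) (N : ℕ)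
    {b c : (Fin (2*n) → ℝ) × ℝ → ℂ} (hb : ContDiff ℝ ∞ b) (hc : ContDiff ℝ ∞ c)
    (hbz : ∀ p, ¬ (1 ≤ heisP n p ∧ heisP n p ≤ M) → b p = 0)
    (hcz : ∀ p, ¬ (1 ≤ heisP n p ∧ heisP n p ≤ M) → c p = 0) :
    ∃ C, 0 ≤ C ∧ ∀ l : ℝ, 0 < l → ∀ w, w ≠ 0 →
      ‖∫ q, Complex.exp (Complex.I * ((l * heisPhi n β (heisDiv n a q w)
          - l * heisPhi n β q : ℝ) : ℂ))
        * (b (heisDiv n a q w) * c q)‖ ≤ C * ((l * ‖w‖) ^ N)⁻¹ := by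
  obtain ⟨Ψ, hΨ, hΨr, hΨ0⟩ := exists_phase_quotient (n := n) (a := a) β
  have hne : ∀ q : (Fin (2*n) → ℝ) × ℝ, 1 ≤ heisP n q → q ≠ 0 := by
    rintro q h rfl
    rw [heisP_eq_zero.2 rfl] at h; linarith
  let vv : HeisSpace n × (ℝ × HeisSpace n) → HeisSpace n :=
    fun x => heisDiv n a x.1 (x.2.1 • x.2.2)
  have hvv : ContDiff ℝ ∞ vv := by
    simp only [vv]; fun_prop
  let U₀ : Set (HeisSpace n × (ℝ × HeisSpace n)) := {x | x.1 ≠ 0} ∩ {x | vv x ≠ 0}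
  have hU₀ : IsOpen U₀ := (isOpen_ne_zero.preimage continuous_fst).inter
    (isOpen_ne_zero.preimage hvv.continuous)
  let bs := Module.finBasis ℝ (HeisSpace n)
  let g : Fin (Module.finrank ℝ (HeisSpace n)) → HeisSpace n × (ℝ × HeisSpace n) → ℝ :=
    fun k x => fderiv ℝ Ψ x (bs k, 0)
  have hg : ∀ k, ContDiffOn ℝ ∞ (g k) U₀ := fun k =>
    (hΨ.fderiv_of_isOpen hU₀ (by simp)).clm_apply contDiffOn_const
  have hdiff : ∀ x ∈ U₀, HasFDerivAt (fun q => Ψ (q, x.2))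
      ((fderiv ℝ Ψ x).comp (ContinuousLinearMap.inl ℝ (HeisSpace n) (ℝ × HeisSpace n))) x.1 := by
    intro x hx
    have h1 : HasFDerivAt Ψ (fderiv ℝ Ψ x) (x.1, x.2) :=
      ((hΨ x hx).contDiffAt (hU₀.mem_nhds hx)).differentiableAt (by simp) |>.hasFDerivAt
    exact h1.comp x.1 (hasFDerivAt_prodMk_left x.1 x.2)
  have hgd : ∀ x ∈ U₀, ∀ k, fderiv ℝ (fun q => Ψ (q, x.2)) x.1 (bs k) = g k x := by
    intro x hx k
    rw [(hdiff x hx).fderiv]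
    simp [g]
  let GG : HeisSpace n × (ℝ × HeisSpace n) → ℝ := fun x => ∑ k, g k x ^ 2
  have hGG : ContDiffOn ℝ ∞ GG U₀ := ContDiffOn.sum fun k _ => (hg k).pow 2
  let U := U₀ ∩ GG ⁻¹' {0}ᶜ
  have hU : IsOpen U := hGG.continuousOn.isOpen_inter_preimage hU₀ isOpen_compl_singleton
  let K : Set (ℝ × HeisSpace n) := {θ | 0 ≤ θ.1 ∧ ‖θ.2‖ = 1}
  let S : Set (HeisSpace n × (ℝ × HeisSpace n)) :=
    {x | (1 ≤ heisP n x.1 ∧ heisP n x.1 ≤ M) ∧ (1 ≤ heisP n (vv x) ∧ heisP n (vv x) ≤ M)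
      ∧ 0 ≤ x.2.1 ∧ ‖x.2.2‖ = 1}
  have hQ := isCompact_heisP_Icc (n := n) 1 M
  obtain ⟨B, hB⟩ := (hQ.prod hQ).exists_bound_of_continuousOn
    (f := fun x : HeisSpace n × HeisSpace n => heisDiv n a (heisInv n x.2) (heisInv n x.1))
    (Continuous.continuousOn (by fun_prop))
  have hS : IsCompact S := by
    refine IsCompact.of_isClosed_subset (hQ.prod ((isCompact_Icc (a := (0:ℝ)) (b := B)).prod
      (isCompact_sphere (0 : HeisSpace n) 1))) ?_ ?_
    · have hPv : Continuous fun x => heisP n (vv x) := continuous_heisP.comp hvv.continuous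
      have hPq : Continuous fun x : HeisSpace n × (ℝ × HeisSpace n) => heisP n x.1 :=
        continuous_heisP.comp continuous_fst
      have hr : Continuous fun x : HeisSpace n × (ℝ × HeisSpace n) => x.2.1 :=
        continuous_fst.comp continuous_snd
      refine IsClosed.inter (IsClosed.inter ?_ ?_) (IsClosed.inter (IsClosed.inter ?_ ?_)
        (IsClosed.inter ?_ ?_))
      · exact isClosed_le continuous_const hPq
      · exact isClosed_le hPq continuous_const
      · exact isClosed_le continuous_const hPv
      · exact isClosed_le hPv continuous_const
      · exact isClosed_le continuous_const hr
      · exact isClosed_eq (by fun_prop) continuous_const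
    · rintro ⟨q, r, η⟩ ⟨h1, h2, h3, h4⟩
      simp only at h3 h4
      refine ⟨h1, ⟨h3, ?_⟩, by simpa using h4⟩
      have := hB (q, vv (q, r, η)) ⟨h1, h2⟩
      simp only at this
      rw [← eq_heisDiv_of_heisDiv_eq (p := q) (w := r • η) rfl, norm_smul, h4, mul_one,
        Real.norm_of_nonneg h3] at this
      exact this
  have hSU : S ⊆ U := by
    rintro ⟨q, r, η⟩ ⟨h1, h2, h3, h4⟩
    have hx : (q, r, η) ∈ U₀ := ⟨hne _ h1.1, hne _ h2.1⟩
    refine ⟨hx, ?_⟩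
    simp only [Set.mem_preimage, Set.mem_compl_iff, Set.mem_singleton_iff]
    intro h0
    have hk : ∀ k, g k (q, r, η) = 0 := by
      intro k
      have := (Finset.sum_eq_zero_iff_of_nonneg (fun k _ => sq_nonneg (g k (q, r, η)))).1 h0 k
        (Finset.mem_univ k)
      exact pow_eq_zero_iff two_ne_zero |>.1 this
    have hη : η ≠ 0 := by
      rintro rfl; simp at h4
    obtain ⟨e, he⟩ := exists_fderiv_phase_quotient_ne_zero ha hβ hΨ hΨr hΨ0 (r := r) hη
      (hne _ h1.1) (hne _ h2.1)
    apply he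
    rw [← bs.sum_repr e, map_sum]
    refine Finset.sum_eq_zero fun k _ => ?_
    rw [map_smul]
    have := hgd _ hx k
    simp only at this
    rw [this, hk, smul_zero]
  let V : HeisSpace n × (ℝ × HeisSpace n) → HeisSpace n := fun x => (GG x)⁻¹ • ∑ k, g k x • bs k
  have hV : ContDiffOn ℝ ∞ V U :=
    ContDiffOn.smul ((hGG.mono Set.inter_subset_left).inv fun x hx => hx.2)
      (ContDiffOn.sum fun k _ => ((hg k).mono Set.inter_subset_left).smul contDiffOn_const)
  obtain ⟨C, hC0, hC⟩ := nonstationary_phase (volume : Measure (HeisSpace n)) hU hS hSU K hV N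
    (fun x => b (vv x) * c x.1) (by
      have h1 := hb.comp hvv
      have h2 := hc.comp (contDiff_fst : ContDiff ℝ ∞
        (Prod.fst : HeisSpace n × (ℝ × HeisSpace n) → HeisSpace n))
      exact (h1.mul h2).contDiffOn) (by
      rintro q ⟨r, η⟩ hθ hnS
      by_contra hne0
      simp only at hne0
      have h1 : 1 ≤ heisP n (vv (q, r, η)) ∧ heisP n (vv (q, r, η)) ≤ M := by
        by_contra h; exact hne0 (by rw [hbz _ h, zero_mul])
      have h2 : 1 ≤ heisP n q ∧ heisP n q ≤ M := by
        by_contra h; exact hne0 (by rw [hcz _ h, mul_zero])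
      exact hnS ⟨h2, h1, hθ⟩)
  refine ⟨C, hC0, ?_⟩
  intro l hl w hw
  have hw0 : 0 < ‖w‖ := norm_pos_iff.2 hw
  have hww : ‖w‖ • (‖w‖⁻¹ • w) = w := by rw [smul_smul, mul_inv_cancel₀ hw0.ne', one_smul]
  have hη1 : ‖(‖w‖⁻¹ • w)‖ = 1 := by
    rw [norm_smul, norm_inv, norm_norm, inv_mul_cancel₀ hw0.ne']
  have hvvw : ∀ q, vv (q, ‖w‖, ‖w‖⁻¹ • w) = heisDiv n a q w := by
    intro q; simp only [vv, hww]
  have key := hC (‖w‖, ‖w‖⁻¹ • w) ⟨hw0.le, hη1⟩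
    (fun q => l * heisPhi n β (heisDiv n a q w) - l * heisPhi n β q) (l * ‖w‖) (by positivity)
    ?_ ?_
  · simpa only [hvvw] using key
  · intro q hq
    have hv0 : heisDiv n a q w ≠ 0 := by rw [← hvvw]; exact hq.1.2
    refine ContDiffAt.sub (contDiffAt_const.mul ?_) (contDiffAt_const.mul ?_)
    · refine ContDiffAt.comp q (f := fun q => heisDiv n a q w)
        (contDiffAt_heisPhi hv0) ?_
      exact ContDiff.contDiffAt (by fun_prop)
    · exact contDiffAt_heisPhi hq.1.1
  · intro q hqS
    have hq := hSU hqS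
    have he : (fun q => l * heisPhi n β (heisDiv n a q w) - l * heisPhi n β q) =ᶠ[nhds q]
        fun q => (l * ‖w‖) * Ψ (q, (‖w‖, ‖w‖⁻¹ • w)) := by
      filter_upwards [isOpen_ne_zero.mem_nhds (show q ≠ 0 from hq.1.1)] with p hp
      have := hΨr p ‖w‖ (‖w‖⁻¹ • w) hp
      rw [hww] at this
      rw [mul_assoc, this]; ring
    have hd := hdiff _ hq.1
    simp only at hd
    have hgd' := hgd _ hq.1
    simp only at hgd'
    rw [hd.fderiv] at hgd'
    rw [he.fderiv_eq, (hd.const_mul _).fderiv, ContinuousLinearMap.smul_apply, smul_eq_mul]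
    have hG0 : GG (q, (‖w‖, ‖w‖⁻¹ • w)) ≠ 0 := hq.2
    have : ((fderiv ℝ Ψ (q, ‖w‖, ‖w‖⁻¹ • w)).comp
        (ContinuousLinearMap.inl ℝ (HeisSpace n) (ℝ × HeisSpace n)))
        (V (q, ‖w‖, ‖w‖⁻¹ • w)) = 1 := by
      simp only [V]
      rw [map_smul, map_sum, smul_eq_mul, inv_mul_eq_one₀ hG0]
      refine Finset.sum_congr rfl fun k _ => ?_
      rw [map_smul, hgd', smul_eq_mul, sq]
    rw [this, mul_one]

end DiagonalBound

section WaveKernel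

open scoped ContDiff

variable {n : ℕ} {a α β : ℝ}

@[fun_prop]
lemma continuous_heisPhi (hβ : 0 < β) : Continuous (heisPhi n β) :=
  continuous_heisP.rpow_const fun _ => Or.inr (by positivity)

/-- The annular piece at scale `R` of an oscillating kernel with profile `b`. -/
def waveKer (n : ℕ) (α β : ℝ) (b : (Fin (2*n) → ℝ) × ℝ → ℂ) (R : ℝ)
    (p : (Fin (2*n) → ℝ) × ℝ) : ℂ :=
  ((R ^ (α - (2 * n + 2 : ℕ)) : ℝ) : ℂ) * Complex.exp (Complex.I * (heisPhi n β p : ℝ))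
    * b (heisDil n R⁻¹ p)

lemma waveKer_heisDil {b : (Fin (2*n) → ℝ) × ℝ → ℂ} {R : ℝ} (hR : 0 < R)
    (p : (Fin (2*n) → ℝ) × ℝ) :
    waveKer n α β b R (heisDil n R p) = ((R ^ (α - (2 * n + 2 : ℕ)) : ℝ) : ℂ)
      * Complex.exp (Complex.I * ((R ^ β * heisPhi n β p : ℝ) : ℂ)) * b p := by
  rw [waveKer, heisPhi_heisDil hR.le, heisDil_heisDil, inv_mul_cancel₀ hR.ne', heisDil_one]

lemma continuous_waveKer (hβ : 0 < β) {b : (Fin (2*n) → ℝ) × ℝ → ℂ} (hb : Continuous b)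
    (R : ℝ) : Continuous (waveKer n α β b R) := by
  have := continuous_heisPhi (n := n) hβ
  unfold waveKer
  fun_prop

lemma hasCompactSupport_waveKer {b : (Fin (2*n) → ℝ) × ℝ → ℂ} {M : ℝ}
    (hbz : ∀ p, ¬ (1 ≤ heisP n p ∧ heisP n p ≤ M) → b p = 0) {R : ℝ} (hR : 0 < R) :
    HasCompactSupport (waveKer n α β b R) := by
  refine HasCompactSupport.intro (isCompact_heisP_Icc (n := n) (R ^ 4) (R ^ 4 * M)) fun p hp => ?_
  rw [waveKer, hbz _ (fun h => hp ?_), mul_zero]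
  rw [heisP_heisDil] at h
  have hR4 : 0 < R ^ 4 := by positivity
  rw [inv_pow, inv_mul_eq_div, one_le_div hR4, div_le_iff₀ hR4, mul_comm M] at h
  exact h

lemma heisPhi_heisInv (p : (Fin (2*n) → ℝ) × ℝ) : heisPhi n β (heisInv n p) = heisPhi n β p := by
  rw [heisPhi, heisP_heisInv, heisPhi]

lemma waveKer_heisInv {b : (Fin (2*n) → ℝ) × ℝ → ℂ} (hbs : ∀ p, b (heisInv n p) = b p) (R : ℝ)
    (p : (Fin (2*n) → ℝ) × ℝ) : waveKer n α β b R (heisInv n p) = waveKer n α β b R p := by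
  rw [waveKer, heisPhi_heisInv, ← heisInv_heisDil, hbs, waveKer]

/-- The oscillatory integral obtained by rescaling the composition of two annular pieces. -/
def waveInt (n : ℕ) (a β : ℝ) (b : (Fin (2*n) → ℝ) × ℝ → ℂ) (ε l l' : ℝ)
    (w : (Fin (2*n) → ℝ) × ℝ) : ℂ :=
  ∫ q, Complex.exp (Complex.I * ((l * heisPhi n β (heisDiv n a (heisDil n ε q) w)
      - l' * heisPhi n β q : ℝ) : ℂ))
    * (b (heisDiv n a (heisDil n ε q) w) * starRingEnd ℂ (b q))

lemma convOp_waveKer_heisDil {b : (Fin (2*n) → ℝ) × ℝ → ℂ} (hbs : ∀ p, b (heisInv n p) = b p)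
    {R R' : ℝ} (hR : 0 < R) (hR' : 0 < R') (w : (Fin (2*n) → ℝ) × ℝ) :
    convOp n a (waveKer n α β b R) (fun p => starRingEnd ℂ (waveKer n α β b R' p)) (heisDil n R w)
      = ((R ^ (α - (2 * n + 2 : ℕ)) * R' ^ α : ℝ) : ℂ)
        * waveInt n a β b (R' / R) (R ^ β) (R' ^ β) w := by
  rw [convOp_eq, integral_comp_heisDil hR', waveInt, ← integral_const_mul, ← integral_const_mul]
  refine integral_congr_ae (Filter.Eventually.of_forall fun q => ?_)
  simp only
  have h1 : heisDil n R' q = heisDil n R (heisDil n (R' / R) q) := by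
    rw [heisDil_heisDil, mul_div_cancel₀ _ hR.ne']
  have h2 : waveKer n α β b R (heisDiv n a (heisDil n R w) (heisDil n R' q))
      = ((R ^ (α - (2 * n + 2 : ℕ)) : ℝ) : ℂ)
      * Complex.exp (Complex.I *
          ((R ^ β * heisPhi n β (heisDiv n a (heisDil n (R' / R) q) w) : ℝ) : ℂ))
        * b (heisDiv n a (heisDil n (R' / R) q) w) := by
    rw [← heisInv_heisDiv, waveKer_heisInv hbs, h1, heisDiv_heisDil, waveKer_heisDil hR]
  have h3 : ((R' ^ α : ℝ) : ℂ) = (R' : ℂ) ^ (2*n+2) * ((R' ^ (α - (2 * n + 2 : ℕ)) : ℝ) : ℂ) := by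
    rw [Real.rpow_sub hR', Real.rpow_natCast]
    push_cast
    rw [mul_div_cancel₀]
    exact pow_ne_zero _ (by exact_mod_cast hR'.ne')
  rw [h2, waveKer_heisDil hR', map_mul, map_mul, Complex.conj_ofReal, ← Complex.exp_conj, map_mul,
    Complex.conj_ofReal, Complex.conj_I]
  rw [Complex.ofReal_sub, mul_sub, Complex.exp_sub, Complex.ofReal_mul (R ^ _) (R' ^ α), h3,
    neg_mul, Complex.exp_neg]
  ring

lemma lintegral_convOp_waveKer {b : (Fin (2*n) → ℝ) × ℝ → ℂ} (hbs : ∀ p, b (heisInv n p) = b p)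
    {R R' : ℝ} (hR : 0 < R) (hR' : 0 < R') :
    ∫⁻ p, ‖convOp n a (waveKer n α β b R) (fun p => starRingEnd ℂ (waveKer n α β b R' p)) p‖ₑ
      = ENNReal.ofReal (R ^ α * R' ^ α)
        * ∫⁻ w, ‖waveInt n a β b (R' / R) (R ^ β) (R' ^ β) w‖ₑ := by
  rw [lintegral_comp_heisDil hR]
  simp_rw [convOp_waveKer_heisDil hbs hR hR', enorm_mul]
  rw [lintegral_const_mul' _ _ enorm_ne_top, ← mul_assoc]
  congr 1
  rw [← ofReal_norm, Complex.norm_real, Real.norm_of_nonneg (by positivity),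
    ← ENNReal.ofReal_mul (by positivity), ← mul_assoc]
  congr 2
  rw [Real.rpow_sub hR, Real.rpow_natCast, mul_div_cancel₀ _ (by positivity)]

lemma convOp_conj_comm {K K' : (Fin (2*n) → ℝ) × ℝ → ℂ} (p : (Fin (2*n) → ℝ) × ℝ) :
    convOp n a (fun p => starRingEnd ℂ (K p)) K' p
      = starRingEnd ℂ (convOp n a K (fun p => starRingEnd ℂ (K' p)) p) := by
  rw [convOp_eq, convOp_eq, ← integral_conj]
  simp

/-- Support of the rescaled oscillatory integral. -/
lemma exists_compact_waveInt {b : (Fin (2*n) → ℝ) × ℝ → ℂ} {M : ℝ}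
    (hbz : ∀ p, ¬ (1 ≤ heisP n p ∧ heisP n p ≤ M) → b p = 0) :
    ∃ W : Set ((Fin (2*n) → ℝ) × ℝ), IsCompact W ∧ ∀ ε ∈ Set.Icc (0:ℝ) 1, ∀ l l' : ℝ, ∀ w ∉ W,
      waveInt n a β b ε l l' w = 0 := by
  have hQ := isCompact_heisP_Icc (n := n) 1 M
  refine ⟨_, ((isCompact_Icc (a := (0:ℝ)) (b := 1)).prod (hQ.prod hQ)).image
    (f := fun x => heisDiv n a (heisInv n x.2.2) (heisInv n (heisDil n x.1 x.2.1)))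
    (by fun_prop), ?_⟩
  intro ε hε l l' w hw
  refine integral_eq_zero_of_ae (Filter.Eventually.of_forall fun q => ?_)
  by_contra hne
  simp only [Pi.zero_apply] at hne
  have h1 := left_ne_zero_of_mul (right_ne_zero_of_mul hne)
  have h2 : b q ≠ 0 := by
    have := right_ne_zero_of_mul (right_ne_zero_of_mul hne)
    simpa using this
  refine hw ⟨(ε, q, heisDiv n a (heisDil n ε q) w), ⟨hε, ?_, ?_⟩,
    (eq_heisDiv_of_heisDiv_eq rfl).symm⟩
  · by_contra h; exact h2 (hbz _ h)
  · by_contra h; exact h1 (hbz _ h)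

end WaveKernel

section KernelBounds

open scoped ContDiff

variable {n : ℕ} {a α β : ℝ}

theorem lintegral_convOp_waveKer_le_offDiagonal (hβ : 2 < β)
    {b : (Fin (2*n) → ℝ) × ℝ → ℂ} {M : ℝ} (hb : ContDiff ℝ ∞ b)
    (hbs : ∀ p, b (heisInv n p) = b p)
    (hbz : ∀ p, ¬ (1 ≤ heisP n p ∧ heisP n p ≤ M) → b p = 0) :
    ∃ m : ℕ, ∃ C : ℝ, 0 ≤ C ∧ ∀ R R' : ℝ, 1 ≤ R' → R' * 2 ^ m ≤ R →
      ∫⁻ p, ‖convOp n a (waveKer n α β b R)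
          (fun p => starRingEnd ℂ (waveKer n α β b R' p)) p‖ₑ
        ≤ ENNReal.ofReal (C * (R⁻¹ * R'⁻¹)) := by
  obtain ⟨κ₀, hκ₀, hoff⟩ := offDiagonal_bound (n := n) (a := a) (by linarith : 0 < β) M
  obtain ⟨N, hN⟩ : ∃ N : ℕ, α + 1 ≤ (β - 2) * N ∧ α + 1 ≤ 2 * N := by
    obtain ⟨N, hN⟩ := exists_nat_ge (max ((α + 1) / (β - 2)) ((α + 1) / 2))
    refine ⟨N, ?_, ?_⟩
    · have := (le_max_left _ _).trans hN
      rw [div_le_iff₀ (by linarith)] at this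
      linarith
    · have := (le_max_right _ _).trans hN
      rw [div_le_iff₀ (by norm_num)] at this
      linarith
  have hbc : ContDiff ℝ ∞ (fun q => starRingEnd ℂ (b q)) := Complex.conjCLE.contDiff.comp hb
  obtain ⟨C, hC0, hC⟩ := hoff N hb hbc hbz (fun p hp => by simp [hbz p hp])
  obtain ⟨W, hW, hWz⟩ := exists_compact_waveInt (a := a) (β := β) hbz
  obtain ⟨m, hm⟩ := exists_pow_lt_of_lt_one (Real.rpow_pos_of_pos hκ₀ (β - 2)⁻¹)
    (by norm_num : (1 / 2 : ℝ) < 1)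
  refine ⟨m, C * (volume W).toReal, by positivity, ?_⟩
  intro R R' hR' hRR'
  have h2m : (1:ℝ) ≤ 2 ^ m := one_le_pow₀ (by norm_num)
  have hR'0 : 0 < R' := by linarith
  have hR : R' ≤ R := le_trans (by nlinarith) hRR'
  have hR1 : 1 ≤ R := hR'.trans hR
  have hR0 : 0 < R := by linarith
  have hε0 : 0 < R' / R := by positivity
  have hε1 : R' / R ≤ 1 := (div_le_one hR0).2 hR
  have hεm : R' / R ≤ (1 / 2) ^ m := by
    rw [div_le_iff₀ hR0, one_div, inv_pow, inv_mul_eq_div, le_div_iff₀ (by positivity)]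
    exact hRR'
  have hκ : (R' / R) ^ (β - 2) ≤ κ₀ := by
    calc (R' / R) ^ (β - 2) ≤ (κ₀ ^ (β - 2)⁻¹) ^ (β - 2) :=
          Real.rpow_le_rpow hε0.le (hεm.trans hm.le) (by linarith)
      _ = κ₀ := by rw [← Real.rpow_mul hκ₀.le, inv_mul_cancel₀ (by linarith), Real.rpow_one]
  have hl' : R' ^ β = R ^ β * (R' / R) ^ 2 * (R' / R) ^ (β - 2) := by
    rw [mul_assoc, ← Real.rpow_natCast, ← Real.rpow_add hε0, Real.div_rpow hR'0.le hR0.le]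
    push_cast
    rw [add_sub_cancel, mul_div_cancel₀ _ (by positivity)]
  set D := C * ((R ^ β * (R' / R) ^ 2) ^ N)⁻¹ with hD
  have hbd : ∀ w, ‖waveInt n a β b (R' / R) (R ^ β) (R' ^ β) w‖ ≤ D := by
    intro w
    have := hC (R' / R) ⟨hε0, hε1⟩ ((R' / R) ^ (β - 2)) ⟨by positivity, hκ⟩ (R ^ β)
      (by positivity) w
    rw [waveInt, hl']
    exact this
  rw [lintegral_convOp_waveKer hbs hR0 hR'0]
  have hint : ∫⁻ w, ‖waveInt n a β b (R' / R) (R ^ β) (R' ^ β) w‖ₑ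
      ≤ ENNReal.ofReal (D * (volume W).toReal) := by
    calc _ ≤ ∫⁻ w, W.indicator (fun _ => ENNReal.ofReal D) w := by
          refine lintegral_mono fun w => ?_
          by_cases hw : w ∈ W
          · simp only [hw, Set.indicator_of_mem]
            rw [← ofReal_norm]
            exact ENNReal.ofReal_le_ofReal (hbd w)
          · rw [hWz _ ⟨hε0.le, hε1⟩ _ _ w hw]; simp
      _ = _ := by
          rw [lintegral_indicator hW.measurableSet, setLIntegral_const,
            ENNReal.ofReal_mul (p := D) (by positivity), ENNReal.ofReal_toReal hW.measure_lt_top.ne]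
  refine (mul_le_mul_right hint _).trans ?_
  rw [← ENNReal.ofReal_mul (by positivity)]
  refine ENNReal.ofReal_le_ofReal ?_
  have hkey : (R ^ α * R' ^ α) * ((R ^ β * (R' / R) ^ 2) ^ N)⁻¹ ≤ R⁻¹ * R'⁻¹ := by
    have e : (R ^ β * (R' / R) ^ 2) ^ N = R ^ ((β - 2) * N) * R' ^ (2 * N : ℝ) := by
      have e1 : R ^ β * (R' / R) ^ 2 = R ^ (β - 2) * R' ^ (2:ℝ) := by
        rw [Real.rpow_sub hR0, Real.rpow_ofNat, Real.rpow_ofNat]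
        field_simp
      rw [e1, mul_pow, Real.rpow_mul hR0.le, Real.rpow_mul hR'0.le, Real.rpow_natCast,
        Real.rpow_natCast]
    have h1 : R ^ α * R ≤ R ^ ((β - 2) * N) := by
      rw [← Real.rpow_add_one hR0.ne']
      exact Real.rpow_le_rpow_of_exponent_le hR1 hN.1
    have h2 : R' ^ α * R' ≤ R' ^ (2 * N : ℝ) := by
      rw [← Real.rpow_add_one hR'0.ne']
      exact Real.rpow_le_rpow_of_exponent_le hR' hN.2
    rw [e, ← div_eq_mul_inv, div_le_iff₀ (by positivity), ← mul_inv, inv_mul_eq_div,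
      le_div_iff₀ (by positivity)]
    calc _ = (R ^ α * R) * (R' ^ α * R') := by ring
      _ ≤ _ := by gcongr
  calc _ = (C * (volume W).toReal) * ((R ^ α * R' ^ α) * ((R ^ β * (R' / R) ^ 2) ^ N)⁻¹) := by
        rw [hD]; ring
    _ ≤ _ := by gcongr

theorem lintegral_convOp_waveKer_le_diagonal (ha : a ≠ 0) (hβ : 2 < β)
    (hαβ : α ≤ (n + 1/2) * β)
    {b : (Fin (2*n) → ℝ) × ℝ → ℂ} {M : ℝ} (hb : ContDiff ℝ ∞ b)
    (hbs : ∀ p, b (heisInv n p) = b p)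
    (hbz : ∀ p, ¬ (1 ≤ heisP n p ∧ heisP n p ≤ M) → b p = 0) :
    ∃ C : ℝ, 0 ≤ C ∧ ∀ R : ℝ, 1 ≤ R →
      ∫⁻ p, ‖convOp n a (waveKer n α β b R)
          (fun p => starRingEnd ℂ (waveKer n α β b R p)) p‖ₑ ≤ ENNReal.ofReal C := by
  have hbc : ContDiff ℝ ∞ (fun q => starRingEnd ℂ (b q)) := Complex.conjCLE.contDiff.comp hb
  have hbcz : ∀ p, ¬ (1 ≤ heisP n p ∧ heisP n p ≤ M) → starRingEnd ℂ (b p) = 0 :=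
    fun p hp => by simp [hbz p hp]
  obtain ⟨C₀, hC₀, h₀⟩ := diagonal_bound (n := n) ha hβ M 0 hb hbc hbz hbcz
  obtain ⟨C₁, hC₁, h₁⟩ := diagonal_bound (n := n) ha hβ M (2 * n + 2) hb hbc hbz hbcz
  have hfr : Module.finrank ℝ (HeisSpace n) = 2 * n + 1 := by simp
  have hint : Integrable fun w : HeisSpace n => (1 + ‖w‖) ^ (-((2 * n + 2 : ℕ) : ℝ)) := by
    refine integrable_one_add_norm ?_
    rw [hfr]
    push_cast
    linarith
  set I := ∫ w : HeisSpace n, (1 + ‖w‖) ^ (-((2 * n + 2 : ℕ) : ℝ)) with hI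
  have hI0 : 0 ≤ I := integral_nonneg fun w => by positivity
  set D := (C₀ + C₁) * 2 ^ (2 * n + 2) with hD
  have hD0 : 0 ≤ D := by positivity
  refine ⟨D * I, by positivity, ?_⟩
  intro R hR
  have hR0 : 0 < R := by linarith
  set l := R ^ β with hl
  have hl0 : 0 < l := by positivity
  have hbd : ∀ w, w ≠ 0 → ‖waveInt n a β b 1 l l w‖
      ≤ D * (1 + ‖l • w‖) ^ (-((2 * n + 2 : ℕ) : ℝ)) := by
    intro w hw
    have e0 := h₀ l hl0 w hw
    have e1 := h₁ l hl0 w hw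
    simp only [waveInt, heisDil_one]
    rw [pow_zero, inv_one, mul_one] at e0
    rw [norm_smul, Real.norm_of_nonneg hl0.le, Real.rpow_neg (by positivity), Real.rpow_natCast]
    set x := l * ‖w‖ with hx
    have hx0 : 0 < x := mul_pos hl0 (norm_pos_iff.2 hw)
    rcases le_total x 1 with h | h
    · refine e0.trans ?_
      have : (1 + x) ^ (2 * n + 2) ≤ 2 ^ (2 * n + 2) := by
        gcongr; linarith
      rw [hD, ← div_eq_mul_inv, le_div_iff₀ (by positivity)]
      gcongr
      linarith
    · refine e1.trans ?_
      have : (1 + x) ^ (2 * n + 2) ≤ 2 ^ (2 * n + 2) * x ^ (2 * n + 2) := by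
        rw [← mul_pow]
        gcongr; linarith
      rw [hD, ← div_eq_mul_inv, ← div_eq_mul_inv, div_le_div_iff₀ (by positivity) (by positivity),
        mul_assoc]
      gcongr
      linarith
  rw [lintegral_convOp_waveKer hbs hR0 hR0, div_self hR0.ne', ← hl]
  have hint2 : ∫⁻ w, ‖waveInt n a β b 1 l l w‖ₑ ≤ ENNReal.ofReal (D * ((l ^ (2 * n + 1))⁻¹ * I)) := by
    calc _ ≤ ∫⁻ w : HeisSpace n, ENNReal.ofReal
            (D * (1 + ‖l • w‖) ^ (-((2 * n + 2 : ℕ) : ℝ))) := by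
          refine lintegral_mono_ae ?_
          have h0 : ∀ᵐ w : HeisSpace n, w ≠ 0 := by
            rw [ae_iff]; simp
          filter_upwards [h0] with w hw
          rw [← ofReal_norm]
          exact ENNReal.ofReal_le_ofReal (hbd w hw)
      _ = _ := by
          rw [← ofReal_integral_eq_lintegral_ofReal
            ((hint.comp_smul hl0.ne').const_mul D)
            (Filter.Eventually.of_forall fun w => by positivity), integral_const_mul]
          have := Measure.integral_comp_smul (volume : Measure (HeisSpace n))
            (fun w => (1 + ‖w‖) ^ (-((2 * n + 2 : ℕ) : ℝ))) l
          rw [this, hfr, abs_of_pos (by positivity), smul_eq_mul]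
  refine (mul_le_mul_right hint2 _).trans ?_
  rw [← ENNReal.ofReal_mul (by positivity)]
  refine ENNReal.ofReal_le_ofReal ?_
  have hkey : R ^ α * R ^ α * (l ^ (2 * n + 1))⁻¹ ≤ 1 := by
    rw [← div_eq_mul_inv, div_le_one (by positivity), hl, ← Real.rpow_add hR0,
      ← Real.rpow_natCast, ← Real.rpow_mul hR0.le]
    refine Real.rpow_le_rpow_of_exponent_le hR ?_
    push_cast
    nlinarith
  calc _ = (D * I) * (R ^ α * R ^ α * (l ^ (2 * n + 1))⁻¹) := by ring
    _ ≤ (D * I) * 1 := by gcongr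
    _ = _ := mul_one _

end KernelBounds

section Sufficiency

open scoped ContDiff InnerProductSpace

variable {n : ℕ} {a α β : ℝ}

/-- Continuous compactly supported functions on the group. -/
def TestFun (n : ℕ) : Type := {f : HeisSpace n → ℂ // Continuous f ∧ HasCompactSupport f}

/-- The class in `L²` of a test function. -/
def TestFun.toL2 (f : TestFun n) : Lp ℂ 2 (volume : Measure (HeisSpace n)) :=
  (f.2.1.memLp_of_hasCompactSupport f.2.2).toLp f.1

lemma TestFun.coeFn_toL2 (f : TestFun n) : f.toL2 =ᵐ[volume] f.1 := MemLp.coeFn_toLp _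

lemma TestFun.norm_toL2 (f : TestFun n) : ‖f.toL2‖ = (eLpNorm f.1 2 volume).toReal :=
  Lp.norm_toLp _ _

lemma TestFun.eLpNorm_ne_top (f : TestFun n) : eLpNorm f.1 2 volume ≠ ⊤ :=
  (f.2.1.memLp_of_hasCompactSupport f.2.2).eLpNorm_ne_top

lemma TestFun.inner_toL2 (f g : TestFun n) :
    ⟪f.toL2, g.toL2⟫_ℂ = ∫ p, g.1 p * starRingEnd ℂ (f.1 p) := by
  rw [L2.inner_def]
  refine integral_congr_ae ?_
  filter_upwards [f.coeFn_toL2, g.coeFn_toL2] with p h1 h2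
  rw [h1, h2, RCLike.inner_apply]

lemma TestFun.coeFn_sum_toL2 {κ : Type*} (F : Finset κ) (g : κ → TestFun n) :
    (∑ j ∈ F, (g j).toL2 : Lp ℂ 2 (volume : Measure (HeisSpace n)))
      =ᵐ[volume] fun p => ∑ j ∈ F, (g j).1 p := by
  classical
  induction F using Finset.induction_on with
  | empty =>
    simp only [Finset.sum_empty]
    exact Lp.coeFn_zero ℂ 2 (volume : Measure (HeisSpace n))
  | insert j F hj ih =>
    rw [Finset.sum_insert hj]
    filter_upwards [Lp.coeFn_add (g j).toL2 (∑ j ∈ F, (g j).toL2), (g j).coeFn_toL2, ih]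
      with p h1 h2 h3
    rw [h1, Pi.add_apply, h2, h3, Finset.sum_insert hj]

/-- Convolution by a test function. -/
def TestFun.conv (a : ℝ) (k f : TestFun n) : TestFun n :=
  ⟨convOp n a k.1 f.1, convOp_continuous k.2.1 f.2.1 f.2.2,
    convOp_hasCompactSupport k.2.2 f.2.2⟩

/-- The complex conjugate of a test function. -/
def TestFun.conj (k : TestFun n) : TestFun n :=
  ⟨fun p => starRingEnd ℂ (k.1 p), Complex.continuous_conj.comp k.2.1,
    k.2.2.comp_left (g := starRingEnd ℂ) (map_zero _)⟩

lemma TestFun.norm_conv_conv_le (k k' f : TestFun n) {c : ℝ} (hc : 0 ≤ c)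
    (h : ∫⁻ p, ‖convOp n a k.1 k'.1 p‖ₑ ≤ ENNReal.ofReal c) :
    ‖((k.conv a (k'.conv a f)).toL2)‖ ≤ c * ‖f.toL2‖ := by
  have e : (k.conv a (k'.conv a f)).1 = convOp n a (k.conv a k').1 f.1 :=
    convOp_assoc k.2.1 k.2.2 k'.2.1 k'.2.2 f.2.1 f.2.2
  rw [TestFun.norm_toL2, TestFun.norm_toL2, e, ← ENNReal.toReal_ofReal hc, ← ENNReal.toReal_mul]
  refine ENNReal.toReal_mono (ENNReal.mul_ne_top ENNReal.ofReal_ne_top f.eLpNorm_ne_top) ?_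
  refine (eLpNorm_convOp_le (k.conv a k').2.1 f.2.1).trans ?_
  gcongr
  exact h

lemma TestFun.inner_conv (k : TestFun n) (hk : ∀ p, k.1 (heisInv n p) = k.1 p) (f g : TestFun n) :
    ⟪(k.conv a f).toL2, g.toL2⟫_ℂ = ⟪f.toL2, (k.conj.conv a g).toL2⟫_ℂ := by
  rw [TestFun.inner_toL2, TestFun.inner_toL2]
  exact convOp_adjoint k.2.1 hk f.2.1 f.2.2 g.2.1 g.2.2

lemma lintegral_enorm_convOp_conj_comm (K K' : HeisSpace n → ℂ) :
    ∫⁻ p, ‖convOp n a (fun p => starRingEnd ℂ (K p)) K' p‖ₑ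
      = ∫⁻ p, ‖convOp n a K (fun p => starRingEnd ℂ (K' p)) p‖ₑ := by
  refine lintegral_congr fun p => ?_
  rw [convOp_conj_comm, RCLike.enorm_conj]

lemma norm_le_sqrt_mul_of_sq_le {x y c : ℝ} (hx : 0 ≤ x) (hy : 0 ≤ y) (hc : 0 ≤ c)
    (h : x ^ 2 ≤ y * (c * y)) : x ≤ Real.sqrt c * y := by
  refine le_of_sq_le_sq ?_ (by positivity)
  rw [mul_pow, Real.sq_sqrt hc]
  linarith

/-- Uniform `L²` bound for the partial sums of the dyadic decomposition. -/
theorem exists_bound_sum_waveKer (ha : a ≠ 0) (hβ : 2 < β) (hαβ : α ≤ (n + 1/2) * β)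
    {b : (Fin (2*n) → ℝ) × ℝ → ℂ} {M : ℝ} (hb : ContDiff ℝ ∞ b)
    (hbs : ∀ p, b (heisInv n p) = b p)
    (hbz : ∀ p, ¬ (1 ≤ heisP n p ∧ heisP n p ≤ M) → b p = 0) :
    ∃ C : ℝ, 0 ≤ C ∧ ∀ f : HeisSpace n → ℂ, Continuous f → HasCompactSupport f → ∀ J : ℕ,
      eLpNorm (fun p => ∑ j ∈ Finset.range J, convOp n a (waveKer n α β b (2 ^ j)) f p) 2 volume
        ≤ ENNReal.ofReal C * eLpNorm f 2 volume := by
  obtain ⟨m, C₁, hC₁, hoff⟩ :=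
    lintegral_convOp_waveKer_le_offDiagonal (a := a) (α := α) hβ hb hbs hbz
  obtain ⟨C₀, hC₀, hdiag⟩ := lintegral_convOp_waveKer_le_diagonal ha hβ hαβ hb hbs hbz
  let k : ℕ → TestFun n := fun j => ⟨waveKer n α β b (2 ^ j),
    continuous_waveKer (by linarith) hb.continuous _,
    hasCompactSupport_waveKer hbz (by positivity)⟩
  have hk : ∀ j p, (k j).1 (heisInv n p) = (k j).1 p := fun j p => waveKer_heisInv hbs _ p
  let T : ℕ → TestFun n → TestFun n := fun j f => (k j).conv a f
  let S : ℕ → TestFun n → TestFun n := fun j f => (k j).conj.conv a f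
  have hadj : ∀ j (f g : TestFun n), ⟪(T j f).toL2, g.toL2⟫_ℂ = ⟪f.toL2, (S j g).toL2⟫_ℂ :=
    fun j f g => TestFun.inner_conv (k j) (hk j) f g
  have hSTdiag : ∀ j f, ‖(S j (T j f)).toL2‖ ≤ C₀ * ‖f.toL2‖ := fun j f =>
    TestFun.norm_conv_conv_le _ _ _ hC₀ ((lintegral_enorm_convOp_conj_comm _ _).le.trans
      (hdiag (2 ^ j) (one_le_pow₀ (by norm_num))))
  have hTSdiag : ∀ j f, ‖(T j (S j f)).toL2‖ ≤ C₀ * ‖f.toL2‖ := fun j f =>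
    TestFun.norm_conv_conv_le _ _ _ hC₀ (hdiag (2 ^ j) (one_le_pow₀ (by norm_num)))
  have hT : ∀ j f, ‖(T j f).toL2‖ ≤ Real.sqrt C₀ * ‖f.toL2‖ := by
    intro j f
    refine norm_le_sqrt_mul_of_sq_le (norm_nonneg _) (norm_nonneg _) hC₀ ?_
    calc ‖(T j f).toL2‖ ^ 2 = ‖⟪(T j f).toL2, (T j f).toL2⟫_ℂ‖ := by
          rw [inner_self_eq_norm_sq_to_K]; simp
      _ = ‖⟪f.toL2, (S j (T j f)).toL2⟫_ℂ‖ := by rw [hadj]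
      _ ≤ ‖f.toL2‖ * ‖(S j (T j f)).toL2‖ := norm_inner_le_norm _ _
      _ ≤ _ := by gcongr; exact hSTdiag j f
  have hS : ∀ j f, ‖(S j f).toL2‖ ≤ Real.sqrt C₀ * ‖f.toL2‖ := by
    intro j f
    refine norm_le_sqrt_mul_of_sq_le (norm_nonneg _) (norm_nonneg _) hC₀ ?_
    calc ‖(S j f).toL2‖ ^ 2 = ‖⟪(S j f).toL2, (S j f).toL2⟫_ℂ‖ := by
          rw [inner_self_eq_norm_sq_to_K]; simp
      _ = ‖⟪(T j (S j f)).toL2, f.toL2⟫_ℂ‖ := by rw [hadj]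
      _ ≤ ‖(T j (S j f)).toL2‖ * ‖f.toL2‖ := norm_inner_le_norm _ _
      _ ≤ (C₀ * ‖f.toL2‖) * ‖f.toL2‖ := by gcongr; exact hTSdiag j f
      _ = _ := by ring
  let e : ℕ → ℝ := fun j => Real.sqrt C₁ * (1 / 2) ^ j
  have he : ∀ j, 0 ≤ e j := fun j => by positivity
  have hee : ∀ i j, C₁ * (((2:ℝ) ^ i)⁻¹ * ((2:ℝ) ^ j)⁻¹) = e i * e j := by
    intro i j
    have := Real.mul_self_sqrt hC₁
    simp only [e, one_div, inv_pow]
    linear_combination (-((2:ℝ) ^ i)⁻¹ * ((2:ℝ) ^ j)⁻¹) * this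
  have hsum : ∀ F : Finset ℕ, ∑ j ∈ F, e j ≤ Real.sqrt C₁ * 2 := by
    intro F
    rw [← Finset.mul_sum]
    gcongr
    exact (summable_geometric_two.sum_le_tsum F fun j _ => by positivity).trans
      tsum_geometric_two.le
  let A : ℝ := Real.sqrt C₀ + Real.sqrt C₁ * 2
  have hA : 0 ≤ A := by positivity
  refine ⟨(m + 1) * A, by positivity, ?_⟩
  intro f hf hfc J
  let f' : TestFun n := ⟨f, hf, hfc⟩
  have hclass : ∀ r, ‖∑ j ∈ (Finset.range J).filter (fun j => j % (m + 1) = r), (T j f').toL2‖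
      ≤ A * ‖f'.toL2‖ := by
    intro r
    have hgap : ∀ i ∈ (Finset.range J).filter (fun j => j % (m + 1) = r),
        ∀ j ∈ (Finset.range J).filter (fun j => j % (m + 1) = r), j < i →
        (2:ℝ) ^ j * 2 ^ m ≤ 2 ^ i := by
      intro i hi j hj hij
      rw [Finset.mem_filter] at hi hj
      rw [← pow_add]
      refine pow_le_pow_right₀ (by norm_num) ?_
      have hd : (m + 1) ∣ i - j := (Nat.modEq_iff_dvd' hij.le).1 (hj.2.trans hi.2.symm)
      have := Nat.le_of_dvd (by omega) hd
      omega
    refine almost_orthogonal_sum_le (ι := TestFun.toL2) hadj (by positivity) (by positivity) he _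
      (hsum _) (fun j _ => hT j) (fun j _ => hS j) ?_ ?_ f'
    · intro i hi j hj hij g
      rw [← hee]
      exact TestFun.norm_conv_conv_le _ _ _ (by positivity)
        ((lintegral_enorm_convOp_conj_comm _ _).le.trans
        (hoff (2 ^ i) (2 ^ j) (one_le_pow₀ (by norm_num)) (hgap i hi j hj hij)))
    · intro i hi j hj hij g
      rw [← hee]
      exact TestFun.norm_conv_conv_le _ _ _ (by positivity)
        (hoff (2 ^ i) (2 ^ j) (one_le_pow₀ (by norm_num)) (hgap i hi j hj hij))
  have htot : ‖∑ j ∈ Finset.range J, (T j f').toL2‖ ≤ (m + 1) * A * ‖f'.toL2‖ := by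
    rw [← Finset.sum_fiberwise_of_maps_to (t := Finset.range (m + 1)) (g := fun j => j % (m + 1))
      (fun j _ => Finset.mem_range.2 (Nat.mod_lt _ (Nat.succ_pos m)))]
    refine (norm_sum_le _ _).trans ((Finset.sum_le_sum fun r _ => hclass r).trans (le_of_eq ?_))
    rw [Finset.sum_const, Finset.card_range, nsmul_eq_mul]
    push_cast
    ring
  have hae := TestFun.coeFn_sum_toL2 (Finset.range J) (fun j => T j f')
  have h1 : eLpNorm (fun p => ∑ j ∈ Finset.range J, convOp n a (waveKer n α β b (2 ^ j)) f p) 2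
      volume = ENNReal.ofReal ‖∑ j ∈ Finset.range J, (T j f').toL2‖ := by
    rw [Lp.norm_def, ENNReal.ofReal_toReal (Lp.eLpNorm_ne_top _)]
    exact (eLpNorm_congr_ae hae).symm
  rw [h1, ← ENNReal.ofReal_toReal f'.eLpNorm_ne_top, ← ENNReal.ofReal_mul (by positivity),
    ← TestFun.norm_toL2]
  exact ENNReal.ofReal_le_ofReal htot

end Sufficiency

section Profile

open scoped ContDiff

variable {n : ℕ} {a α β : ℝ} {χ : ℝ → ℝ}

lemma heisRho_pos {p : (Fin (2*n) → ℝ) × ℝ} (hp : p ≠ 0) : 0 < heisRho n p := by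
  rw [heisRho_eq]; exact Real.rpow_pos_of_pos (heisP_pos hp) _

lemma heisRho_pow_four (p : (Fin (2*n) → ℝ) × ℝ) : heisRho n p ^ 4 = heisP n p := by
  rw [heisRho_eq, ← Real.rpow_natCast, ← Real.rpow_mul (heisP_nonneg p)]
  norm_num

lemma heisRho_nonneg (p : (Fin (2*n) → ℝ) × ℝ) : 0 ≤ heisRho n p :=
  Real.rpow_nonneg (heisP_nonneg p) _

lemma heisRho_heisInv (p : (Fin (2*n) → ℝ) × ℝ) : heisRho n (heisInv n p) = heisRho n p := by
  rw [heisRho_eq, heisP_heisInv, heisRho_eq]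

lemma heisRho_heisDil {R : ℝ} (hR : 0 ≤ R) (p : (Fin (2*n) → ℝ) × ℝ) :
    heisRho n (heisDil n R p) = R * heisRho n p := by
  have := heisPhi_heisDil (n := n) (β := 1) hR p
  rwa [← heisRho_rpow, ← heisRho_rpow, Real.rpow_one, Real.rpow_one, Real.rpow_one] at this

lemma heisRho_eq_heisPhi : heisRho n = heisPhi n 1 := by
  funext q; rw [← heisRho_rpow, Real.rpow_one]

lemma heisRho_zero : heisRho n 0 = 0 := by
  rw [heisRho_eq, heisP_eq_zero.2 rfl]
  norm_num

/-- The profile of the annular pieces of the oscillating kernel. -/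
def annProfile (n : ℕ) (α : ℝ) (χ : ℝ → ℝ) (p : (Fin (2*n) → ℝ) × ℝ) : ℂ :=
  ((heisRho n p ^ (-(2*(n:ℝ) + 2 - α)) * (χ (heisRho n p)⁻¹ - χ (2 * (heisRho n p)⁻¹)) : ℝ) : ℂ)

lemma annProfile_heisInv (p : (Fin (2*n) → ℝ) × ℝ) :
    annProfile n α χ (heisInv n p) = annProfile n α χ p := by
  rw [annProfile, heisRho_heisInv, annProfile]

lemma eq_zero_of_one_le (hχsupp : Function.support χ ⊆ Set.Ioo (-1 : ℝ) 1) {r : ℝ} (hr : 1 ≤ r) :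
    χ r = 0 := by
  by_contra h
  have := (hχsupp h).2
  linarith

lemma annProfile_eq_zero_of_lt (hχsupp : Function.support χ ⊆ Set.Ioo (-1 : ℝ) 1)
    {p : (Fin (2*n) → ℝ) × ℝ} (hp : heisP n p < 1) : annProfile n α χ p = 0 := by
  by_cases h0 : p = 0
  · simp [annProfile, h0, heisRho_zero]
  · have h1 := heisRho_pos h0
    have h2 : heisRho n p < 1 := by
      rw [← heisRho_pow_four] at hp
      exact (pow_lt_one_iff_of_nonneg h1.le (by norm_num)).1 hp
    have h3 : 1 ≤ (heisRho n p)⁻¹ := (one_le_inv₀ h1).2 h2.le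
    simp [annProfile, eq_zero_of_one_le hχsupp h3,
      eq_zero_of_one_le hχsupp (show 1 ≤ 2 * (heisRho n p)⁻¹ by linarith)]

lemma exists_annProfile_support (hχone : ∀ᶠ r in nhds (0:ℝ), χ r = 1)
    (hχsupp : Function.support χ ⊆ Set.Ioo (-1 : ℝ) 1) :
    ∃ M : ℝ, ∀ p, ¬ (1 ≤ heisP n p ∧ heisP n p ≤ M) → annProfile n α χ p = 0 := by
  obtain ⟨δ, hδ, h⟩ := Metric.eventually_nhds_iff.1 hχone
  refine ⟨(2 / δ) ^ 4, fun p hp => ?_⟩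
  rcases lt_or_ge (heisP n p) 1 with h1 | h1
  · exact annProfile_eq_zero_of_lt hχsupp h1
  · have h2 : (2 / δ) ^ 4 < heisP n p := by
      by_contra h2
      exact hp ⟨h1, not_lt.1 h2⟩
    rw [← heisRho_pow_four] at h2
    have h3 : 2 / δ < heisRho n p := lt_of_pow_lt_pow_left₀ 4 (heisRho_nonneg p) h2
    have h4 : 0 < heisRho n p := lt_trans (by positivity) h3
    have h5 : 2 * (heisRho n p)⁻¹ < δ := by
      rw [div_lt_iff₀ hδ] at h3
      rw [← div_eq_mul_inv, div_lt_iff₀ h4]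
      linarith
    have h6 : 0 < (heisRho n p)⁻¹ := by positivity
    have e1 : χ (heisRho n p)⁻¹ = 1 := h (by
      rw [Real.dist_eq, sub_zero, abs_of_pos h6]; linarith)
    have e2 : χ (2 * (heisRho n p)⁻¹) = 1 := h (by
      rw [Real.dist_eq, sub_zero, abs_of_pos (by linarith)]; exact h5)
    simp [annProfile, e1, e2]

lemma contDiff_annProfile (hχsm : ContDiff ℝ ∞ χ)
    (hχsupp : Function.support χ ⊆ Set.Ioo (-1 : ℝ) 1) : ContDiff ℝ ∞ (annProfile n α χ) := by
  rw [contDiff_iff_contDiffAt]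
  intro p
  by_cases hp : p = 0
  · have hev : annProfile n α χ =ᶠ[nhds p] fun _ => 0 := by
      have : ∀ᶠ q in nhds p, heisP n q < 1 := by
        refine continuous_heisP.continuousAt.eventually_lt continuousAt_const ?_
        rw [hp, heisP_eq_zero.2 rfl]
        norm_num
      filter_upwards [this] with q hq using annProfile_eq_zero_of_lt hχsupp hq
    exact contDiffAt_const.congr_of_eventuallyEq hev
  · have hρ : ContDiffAt ℝ ∞ (heisRho n) p := by
      rw [heisRho_eq_heisPhi]; exact contDiffAt_heisPhi hp
    have hne := (heisRho_pos hp).ne'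
    refine Complex.ofRealCLM.contDiff.contDiffAt.comp p ?_
    exact (hρ.rpow_const_of_ne hne).mul ((hχsm.contDiffAt.comp p (hρ.inv hne)).sub
      (hχsm.contDiffAt.comp p (contDiffAt_const.mul (hρ.inv hne))))

lemma waveKer_annProfile {R : ℝ} (hR : 0 < R) (p : (Fin (2*n) → ℝ) × ℝ) :
    waveKer n α β (annProfile n α χ) R p
      = ((heisRho n p ^ (-(2*(n:ℝ) + 2 - α)) : ℝ) : ℂ)
        * Complex.exp (Complex.I * ((heisRho n p ^ β : ℝ) : ℂ))
        * ((χ (R * (heisRho n p)⁻¹) : ℂ) - χ (2 * R * (heisRho n p)⁻¹)) := by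
  rw [waveKer, annProfile, heisRho_heisDil (by positivity), heisRho_rpow p β,
    Real.mul_rpow (by positivity) (heisRho_nonneg p), Real.inv_rpow hR.le, Real.rpow_neg hR.le,
    inv_inv, mul_inv, inv_inv]
  have e : (R : ℝ) ^ (α - (2 * n + 2 : ℕ)) * R ^ (2 * (n:ℝ) + 2 - α) = 1 := by
    rw [← Real.rpow_add hR]
    push_cast
    ring_nf
    exact Real.rpow_zero R
  have e' : ((R ^ (α - (2 * n + 2 : ℕ)) : ℝ) : ℂ) * ((R ^ (2 * (n:ℝ) + 2 - α) : ℝ) : ℂ) = 1 := by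
    exact_mod_cast e
  rw [mul_assoc 2 R, Complex.ofReal_mul, Complex.ofReal_mul, Complex.ofReal_sub]
  linear_combination (Complex.exp (Complex.I * (heisPhi n β p : ℝ))
    * ((heisRho n p ^ (-(2*(n:ℝ) + 2 - α)) : ℝ) : ℂ)
    * ((χ (R * (heisRho n p)⁻¹) : ℂ) - χ (2 * (R * (heisRho n p)⁻¹)))) * e'

lemma sum_waveKer_eq_Lker (hχsupp : Function.support χ ⊆ Set.Ioo (-1 : ℝ) 1)
    {p : (Fin (2*n) → ℝ) × ℝ} (hp : p ≠ 0) {J : ℕ} (hJ : heisRho n p ≤ 2 ^ J) :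
    ∑ j ∈ Finset.range J, waveKer n α β (annProfile n α χ) (2 ^ j) p = Lker n α β χ p := by
  have h1 : ∀ j : ℕ, waveKer n α β (annProfile n α χ) (2 ^ j) p
      = ((heisRho n p ^ (-(2*(n:ℝ) + 2 - α)) : ℝ) : ℂ)
        * Complex.exp (Complex.I * ((heisRho n p ^ β : ℝ) : ℂ))
        * ((χ (2 ^ j * (heisRho n p)⁻¹) : ℂ) - χ (2 ^ (j + 1) * (heisRho n p)⁻¹)) := by
    intro j
    rw [waveKer_annProfile (by positivity), ← pow_succ']
  simp_rw [h1]
  rw [← Finset.mul_sum, Finset.sum_range_sub' (fun j => ((χ (2 ^ j * (heisRho n p)⁻¹) : ℝ) : ℂ)),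
    eq_zero_of_one_le hχsupp (r := 2 ^ J * (heisRho n p)⁻¹)]
  · simp [Lker]
  · rw [← div_eq_mul_inv, one_le_div (heisRho_pos hp)]
    exact hJ

/-- On compactly supported functions, the dyadic partial sums are eventually equal to the full
convolution operator. -/
lemma eventually_sum_convOp_eq (hβ : 0 < β) (hχsm : ContDiff ℝ ∞ χ)
    (hχone : ∀ᶠ r in nhds (0:ℝ), χ r = 1)
    (hχsupp : Function.support χ ⊆ Set.Ioo (-1 : ℝ) 1)
    {f : (Fin (2*n) → ℝ) × ℝ → ℂ} (hf : Continuous f) (hfc : HasCompactSupport f)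
    (p : (Fin (2*n) → ℝ) × ℝ) :
    ∀ᶠ J in Filter.atTop, ∑ j ∈ Finset.range J,
      convOp n a (waveKer n α β (annProfile n α χ) (2 ^ j)) f p
        = convOp n a (Lker n α β χ) f p := by
  have hρ : Continuous (heisRho n) := by
    rw [heisRho_eq_heisPhi]; exact continuous_heisPhi one_pos
  obtain ⟨B, hB⟩ := hfc.isCompact.exists_bound_of_continuousOn
    (f := fun q => heisRho n (heisDiv n a p q))
    (hρ.comp (by fun_prop)).continuousOn
  have htop : Filter.Tendsto (fun J : ℕ => (2:ℝ) ^ J) Filter.atTop Filter.atTop :=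
    tendsto_pow_atTop_atTop_of_one_lt (by norm_num)
  filter_upwards [htop.eventually_ge_atTop B] with J hJ
  have hb := contDiff_annProfile (n := n) (α := α) hχsm hχsupp
  have hcont : ∀ j : ℕ, Continuous (waveKer n α β (annProfile n α χ) (2 ^ j)) :=
    fun j => continuous_waveKer hβ hb.continuous _
  simp_rw [convOp_eq]
  rw [← integral_finset_sum]
  · refine integral_congr_ae ?_
    have hae : ∀ᵐ q : HeisSpace n, q ≠ p := by
      rw [ae_iff]; simp
    filter_upwards [hae] with q hq
    rw [← Finset.sum_mul]
    by_cases hfq : f q = 0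
    · rw [hfq, mul_zero, mul_zero]
    · rw [sum_waveKer_eq_Lker hχsupp]
      · intro h
        refine hq ?_
        have := heisDiv_heisMul_cancel (a := a) p q
        rw [h] at this
        rw [← this]
        simp [heisMul]
      · exact ((le_abs_self _).trans (hB q (subset_tsupport _ hfq))).trans hJ
  · intro j _
    refine Continuous.integrable_of_hasCompactSupport ?_ (hfc.mul_left)
    exact ((hcont j).comp (by fun_prop)).mul hf

theorem isL2Bounded_Lker (ha : a ≠ 0) (hβ : 2 < β) (hαβ : α ≤ (n + 1/2) * β)
    (hχsm : ContDiff ℝ ∞ χ) (hχone : ∀ᶠ r in nhds (0:ℝ), χ r = 1)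
    (hχsupp : Function.support χ ⊆ Set.Ioo (-1 : ℝ) 1) : IsL2Bounded n a (Lker n α β χ) := by
  obtain ⟨M, hbz⟩ := exists_annProfile_support (n := n) (α := α) hχone hχsupp
  have hb := contDiff_annProfile (n := n) (α := α) hχsm hχsupp
  obtain ⟨C, hC, h⟩ := exists_bound_sum_waveKer ha hβ hαβ hb annProfile_heisInv hbz
  refine ⟨C + 1, by linarith, fun f hf hfc => ?_⟩
  have hcont : ∀ j : ℕ, Continuous (waveKer n α β (annProfile n α χ) (2 ^ j)) :=
    fun j => continuous_waveKer (by linarith) hb.continuous _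
  have hlim := Lp.eLpNorm_lim_le_liminf_eLpNorm (p := 2) (μ := (volume : Measure (HeisSpace n)))
    (f := fun J p => ∑ j ∈ Finset.range J,
      convOp n a (waveKer n α β (annProfile n α χ) (2 ^ j)) f p)
    (fun J => (continuous_finset_sum _ fun j _ =>
      convOp_continuous (hcont j) hf.continuous hfc).aestronglyMeasurable)
    (convOp n a (Lker n α β χ) f)
    (Filter.Eventually.of_forall fun p => tendsto_const_nhds.congr' (by
      filter_upwards [eventually_sum_convOp_eq (a := a) (α := α) (by linarith : 0 < β) hχsm hχone
        hχsupp hf.continuous hfc p] with J hJ using hJ.symm))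
  refine hlim.trans ((Filter.liminf_le_of_frequently_le' (Filter.Eventually.of_forall fun J =>
    h f hf.continuous hfc J).frequently).trans ?_)
  gcongr
  linarith

end Profile

section Necessity

open scoped ContDiff

variable {n : ℕ} {a α β : ℝ} {χ : ℝ → ℝ}

lemma heisP_base : heisP n ((0 : Fin (2*n) → ℝ), (1:ℝ)) = 1 := by simp [heisP]

lemma exists_local_phase_control (a β s : ℝ) : ∃ r > 0, ∃ K > 0,
    ∀ p ∈ Metric.ball ((0 : Fin (2*n) → ℝ), (1:ℝ)) r, ∀ q, ‖q‖ < r →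
      |heisPhi n β (heisDiv n a p q) - heisPhi n β p| ≤ K * ‖q‖
      ∧ 1/2 ≤ heisRho n (heisDiv n a p q) ∧ 1/2 ≤ heisRho n (heisDiv n a p q) ^ s
      ∧ heisRho n (heisDiv n a p q) ^ s ≤ 2 := by
  let x₀ : HeisSpace n × HeisSpace n := (((0 : Fin (2*n) → ℝ), (1:ℝ)), 0)
  let dv : HeisSpace n × HeisSpace n → HeisSpace n := fun x => heisDiv n a x.1 x.2
  have hdv : ContDiff ℝ ∞ dv := by
    simp only [dv]
    fun_prop
  have hx₀ : dv x₀ = ((0 : Fin (2*n) → ℝ), (1:ℝ)) := by simp only [dv, x₀, heisDiv_zero]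
  have hne : dv x₀ ≠ 0 := by
    rw [hx₀]
    intro h
    simpa using congrArg Prod.snd h
  have hphi : ∀ t : ℝ, ContDiffAt ℝ 1 (fun x => heisPhi n t (dv x)) x₀ := fun t =>
    (contDiffAt_heisPhi (m := 1) hne).comp x₀ (hdv.contDiffAt.of_le (by simp))
  have hphi1 : ∀ t : ℝ, heisPhi n t (dv x₀) = 1 := by
    intro t
    rw [heisPhi, hx₀, heisP_base, Real.one_rpow]
  obtain ⟨K, t, ht, hK⟩ := (hphi β).exists_lipschitzOnWith
  have h1 : ∀ᶠ x in nhds x₀, 1/2 < heisPhi n 1 (dv x) :=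
    continuousAt_const.eventually_lt (hphi 1).continuousAt (by rw [hphi1]; norm_num)
  have h2 : ∀ᶠ x in nhds x₀, 1/2 < heisPhi n s (dv x) :=
    continuousAt_const.eventually_lt (hphi s).continuousAt (by rw [hphi1]; norm_num)
  have h3 : ∀ᶠ x in nhds x₀, heisPhi n s (dv x) < 2 :=
    (hphi s).continuousAt.eventually_lt continuousAt_const (by rw [hphi1]; norm_num)
  obtain ⟨r, hr, hball⟩ := Metric.eventually_nhds_iff_ball.1 (((h1.and h2).and h3).and ht)
  refine ⟨r, hr, K + 1, by positivity, fun p hp q hq => ?_⟩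
  have hpq : (p, q) ∈ Metric.ball x₀ r := by
    rw [Metric.mem_ball, Prod.dist_eq]
    exact max_lt hp (by simpa [x₀] using hq)
  have hp0 : (p, (0 : HeisSpace n)) ∈ Metric.ball x₀ r := by
    rw [Metric.mem_ball, Prod.dist_eq]
    exact max_lt hp (by simpa [x₀] using hr)
  obtain ⟨⟨⟨e1, e2⟩, e3⟩, e4⟩ := hball _ hpq
  have e5 := (hball _ hp0).2
  rw [← heisRho_rpow] at e1 e2 e3
  rw [Real.rpow_one] at e1
  refine ⟨?_, e1.le, e2.le, e3.le⟩
  have := hK.dist_le_mul _ e4 _ e5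
  simp only [dv, heisDiv_zero, Real.dist_eq, Prod.dist_eq, dist_self, dist_zero_right] at this
  rw [max_eq_right (norm_nonneg _)] at this
  refine this.trans ?_
  gcongr
  linarith

lemma Lker_heisDil {R : ℝ} (hR : 0 < R) (u : (Fin (2*n) → ℝ) × ℝ) :
    Lker n α β χ (heisDil n R u)
      = ((R ^ (-(2*(n:ℝ) + 2 - α)) * heisRho n u ^ (-(2*(n:ℝ) + 2 - α)) * χ (R * heisRho n u)⁻¹ : ℝ)
          : ℂ) * Complex.exp (Complex.I * ((R ^ β * heisPhi n β u : ℝ) : ℂ)) := by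
  rw [Lker, heisRho_heisDil hR.le, Real.mul_rpow hR.le (heisRho_nonneg u),
    Real.mul_rpow hR.le (heisRho_nonneg u), ← heisRho_rpow]
  push_cast
  ring

lemma measurable_Lker (hχ : Continuous χ) : Measurable (Lker n α β χ) := by
  have hρ : Measurable (heisRho n) := by
    have : heisRho n = fun p => heisP n p ^ ((1:ℝ)/4) := rfl
    rw [this]
    exact continuous_heisP.measurable.pow_const _
  have h1 : Measurable fun p => χ (heisRho n p)⁻¹ := hχ.measurable.comp hρ.inv
  unfold Lker
  exact ((Complex.measurable_ofReal.comp (hρ.pow_const _)).mul (Complex.measurable_exp.comp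
    ((Complex.measurable_ofReal.comp (hρ.pow_const _)).const_mul Complex.I))).mul
    (Complex.measurable_ofReal.comp h1)

/-- The rescaled test functions at scale `R`. -/
def focused (n : ℕ) (β : ℝ) (g : HeisSpace n → ℝ) (R : ℝ) (q : HeisSpace n) : ℂ :=
  ((g (R ^ β • heisDil n R⁻¹ q) : ℝ) : ℂ)

lemma focused_heisDil (g : HeisSpace n → ℝ) {R : ℝ} (hR : 0 < R) (q : HeisSpace n) :
    focused n β g R (heisDil n R q) = ((g (R ^ β • q) : ℝ) : ℂ) := by
  rw [focused, heisDil_heisDil, inv_mul_cancel₀ hR.ne', heisDil_one]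

lemma contDiff_focused {g : HeisSpace n → ℝ} (hg : ContDiff ℝ ∞ g) (R : ℝ) :
    ContDiff ℝ ∞ (focused n β g R) := by
  refine Complex.ofRealCLM.contDiff.comp (hg.comp ?_)
  fun_prop

lemma hasCompactSupport_focused {g : HeisSpace n → ℝ} (hg : HasCompactSupport g) {R : ℝ}
    (hR : 0 < R) : HasCompactSupport (focused n β g R) := by
  refine HasCompactSupport.intro (hg.isCompact.image
    (f := fun q => heisDil n R ((R ^ β)⁻¹ • q)) (by fun_prop)) fun q hq => ?_
  by_contra h
  refine hq ⟨R ^ β • heisDil n R⁻¹ q, subset_tsupport _ ?_, ?_⟩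
  · intro h0
    exact h (by rw [focused, h0, Complex.ofReal_zero])
  · have hl : 0 < R ^ β := by positivity
    simp only
    rw [smul_smul, inv_mul_cancel₀ hl.ne', one_smul, heisDil_heisDil, mul_inv_cancel₀ hR.ne',
      heisDil_one]

lemma integral_smul_heisSpace (g : HeisSpace n → ℝ) {l : ℝ} (hl : 0 < l) :
    ∫ q, g (l • q) = (l ^ (2 * n + 1))⁻¹ * ∫ q, g q := by
  have := Measure.integral_comp_smul (volume : Measure (HeisSpace n)) g l
  have hfr : Module.finrank ℝ (HeisSpace n) = 2 * n + 1 := by simp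
  rw [this, hfr, abs_of_pos (by positivity), smul_eq_mul]

/-- Focusing: on a fixed dilated ball the phases of the oscillating kernel align. -/
theorem exists_lower_bound_convOp_focused (hχsm : ContDiff ℝ ∞ χ)
    (hχone : ∀ᶠ r in nhds (0:ℝ), χ r = 1) (hβ : 0 < β) :
    ∃ r > 0, ∃ g : HeisSpace n → ℝ, ContDiff ℝ ∞ g ∧ HasCompactSupport g ∧ (∀ q, 0 ≤ g q) ∧
      (∀ q, g q ≤ 1) ∧ 0 < ∫ q, g q ∧ ∃ R₀ ≥ (1:ℝ), ∀ R ≥ R₀,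
      ∀ p ∈ Metric.ball ((0 : Fin (2*n) → ℝ), (1:ℝ)) r,
        R ^ α * ((R ^ β) ^ (2 * n + 1))⁻¹ * ((∫ q, g q) / 4)
          ≤ ‖convOp n a (Lker n α β χ) (focused n β g R) (heisDil n R p)‖ := by
  set s : ℝ := -(2*(n:ℝ) + 2 - α) with hs
  obtain ⟨r, hr, K, hK, hloc⟩ := exists_local_phase_control (n := n) a β s
  let c : ℝ := min r K⁻¹
  have hc : 0 < c := lt_min hr (by positivity)
  let g : ContDiffBump (0 : HeisSpace n) := ⟨c / 2, c, by positivity, by linarith⟩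
  have hgint : 0 < ∫ q, g q := g.integral_pos
  obtain ⟨δ, hδ, hχδ⟩ := Metric.eventually_nhds_iff.1 hχone
  refine ⟨r, hr, g, g.contDiff, g.hasCompactSupport, fun q => g.nonneg, fun q => g.le_one, hgint,
    max 1 (4 / δ), le_max_left _ _, fun R hR p hp => ?_⟩
  have hR1 : 1 ≤ R := (le_max_left _ _).trans hR
  have hRδ : 4 / δ ≤ R := (le_max_right _ _).trans hR
  have hR0 : 0 < R := by linarith
  set l := R ^ β with hl
  have hl1 : 1 ≤ l := Real.one_le_rpow hR1 hβ.le
  have hl0 : 0 < l := by linarith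
  have hsmall : ∀ q, g (l • q) ≠ 0 → l * ‖q‖ < c := by
    intro q hq
    by_contra h
    refine hq (g.zero_of_le_dist ?_)
    rw [dist_zero_right, norm_smul, Real.norm_of_nonneg hl0.le]
    exact not_lt.1 h
  have hfacts : ∀ q, g (l • q) ≠ 0 →
      |l * heisPhi n β (heisDiv n a p q) - l * heisPhi n β p| ≤ 1
      ∧ 1/2 ≤ heisRho n (heisDiv n a p q) ^ s ∧ heisRho n (heisDiv n a p q) ^ s ≤ 2
      ∧ χ (R * heisRho n (heisDiv n a p q))⁻¹ = 1 := by
    intro q hq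
    have h1 := hsmall q hq
    have h2 : ‖q‖ < r := lt_of_le_of_lt (le_mul_of_one_le_left (norm_nonneg q) hl1)
      (h1.trans_le (min_le_left _ _))
    obtain ⟨e1, e2, e3, e4⟩ := hloc p hp q h2
    refine ⟨?_, e3, e4, hχδ ?_⟩
    · rw [← mul_sub, abs_mul, abs_of_pos hl0]
      calc l * |heisPhi n β (heisDiv n a p q) - heisPhi n β p| ≤ l * (K * ‖q‖) := by gcongr
        _ = K * (l * ‖q‖) := by ring
        _ ≤ K * K⁻¹ := by gcongr; exact h1.le.trans (min_le_right _ _)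
        _ = 1 := mul_inv_cancel₀ hK.ne'
    · have hx : 0 < R * heisRho n (heisDiv n a p q) := by nlinarith
      rw [Real.dist_eq, sub_zero, abs_of_pos (by positivity), inv_lt_comm₀ hx hδ]
      rw [div_le_iff₀ hδ] at hRδ
      rw [inv_eq_one_div, div_lt_iff₀ hδ]
      nlinarith
  set D : HeisSpace n → ℂ := fun q => Complex.exp (-(Complex.I * ((l * heisPhi n β p : ℝ) : ℂ)))
    * (Lker n α β χ (heisDil n R (heisDiv n a p q)) * ((g (l • q) : ℝ) : ℂ)) with hD
  have hDeq : ∀ q, D q = ((R ^ s * heisRho n (heisDiv n a p q) ^ s * g (l • q) : ℝ) : ℂ)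
      * Complex.exp (((l * heisPhi n β (heisDiv n a p q) - l * heisPhi n β p : ℝ) : ℂ)
        * Complex.I) := by
    intro q
    simp only [hD]
    by_cases hq : g (l • q) = 0
    · simp [hq]
    · rw [Lker_heisDil hR0, (hfacts q hq).2.2.2, mul_one, Complex.ofReal_sub, sub_mul,
        Complex.exp_sub, Complex.exp_neg, mul_comm Complex.I, mul_comm Complex.I]
      push_cast
      ring
  have hRs : 0 < R ^ s := by positivity
  have hgl : Integrable fun q : HeisSpace n => g (l • q) := g.integrable.comp_smul hl0.ne'
  have hDint : Integrable D := by
    refine Integrable.mono' (hgl.const_mul (R ^ s * 2)) ?_ (Filter.Eventually.of_forall fun q => ?_)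
    · refine Measurable.aestronglyMeasurable (Measurable.const_mul (Measurable.mul ?_ ?_) _)
      · refine (measurable_Lker hχsm.continuous).comp (Continuous.measurable ?_)
        fun_prop
      · exact (Complex.continuous_ofReal.comp (g.continuous.comp (by fun_prop))).measurable
    · rw [hDeq, norm_mul, Complex.norm_exp_ofReal_mul_I, mul_one, Complex.norm_real,
        Real.norm_of_nonneg (mul_nonneg (mul_nonneg hRs.le (Real.rpow_nonneg (heisRho_nonneg _) _))
          g.nonneg)]
      by_cases hq : g (l • q) = 0
      · simp [hq]
      · have := (hfacts q hq).2.2.1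
        have hg0 := g.nonneg (x := l • q)
        gcongr
  have hDre : ∀ q, R ^ s / 4 * g (l • q) ≤ RCLike.re (D q) := by
    intro q
    rw [hDeq, RCLike.re_eq_complex_re, Complex.re_ofReal_mul, Complex.exp_ofReal_mul_I_re]
    by_cases hq : g (l • q) = 0
    · simp [hq]
    · obtain ⟨e1, e2, -, -⟩ := hfacts q hq
      have hg0 := g.nonneg (x := l • q)
      set θ := l * heisPhi n β (heisDiv n a p q) - l * heisPhi n β p
      have hcos : 1/2 ≤ Real.cos θ := by
        have h1 := Real.one_sub_sq_div_two_le_cos (x := θ)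
        have h2 : θ ^ 2 ≤ 1 := by rw [← sq_abs]; exact pow_le_one₀ (abs_nonneg _) e1
        linarith
      calc R ^ s / 4 * g (l • q) = (R ^ s * (1/2) * g (l • q)) * (1/2) := by ring
        _ ≤ _ := by gcongr
  have hlow : R ^ s / 4 * ((l ^ (2 * n + 1))⁻¹ * ∫ q, g q) ≤ ‖∫ q, D q‖ := by
    rw [← integral_smul_heisSpace g hl0, ← integral_const_mul]
    refine (integral_mono (hgl.const_mul _) hDint.re hDre).trans ?_
    rw [integral_re hDint]
    exact RCLike.re_le_norm _
  have hconv : ‖convOp n a (Lker n α β χ) (focused n β g R) (heisDil n R p)‖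
      = R ^ (2 * n + 2) * ‖∫ q, D q‖ := by
    rw [convOp_eq, integral_comp_heisDil hR0, norm_mul, norm_pow, Complex.norm_real,
      Real.norm_of_nonneg hR0.le, hD, integral_const_mul, norm_mul, ← mul_neg,
      ← Complex.ofReal_neg, Complex.norm_exp_I_mul_ofReal, one_mul]
    simp_rw [heisDiv_heisDil, focused_heisDil _ hR0]
    rfl
  rw [hconv]
  refine le_trans (le_of_eq ?_) (mul_le_mul_of_nonneg_left hlow (by positivity))
  have hRα : R ^ α = R ^ (2 * n + 2) * R ^ s := by
    rw [← Real.rpow_natCast, ← Real.rpow_add hR0]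
    congr 1
    push_cast [hs]
    ring
  rw [hRα]
  ring

theorem le_of_isL2Bounded_Lker (hβ : 0 < β) (hχsm : ContDiff ℝ ∞ χ)
    (hχone : ∀ᶠ r in nhds (0:ℝ), χ r = 1) (h : IsL2Bounded n a (Lker n α β χ)) :
    α ≤ (n + 1/2) * β := by
  obtain ⟨C, hC, hbd⟩ := h
  obtain ⟨r, hr, g, hg, hgc, hg0, hg1, hG, R₀, hR₀, hlow⟩ :=
    exists_lower_bound_convOp_focused (n := n) (a := a) (α := α) hχsm hχone hβ
  set G := ∫ q, g q
  set V := (volume (Metric.ball ((0 : Fin (2*n) → ℝ), (1:ℝ)) r)).toReal with hV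
  have hVfin : volume (Metric.ball ((0 : Fin (2*n) → ℝ), (1:ℝ)) r) ≠ ⊤ := measure_ball_lt_top.ne
  have hV0 : 0 < V := ENNReal.toReal_pos (Metric.measure_ball_pos volume _ hr).ne' hVfin
  by_contra! hlt
  have hpos : 0 < 2 * α - β * (2 * n + 1) := by linarith
  have key : ∀ R ≥ R₀, R ^ (2 * α - β * (2 * n + 1)) ≤ 16 * C ^ 2 / (G * V) := by
    intro R hR
    have hR0 : 0 < R := by linarith
    have hl0 : 0 < R ^ β := by positivity
    set A := R ^ α * ((R ^ β) ^ (2 * n + 1))⁻¹ * (G / 4) with hA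
    have hA0 : 0 ≤ A := by positivity
    have h1 := hbd _ (contDiff_focused (β := β) hg R) (hasCompactSupport_focused hgc hR0)
    have h2 := pow_le_pow_left₀ zero_le h1 2
    rw [mul_pow, eLpNorm_two_sq, eLpNorm_two_sq, lintegral_comp_heisDil hR0,
      lintegral_comp_heisDil hR0 (fun p => ‖focused n β g R p‖ₑ ^ 2)] at h2
    have h3 : ENNReal.ofReal (A ^ 2 * V)
        ≤ ∫⁻ p, ‖convOp n a (Lker n α β χ) (focused n β g R) (heisDil n R p)‖ₑ ^ 2 := by
      calc ENNReal.ofReal (A ^ 2 * V)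
          = ∫⁻ _ in Metric.ball ((0 : Fin (2*n) → ℝ), (1:ℝ)) r, ENNReal.ofReal A ^ 2 := by
            rw [setLIntegral_const, ENNReal.ofReal_mul (by positivity), hV,
              ENNReal.ofReal_toReal hVfin, ENNReal.ofReal_pow hA0]
        _ ≤ ∫⁻ p in Metric.ball ((0 : Fin (2*n) → ℝ), (1:ℝ)) r,
              ‖convOp n a (Lker n α β χ) (focused n β g R) (heisDil n R p)‖ₑ ^ 2 := by
            refine setLIntegral_mono' Metric.isOpen_ball.measurableSet fun p hp => ?_
            rw [← ofReal_norm]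
            gcongr
            exact hlow R hR p hp
        _ ≤ _ := setLIntegral_le_lintegral _ _
    have h4 : ∫⁻ p, ‖focused n β g R (heisDil n R p)‖ₑ ^ 2
        ≤ ENNReal.ofReal (((R ^ β) ^ (2 * n + 1))⁻¹ * G) := by
      have hgint : Integrable g := hg.continuous.integrable_of_hasCompactSupport hgc
      rw [← integral_smul_heisSpace g hl0, ofReal_integral_eq_lintegral_ofReal
        (hgint.comp_smul hl0.ne') (Filter.Eventually.of_forall fun q => hg0 _)]
      refine lintegral_mono fun q => ?_
      rw [focused_heisDil _ hR0, ← ofReal_norm, Complex.norm_real, Real.norm_of_nonneg (hg0 _),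
        ← ENNReal.ofReal_pow (hg0 _)]
      exact ENNReal.ofReal_le_ofReal (pow_le_of_le_one (hg0 _) (hg1 _) two_ne_zero)
    have h5 : ENNReal.ofReal (R ^ (2 * n + 2)) * ENNReal.ofReal (A ^ 2 * V)
        ≤ ENNReal.ofReal C ^ 2 * (ENNReal.ofReal (R ^ (2 * n + 2))
          * ENNReal.ofReal (((R ^ β) ^ (2 * n + 1))⁻¹ * G)) := by
      refine (mul_le_mul_right h3 _).trans (h2.trans ?_)
      gcongr
    rw [← ENNReal.ofReal_pow hC.le, ← ENNReal.ofReal_mul (by positivity),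
      ← ENNReal.ofReal_mul (by positivity), ← ENNReal.ofReal_mul (by positivity),
      ENNReal.ofReal_le_ofReal_iff (by positivity)] at h5
    have e1 : (R ^ β) ^ (2 * n + 1) = R ^ (β * (2 * n + 1)) := by
      rw [← Real.rpow_natCast, ← Real.rpow_mul hR0.le]
      push_cast
      rfl
    have e2 : R ^ (2 * α - β * (2 * n + 1)) = (R ^ α) ^ 2 * ((R ^ β) ^ (2 * n + 1))⁻¹ := by
      rw [e1, Real.rpow_sub hR0, two_mul α, Real.rpow_add hR0]
      ring
    rw [e2, le_div_iff₀ (by positivity)]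
    have hRQ : 0 < R ^ (2 * n + 2) := by positivity
    set Y := (R ^ β) ^ (2 * n + 1)
    have hY : 0 < Y := by positivity
    rw [hA] at h5
    have h6 : (R ^ (2 * n + 2) * Y⁻¹ * G / 16) * ((R ^ α) ^ 2 * Y⁻¹ * (G * V))
        ≤ (R ^ (2 * n + 2) * Y⁻¹ * G / 16) * (16 * C ^ 2) := by
      nlinarith [h5]
    exact le_of_mul_le_mul_left h6 (by positivity)
  obtain ⟨R, hR1, hR2⟩ := ((tendsto_rpow_atTop hpos).eventually_gt_atTop
    (16 * C ^ 2 / (G * V))).and (Filter.eventually_ge_atTop R₀) |>.exists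
  exact absurd (key R hR2) (not_le.2 hR1)

end Necessity

/-- For `β > 2`, `T_{L_{α,β}}` is bounded on `L²(ℍⁿ_a)` iff `α ≤ (n+1/2)β`. -/
theorem oscillating_L2_beta_gt_two
    (n : ℕ) (hn : 1 ≤ n) (a : ℝ) (ha : a ≠ 0) (α β : ℝ) (hα : 0 < α)
    (hβ : 2 < β)
    (χ : ℝ → ℝ) (hχsm : ContDiff ℝ (⊤ : ℕ∞) χ) (hχc : HasCompactSupport χ)
    (hχone : ∀ᶠ r in nhds (0:ℝ), χ r = 1)
    (hχsupp : Function.support χ ⊆ Set.Ioo (-1 : ℝ) 1) :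
    IsL2Bounded n a (Lker n α β χ) ↔ α ≤ ((n : ℝ) + 1/2) * β := by
  refine ⟨fun h => le_of_isL2Bounded_Lker (by linarith) hχsm hχone h, fun h => ?_⟩
  exact isL2Bounded_Lker ha hβ h hχsm hχone hχsupp

end
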